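/- Let n, l, m ≥ 0 be integers, let p, q ∈ ℂ with 0 < |p| < 1, 0 < |q| < 1, and let u_0,...,u_{2n+3} ∈ ℂ be nonzero with ∏_{r=0}^{2n+3} u_r = pq, |u_r| < 1 for all r, and |u_0| < |p|^l |q|^m. Let x_1,...,x_l, y_1,...,y_m ∈ ℂ be nonzero with θ(x_i²;q) ≠ 0 for all i, θ(x_i x_j;q) ≠ 0 and θ(x_i/x_j;q) ≠ 0 for i < j, θ(y_i²;p) ≠ 0 for all i, θ(y_i y_j;p) ≠ 0 and θ(y_i/y_j;p) ≠ 0 for i < j, and assume θ(pq/(u_0 u_r);p,q)_{l,m} ≠ 0 for 1 ≤ r ≤ 2n+3. Define f(z_1,...,z_n) := ∏_{i=1}^{n} ( ∏_{j=1}^{l} x_j^{−1} θ(x_j z_i;q) θ(x_j/z_i;q) · ∏_{j=1}^{m} y_j^{−1} θ(y_j z_i;p) θ(y_j/z_i;p) ) / ( θ(pq z_i/u_0;p,q)_{l,m} · θ(pq/(z_i u_0);p,q)_{l,m} ). Then ((p;p)_∞ (q;q)_∞)^n/(2^n · n!) · (1/(2π)^n) ∫_{[0,2π]^n} f(z_1,...,z_n)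 · ∏_{i=1}^{n} ∏_{r=0}^{2n+3} Γ(u_r z_i^{±1};p,q) / ( ∏_{1≤i<j≤n} Γ(z_i^{±1} z_j^{±1};p,q) · ∏_{i=1}^{n} Γ(z_i^{±2};p,q) ) dθ₁⋯dθₙ (with z_i = e^{iθ_i}) equals ∏_{0≤r<s≤2n+3} Γ(u_r u_s;p,q) · ∏_{r=1}^{2n+3} θ(pq/(u_0 u_r);p,q)_{l,m}^{−1} · S_x · S_y, where S_x := Σ_{σ∈{±1}^l} ∏_{i=1}^{l} ( θ(p^{−l} u_0 x_i^{σ_i};q) · ∏_{r=1}^{2n+3} θ(u_r x_i^{σ_i};q) ) / ( x_i^{n σ_i} θ(x_i^{2σ_i};q) ) · ∏_{1≤i<j≤l} θ(p x_i^{σ_i} x_j^{σ_j};q)/θ(x_i^{σ_i} x_j^{σ_j};q), and S_y := Σ_{σ∈{±1}^m} ∏_{i=1}^{m} ( θ(q^{−m} u_0 y_i^{σ_i};p) · ∏_{r=1}^{2n+3} θ(u_r y_i^{σ_i};p) ) / ( y_i^{n σ_i} θ(y_i^{2σ_i};p) ) · ∏_{1≤i<j≤m} θ(q y_i^{σ_i}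 y_j^{σ_j};p)/θ(y_i^{σ_i} y_j^{σ_j};p). -/

import Mathlib

open scoped BigOperators Real
open MeasureTheory

/-- The theta function `θ(x;p)`. -/
noncomputable def ellTheta (x p : ℂ) : ℂ :=
  ∏' k : ℕ, ((1 - p ^ k * x) * (1 - p ^ (k + 1) / x))

/-- The elliptic `q`-symbol `θ(x;p,q)_{l,m}`. -/
noncomputable def ellThetaPQ (x p q : ℂ) (l m : ℕ) : ℂ :=
  (∏ k ∈ Finset.range l, ellTheta (p ^ k * x) q) * ∏ k ∈ Finset.range m, ellTheta (q ^ k * x) p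

/-- The elliptic Gamma function `Γ(x;p,q)`. -/
noncomputable def ellGamma (x p q : ℂ) : ℂ :=
  ∏' jk : ℕ × ℕ, ((1 - p ^ (jk.1 + 1) * q ^ (jk.2 + 1) / x) / (1 - p ^ jk.1 * q ^ jk.2 * x))

/-- `(p;p)_∞`. -/
noncomputable def qPoch (p : ℂ) : ℂ := ∏' k : ℕ, (1 - p ^ (k + 1))

/-- `n`-fold contour integral over the unit torus. -/
noncomputable def torusInt (n : ℕ) (f : (Fin n → ℂ) → ℂ) : ℂ :=
  ((1 / (2 * Real.pi) : ℝ) : ℂ) ^ n *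
    ∫ θ in Set.univ.pi fun _ : Fin n => Set.Icc (0 : ℝ) (2 * Real.pi),
      f fun i => Complex.exp (Complex.I * (θ i))

/-- `z^{σ}`: `z` if the sign is `+1` (`true`), `z⁻¹` if the sign is `−1` (`false`). -/
noncomputable def pw (z : ℂ) (b : Bool) : ℂ := if b then z else z⁻¹

section EllipticHelpers

open Filter Topology Set Metric

/-- The infinite product `∏ (1 - a i * x)`. -/
noncomputable def linProd {ι : Type*} (a : ι → ℂ) (x : ℂ) : ℂ := ∏' i, (1 - a i * x)

section LinProd

variable {ι : Type*} {a : ι → ℂ}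

theorem summable_norm_neg_mul (ha : Summable fun i => ‖a i‖) (x : ℂ) :
    Summable fun i => ‖-(a i * x)‖ := by
  simpa [norm_mul] using ha.mul_right ‖x‖

theorem multipliable_linProd (ha : Summable fun i => ‖a i‖) (x : ℂ) :
    Multipliable fun i => (1 - a i * x) := by
  simpa [sub_eq_add_neg] using multipliable_one_add_of_summable (summable_norm_neg_mul ha x)

theorem linProd_ne_zero (ha : Summable fun i => ‖a i‖) {x : ℂ} (hx : ∀ i, a i * x ≠ 1) :
    linProd a x ≠ 0 := by
  have := tprod_one_add_ne_zero_of_summable (f := fun i => -(a i * x))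
    (fun i h => hx i (by linear_combination -h)) (summable_norm_neg_mul ha x)
  simpa [linProd, sub_eq_add_neg] using this

theorem linProd_eq_zero {x : ℂ} {i : ι} (hx : a i * x = 1) : linProd a x = 0 :=
  tprod_of_exists_eq_zero ⟨i, by simp [hx]⟩

theorem differentiable_linProd (ha : Summable fun i => ‖a i‖) : Differentiable ℂ (linProd a) := by
  intro x
  have hK : IsOpen (Metric.ball (0 : ℂ) (‖x‖ + 1)) := Metric.isOpen_ball
  have h := Summable.hasProdLocallyUniformlyOn_one_add (f := fun i (y : ℂ) => -(a i * y)) hK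
    (ha.mul_right (‖x‖ + 1)) (Eventually.of_forall fun i y hy => by
      rw [norm_neg, norm_mul]
      exact mul_le_mul_of_nonneg_left (by simpa using (mem_ball_zero_iff.1 hy).le) (norm_nonneg _))
    (fun i => by fun_prop)
  have h2 := TendstoLocallyUniformlyOn.differentiableOn h
    (Eventually.of_forall fun s => by fun_prop) hK
  have h3 : DifferentiableAt ℂ (fun y => ∏' i, (1 + -(a i * y))) x :=
    h2.differentiableAt (hK.mem_nhds (by simp))
  have h4 : linProd a = fun y => ∏' i, (1 + -(a i * y)) := by
    funext y; simp [linProd, sub_eq_add_neg]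
  rw [h4]; exact h3

end LinProd

theorem summable_norm_pow {p : ℂ} (hp : ‖p‖ < 1) : Summable fun k : ℕ => ‖p ^ k‖ := by
  simpa using summable_geometric_of_lt_one (norm_nonneg p) hp

theorem summable_norm_pow_mul_pow {p q : ℂ} (hp : ‖p‖ < 1) (hq : ‖q‖ < 1) :
    Summable fun jk : ℕ × ℕ => ‖p ^ jk.1 * q ^ jk.2‖ := by
  simpa using (summable_norm_pow hp).mul_of_nonneg (summable_norm_pow hq)
    (fun _ => norm_nonneg _) (fun _ => norm_nonneg _)

/-- The `q`-shifted factorial `(x;p)_∞`. -/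
noncomputable def qp1 (p x : ℂ) : ℂ := linProd (fun k : ℕ => p ^ k) x

/-- The double `q`-shifted factorial `(x;p,q)_∞`. -/
noncomputable def qp2 (p q x : ℂ) : ℂ := linProd (fun jk : ℕ × ℕ => p ^ jk.1 * q ^ jk.2) x

section Products

variable {p q : ℂ}

theorem differentiable_qp1 (hp : ‖p‖ < 1) : Differentiable ℂ (qp1 p) :=
  differentiable_linProd (summable_norm_pow hp)

theorem differentiable_qp2 (hp : ‖p‖ < 1) (hq : ‖q‖ < 1) : Differentiable ℂ (qp2 p q) :=
  differentiable_linProd (summable_norm_pow_mul_pow hp hq)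

theorem qp1_step (hp : ‖p‖ < 1) (x : ℂ) : qp1 p x = (1 - x) * qp1 p (p * x) := by
  have h : Multipliable fun k : ℕ => (1 - p ^ (k + 1) * x) := by
    convert multipliable_linProd (summable_norm_pow hp) (p * x) using 2
    ring
  have h2 := tprod_eq_zero_mul' (f := fun k : ℕ => (1 - p ^ k * x)) h
  unfold qp1 linProd
  rw [h2]
  simp only [pow_zero, one_mul]
  congr 2
  funext k
  ring

theorem qp2_comm (p q x : ℂ) : qp2 p q x = qp2 q p x := by
  unfold qp2 linProd
  rw [← (Equiv.prodComm ℕ ℕ).tprod_eq]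
  simp [mul_comm]

theorem qp2_step (hp : ‖p‖ < 1) (hq : ‖q‖ < 1) (x : ℂ) :
    qp2 p q x = qp1 q x * qp2 p q (p * x) := by
  let e : ℕ ⊕ ℕ × ℕ ≃ ℕ × ℕ :=
    { toFun := Sum.elim (fun k => (0, k)) (fun jk => (jk.1 + 1, jk.2))
      invFun := fun jk => match jk with
        | (0, k) => Sum.inl k
        | (j + 1, k) => Sum.inr (j, k)
      left_inv := by rintro (k | ⟨j, k⟩) <;> rfl
      right_inv := by rintro ⟨_ | j, k⟩ <;> rfl }
  unfold qp2 qp1 linProd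
  rw [← e.tprod_eq]
  have h1 := multipliable_linProd (summable_norm_pow hq) x
  have h2 := multipliable_linProd (summable_norm_pow_mul_pow hp hq) (p * x)
  have e1 : (fun c => 1 - p ^ (e c).1 * q ^ (e c).2 * x) ∘ Sum.inl = fun k : ℕ => 1 - q ^ k * x := by
    funext k; simp [e]
  have e2 : (fun c => 1 - p ^ (e c).1 * q ^ (e c).2 * x) ∘ Sum.inr =
      fun jk : ℕ × ℕ => 1 - p ^ jk.1 * q ^ jk.2 * (p * x) := by
    funext k; simp [e]; ring
  have h := Multipliable.tprod_sum (f := fun c => 1 - p ^ (e c).1 * q ^ (e c).2 * x)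
    (by rw [e1]; exact h1) (by rw [e2]; exact h2)
  rw [h]
  congr 1
  · exact tprod_congr fun k => congrFun e1 k
  · exact tprod_congr fun k => congrFun e2 k

theorem qp2_step' (hp : ‖p‖ < 1) (hq : ‖q‖ < 1) (x : ℂ) :
    qp2 p q x = qp1 p x * qp2 p q (q * x) := by
  rw [qp2_comm, qp2_step hq hp, qp2_comm q p]

theorem qp1_ne_zero_of_norm_lt (hp : ‖p‖ < 1) {x : ℂ} (hx : ‖x‖ < 1) : qp1 p x ≠ 0 := by
  refine linProd_ne_zero (summable_norm_pow hp) fun k h => ?_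
  have h1 : ‖p ^ k * x‖ = 1 := by rw [h, norm_one]
  rw [norm_mul, norm_pow] at h1
  have := mul_le_mul_of_nonneg_right (pow_le_one₀ (n := k) (norm_nonneg p) hp.le) (norm_nonneg x)
  linarith

theorem qp2_ne_zero_of_norm_lt (hp : ‖p‖ < 1) (hq : ‖q‖ < 1) {x : ℂ} (hx : ‖x‖ < 1) :
    qp2 p q x ≠ 0 := by
  refine linProd_ne_zero (summable_norm_pow_mul_pow hp hq) fun k h => ?_
  have h1 : ‖p ^ k.1 * q ^ k.2 * x‖ = 1 := by rw [h, norm_one]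
  rw [norm_mul, norm_mul, norm_pow, norm_pow] at h1
  have h2 : ‖p‖ ^ k.1 * ‖q‖ ^ k.2 ≤ 1 :=
    mul_le_one₀ (pow_le_one₀ (norm_nonneg p) hp.le) (by positivity)
      (pow_le_one₀ (norm_nonneg q) hq.le)
  have := mul_le_mul_of_nonneg_right h2 (norm_nonneg x)
  linarith

theorem ellTheta_eq (hp : ‖p‖ < 1) (x : ℂ) : ellTheta x p = qp1 p x * qp1 p (p / x) := by
  have h1 := multipliable_linProd (summable_norm_pow hp) x
  have h2 := multipliable_linProd (summable_norm_pow hp) (p / x)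
  unfold ellTheta qp1 linProd
  rw [← h1.tprod_mul h2]
  refine tprod_congr fun k => ?_
  ring

theorem ellGamma_eq (hp : ‖p‖ < 1) (hq : ‖q‖ < 1) (x : ℂ) :
    ellGamma x p q = qp2 p q (p * q / x) / qp2 p q x := by
  have h1 := multipliable_linProd (summable_norm_pow_mul_pow hp hq) (p * q / x)
  have h2 := multipliable_linProd (summable_norm_pow_mul_pow hp hq) x
  by_cases h : ∃ jk : ℕ × ℕ, p ^ jk.1 * q ^ jk.2 * x = 1
  · obtain ⟨jk, h⟩ := h
    have : qp2 p q x = 0 := linProd_eq_zero h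
    rw [this, div_zero]
    exact tprod_of_exists_eq_zero ⟨jk, by simp [h]⟩
  · push Not at h
    have h0 : qp2 p q x ≠ 0 := linProd_ne_zero (summable_norm_pow_mul_pow hp hq) h
    have := (h1.tprod_div₀ h2 h0)
    unfold qp2 linProd
    rw [← this]
    refine tprod_congr fun k => ?_
    congr 1
    ring

theorem qPoch_eq (p : ℂ) : qPoch p = qp1 p p := by
  unfold qPoch qp1 linProd
  exact tprod_congr fun k => by ring

end Products

section ThetaGamma

variable {p q : ℂ}

theorem ellTheta_inv (hp : ‖p‖ < 1) {x : ℂ} (hx : x ≠ 0) :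
    ellTheta x⁻¹ p = -x⁻¹ * ellTheta x p := by
  rw [ellTheta_eq hp, ellTheta_eq hp, qp1_step hp x, qp1_step hp x⁻¹, div_inv_eq_mul,
    div_eq_mul_inv]
  field_simp
  ring

theorem ellTheta_mul_nome (hp : ‖p‖ < 1) (hp0 : p ≠ 0) {x : ℂ} (hx : x ≠ 0) :
    ellTheta (p * x) p = -x⁻¹ * ellTheta x p := by
  have h : p / (p * x) = x⁻¹ := by field_simp
  rw [ellTheta_eq hp, ellTheta_eq hp, qp1_step hp x, h, qp1_step hp x⁻¹, div_eq_mul_inv]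
  field_simp
  ring

theorem ellTheta_nome_div (hp : ‖p‖ < 1) (hp0 : p ≠ 0) (x : ℂ) :
    ellTheta (p / x) p = ellTheta x p := by
  rcases eq_or_ne x 0 with rfl | hx
  · simp
  have h : p / (p / x) = x := by field_simp
  rw [ellTheta_eq hp, ellTheta_eq hp, h, mul_comm]

theorem ellTheta_one (p : ℂ) : ellTheta 1 p = 0 :=
  tprod_of_exists_eq_zero ⟨0, by simp⟩

theorem exists_zpow_of_ellTheta_eq_zero (hp : ‖p‖ < 1) (hp0 : p ≠ 0) {x : ℂ} (hx : x ≠ 0)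
    (h : ellTheta x p = 0) : ∃ k : ℤ, x = p ^ k := by
  by_contra! hk
  refine absurd h ?_
  rw [ellTheta_eq hp]
  refine mul_ne_zero (linProd_ne_zero (summable_norm_pow hp) fun k h => ?_)
    (linProd_ne_zero (summable_norm_pow hp) fun k h => ?_)
  · refine hk (-(k : ℤ)) ?_
    rw [zpow_neg, zpow_natCast]
    exact eq_inv_of_mul_eq_one_right h
  · refine hk ((k : ℤ) + 1) ?_
    rw [zpow_add₀ hp0, zpow_natCast, zpow_one]
    field_simp at h
    exact h.symm

theorem ellTheta_ne_zero_of_norm (hp : ‖p‖ < 1) {x : ℂ} (h1 : ‖p‖ < ‖x‖) (h2 : ‖x‖ < 1) :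
    ellTheta x p ≠ 0 := by
  rw [ellTheta_eq hp]
  refine mul_ne_zero (qp1_ne_zero_of_norm_lt hp h2) (qp1_ne_zero_of_norm_lt hp ?_)
  rw [norm_div]
  exact (div_lt_one ((norm_nonneg p).trans_lt h1)).2 h1

theorem differentiableAt_ellTheta (hp : ‖p‖ < 1) {x : ℂ} (hx : x ≠ 0) :
    DifferentiableAt ℂ (fun x => ellTheta x p) x := by
  have h : (fun x => ellTheta x p) = fun x => qp1 p x * qp1 p (p / x) :=
    funext fun x => ellTheta_eq hp x
  rw [h]
  have h1 := differentiable_qp1 hp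
  have h2 : DifferentiableAt ℂ (fun x => qp1 p (p / x)) x :=
    (h1 _).comp x ((differentiableAt_const p).div differentiableAt_id hx)
  exact (h1 x).mul h2

theorem qPoch_ne_zero (hp : ‖p‖ < 1) : qPoch p ≠ 0 := by
  rw [qPoch_eq]; exact qp1_ne_zero_of_norm_lt hp hp

theorem ellGamma_symm (hp : ‖p‖ < 1) (hq : ‖q‖ < 1) (x : ℂ) :
    ellGamma x p q = ellGamma x q p := by
  rw [ellGamma_eq hp hq, ellGamma_eq hq hp, qp2_comm p q, qp2_comm p q, mul_comm p q]

theorem ellGamma_nome_mul (hp : ‖p‖ < 1) (hp0 : p ≠ 0) (hq : ‖q‖ < 1) {x : ℂ} (hx : x ≠ 0)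
    (hx1 : qp1 q x ≠ 0) :
    ellGamma (p * x) p q = ellTheta x q * ellGamma x p q := by
  have h : p * q / (p * x) = q / x := by field_simp
  rw [ellGamma_eq hp hq, ellGamma_eq hp hq, ellTheta_eq hq, h, qp2_step hp hq (q / x),
    qp2_step hp hq x, mul_div_assoc]
  by_cases h0 : qp2 p q (p * x) = 0
  · simp [h0]
  field_simp

theorem ellGamma_reflection (hp : ‖p‖ < 1) (hp0 : p ≠ 0) (hq : ‖q‖ < 1) (hq0 : q ≠ 0) {x : ℂ}
    (h1 : ‖x‖ < 1) (h2 : ‖p * q‖ < ‖x‖) :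
    ellGamma x p q * ellGamma (p * q / x) p q = 1 := by
  have hx : x ≠ 0 := norm_pos_iff.1 ((norm_nonneg _).trans_lt h2)
  have h : p * q / (p * q / x) = x := by field_simp
  have h3 := qp2_ne_zero_of_norm_lt hp hq h1
  have h4 : qp2 p q (p * q / x) ≠ 0 := qp2_ne_zero_of_norm_lt hp hq <| by
    rw [norm_div]; exact (div_lt_one (norm_pos_iff.2 hx)).2 h2
  rw [ellGamma_eq hp hq, ellGamma_eq hp hq, h]
  field_simp

theorem ellGamma_ne_zero (hp : ‖p‖ < 1) (hp0 : p ≠ 0) (hq : ‖q‖ < 1) (hq0 : q ≠ 0) {x : ℂ}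
    (h1 : ‖x‖ < 1) (h2 : ‖p * q‖ < ‖x‖) : ellGamma x p q ≠ 0 :=
  left_ne_zero_of_mul_eq_one (ellGamma_reflection hp hp0 hq hq0 h1 h2)

theorem differentiableAt_ellGamma (hp : ‖p‖ < 1) (hq : ‖q‖ < 1) {x : ℂ} (hx : x ≠ 0)
    (hx1 : ‖x‖ < 1) : DifferentiableAt ℂ (fun x => ellGamma x p q) x := by
  have h : (fun x => ellGamma x p q) = fun x => qp2 p q (p * q / x) / qp2 p q x :=
    funext fun x => ellGamma_eq hp hq x
  rw [h]
  have h1 := differentiable_qp2 hp hq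
  have h2 : DifferentiableAt ℂ (fun x => qp2 p q (p * q / x)) x :=
    (h1 _).comp x ((differentiableAt_const (p * q)).div differentiableAt_id hx)
  exact h2.div (h1 x) (qp2_ne_zero_of_norm_lt hp hq hx1)

theorem inv_ellGamma_mul_ellGamma_inv (hp : ‖p‖ < 1) (hq : ‖q‖ < 1) {x : ℂ} (hx : ‖x‖ = 1) :
    (ellGamma x p q * ellGamma x⁻¹ p q)⁻¹ = ellTheta x q * ellTheta x⁻¹ p := by
  have hx0 : x ≠ 0 := norm_pos_iff.1 (by rw [hx]; exact one_pos)
  have h1 : qp2 p q (p * q * x) ≠ 0 := qp2_ne_zero_of_norm_lt hp hq <| by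
    rw [norm_mul, norm_mul, hx, mul_one]; exact mul_lt_one_of_nonneg_of_lt_one_left
      (norm_nonneg _) hp hq.le
  have h2 : qp2 p q (p * q * x⁻¹) ≠ 0 := qp2_ne_zero_of_norm_lt hp hq <| by
    rw [norm_mul, norm_mul, norm_inv, hx, inv_one, mul_one]
    exact mul_lt_one_of_nonneg_of_lt_one_left (norm_nonneg _) hp hq.le
  have e1 : p * q * x = q * (p * x) := by ring
  have e2 : p * q * x⁻¹ = p * (q * x⁻¹) := by ring
  rw [ellGamma_eq hp hq, ellGamma_eq hp hq, div_inv_eq_mul, div_eq_mul_inv (p * q) x,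
    ellTheta_eq hq, ellTheta_eq hp, div_inv_eq_mul, div_eq_mul_inv q x, qp2_step hp hq x,
    qp2_step' hp hq (p * x), ← e1, qp2_step' hp hq x⁻¹, qp2_step hp hq (q * x⁻¹), ← e2]
  rw [mul_inv, inv_div, inv_div, div_mul_div_comm, div_eq_iff (mul_ne_zero h2 h1)]
  ring

theorem ellGamma_nome (hp : ‖p‖ < 1) (hp0 : p ≠ 0) (hq : ‖q‖ < 1) :
    ellGamma p p q = qPoch q / qPoch p := by
  have h : p * q / p = q := by field_simp
  have h1 : qp2 p q (p * q) ≠ 0 := qp2_ne_zero_of_norm_lt hp hq <| by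
    rw [norm_mul]; exact mul_lt_one_of_nonneg_of_lt_one_left (norm_nonneg _) hp hq.le
  rw [ellGamma_eq hp hq, h, qPoch_eq, qPoch_eq, qp2_step hp hq q, qp2_step' hp hq p, mul_comm q p]
  field_simp

end ThetaGamma

/-- The mean of `f` over the unit circle. -/
noncomputable def cAvg (f : ℂ → ℂ) : ℂ := Real.circleAverage f 0 1

section CAvg

theorem cAvg_congr {f g : ℂ → ℂ} (h : ∀ z, ‖z‖ = 1 → f z = g z) : cAvg f = cAvg g := by
  refine Real.circleAverage_congr_sphere fun z hz => h z ?_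
  simpa using hz

theorem cAvg_inv (f : ℂ → ℂ) : cAvg (fun z => f z⁻¹) = cAvg f :=
  Real.circleAverage_zero_one_congr_inv

theorem circleIntegrable_of_continuousOn_sphere {f : ℂ → ℂ}
    (h : ContinuousOn f (sphere 0 1)) : CircleIntegrable f 0 1 :=
  h.circleIntegrable zero_le_one

theorem cAvg_add {f g : ℂ → ℂ} (hf : ContinuousOn f (sphere 0 1))
    (hg : ContinuousOn g (sphere 0 1)) : cAvg (fun z => f z + g z) = cAvg f + cAvg g :=
  Real.circleAverage_fun_add (circleIntegrable_of_continuousOn_sphere hf)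
    (circleIntegrable_of_continuousOn_sphere hg)

theorem cAvg_const_mul (c : ℂ) (f : ℂ → ℂ) : cAvg (fun z => c * f z) = c * cAvg f :=
  Real.circleAverage_fun_smul (a := c) (f := f)

theorem cAvg_sum {ι : Type*} (s : Finset ι) {f : ι → ℂ → ℂ}
    (hf : ∀ i ∈ s, ContinuousOn (f i) (sphere 0 1)) :
    cAvg (fun z => ∑ i ∈ s, f i z) = ∑ i ∈ s, cAvg (f i) :=
  Real.circleAverage_fun_sum fun i hi => circleIntegrable_of_continuousOn_sphere (hf i hi)

theorem circleAverage_norm_eq_cAvg (f : ℂ → ℂ) (a : ℂ) :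
    Real.circleAverage f 0 ‖a‖ = cAvg fun z => f (a * z) := by
  rw [Real.circleAverage_eq_integral_add a.arg, cAvg, Real.circleAverage_def]
  congr 2
  funext θ
  congr 1
  conv_rhs => rw [← Complex.norm_mul_exp_arg_mul_I a]
  simp only [circleMap, zero_add, Complex.ofReal_add, Complex.ofReal_one, one_mul]
  rw [add_mul, Complex.exp_add]
  ring

theorem circleAverage_eq_of_annulus {f : ℂ → ℂ} {r R : ℝ} (hr : 0 < r) (hrR : r ≤ R)
    (hf : ∀ z, r ≤ ‖z‖ → ‖z‖ ≤ R → DifferentiableAt ℂ f z) :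
    Real.circleAverage f 0 R = Real.circleAverage f 0 r := by
  rw [Real.circleAverage_eq_circleIntegral (hr.trans_le hrR).ne',
    Real.circleAverage_eq_circleIntegral hr.ne',
    Complex.circleIntegral_sub_center_inv_smul_eq_of_differentiable_on_annulus_off_countable
      hr hrR countable_empty]
  · intro z hz
    simp only [Set.mem_sdiff, mem_closedBall, dist_zero_right, mem_ball, not_lt] at hz
    exact (hf z hz.2 hz.1).continuousAt.continuousWithinAt
  · intro z hz
    simp only [Set.mem_sdiff, mem_closedBall, dist_zero_right, mem_ball, not_le] at hz
    exact hf z hz.1.2.le hz.1.1.le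

theorem cAvg_comp_mul_of_one_le {f : ℂ → ℂ} {a : ℂ} (ha : 1 ≤ ‖a‖)
    (hf : ∀ z, 1 ≤ ‖z‖ → ‖z‖ ≤ ‖a‖ → DifferentiableAt ℂ f z) :
    cAvg (fun z => f (a * z)) = cAvg f := by
  rw [← circleAverage_norm_eq_cAvg, circleAverage_eq_of_annulus one_pos ha hf, cAvg]

theorem cAvg_comp_mul_of_le_one {f : ℂ → ℂ} {a : ℂ} (ha0 : a ≠ 0) (ha : ‖a‖ ≤ 1)
    (hf : ∀ z, ‖a‖ ≤ ‖z‖ → ‖z‖ ≤ 1 → DifferentiableAt ℂ f z) :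
    cAvg (fun z => f (a * z)) = cAvg f := by
  rw [← circleAverage_norm_eq_cAvg, ← circleAverage_eq_of_annulus (norm_pos_iff.2 ha0) ha hf, cAvg]

theorem circleAverage_div_sub_of_lt {c : ℂ} {R : ℝ} (h : ‖c‖ < R) :
    Real.circleAverage (fun z => z / (z - c)) 0 R = 1 := by
  have hR : 0 < R := (norm_nonneg c).trans_lt h
  rw [Real.circleAverage_eq_circleIntegral hR.ne']
  have : (∮ z in C(0, R), (z - 0)⁻¹ • (z / (z - c))) = ∮ z in C(0, R), (z - c)⁻¹ := by
    refine circleIntegral.integral_congr hR.le fun z hz => ?_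
    have hz0 : z ≠ 0 := by
      rw [mem_sphere_zero_iff_norm] at hz
      exact norm_pos_iff.1 (hz ▸ hR)
    simp only [sub_zero, smul_eq_mul]
    field_simp
  rw [this, circleIntegral.integral_sub_inv_of_mem_ball (by simpa using h), smul_eq_mul,
    inv_mul_cancel₀ Complex.two_pi_I_ne_zero]

theorem circleAverage_div_sub_of_gt {c : ℂ} {R : ℝ} (hR : 0 < R) (h : R < ‖c‖) :
    Real.circleAverage (fun z => z / (z - c)) 0 R = 0 := by
  rw [Real.circleAverage_eq_circleIntegral hR.ne']
  have : (∮ z in C(0, R), (z - 0)⁻¹ • (z / (z - c))) = ∮ z in C(0, R), (z - c)⁻¹ := by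
    refine circleIntegral.integral_congr hR.le fun z hz => ?_
    have hz0 : z ≠ 0 := by
      rw [mem_sphere_zero_iff_norm] at hz
      exact norm_pos_iff.1 (hz ▸ hR)
    simp only [sub_zero, smul_eq_mul]
    field_simp
  have hd : ∀ z, ‖z‖ ≤ R → DifferentiableAt ℂ (fun z => (z - c)⁻¹) z := fun z hz => by
    refine (differentiableAt_id.sub_const c).inv (sub_ne_zero.2 ?_)
    rintro rfl
    simp only [id] at hz h
    linarith
  rw [this, Complex.circleIntegral_eq_zero_of_differentiable_on_off_countable hR.le countable_empty,
    smul_zero]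
  · exact fun z hz => (hd z (by simpa using hz)).continuousAt.continuousWithinAt
  · exact fun z hz => hd z (by simpa using (mem_ball.1 hz.1).le)

theorem cAvg_comp_mul_of_pole {h : ℂ → ℂ} {a c : ℂ} (hc : 1 < ‖c‖) (hca : ‖c‖ < ‖a‖)
    (hh : ∀ z, 1 ≤ ‖z‖ → ‖z‖ ≤ ‖a‖ → DifferentiableAt ℂ h z) :
    cAvg (fun z => h (a * z) / (1 - c / (a * z))) = cAvg (fun z => h z / (1 - c / z)) + h c := by
  set U : Set ℂ := {z | 1 < ‖z‖ ∧ ‖z‖ < ‖a‖} with hU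
  have hUo : IsOpen U := (isOpen_lt continuous_const continuous_norm).inter
    (isOpen_lt continuous_norm continuous_const)
  have hk : ∀ z, 1 ≤ ‖z‖ → ‖z‖ ≤ ‖a‖ → DifferentiableAt ℂ (dslope h c) z := by
    intro z h1 h2
    rcases eq_or_ne z c with rfl | hz
    · have : DifferentiableOn ℂ (dslope h z) U :=
        (Complex.differentiableOn_dslope (hUo.mem_nhds ⟨hc, hca⟩)).2 fun w hw =>
          (hh w hw.1.le hw.2.le).differentiableWithinAt
      exact this.differentiableAt (hUo.mem_nhds ⟨hc, hca⟩)
    · exact (differentiableAt_dslope_of_ne hz).2 (hh z h1 h2)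
  have key : ∀ z, z ≠ 0 → z ≠ c →
      h z / (1 - c / z) = z * dslope h c z + h c * (z / (z - c)) := by
    intro z hz hzc
    have hzc' := sub_ne_zero.2 hzc
    have e : (1 - c / z) = (z - c) / z := by field_simp
    rw [dslope_of_ne _ hzc, slope_def_field, e]
    field_simp
    ring
  have hcont : ∀ r, 1 ≤ r → r ≤ ‖a‖ → ContinuousOn (fun z => z * dslope h c z) (sphere 0 r) := by
    intro r h1 h2 z hz
    rw [mem_sphere_zero_iff_norm] at hz
    exact (continuousAt_id.mul (hk z (hz ▸ h1) (hz ▸ h2)).continuousAt).continuousWithinAt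
  have main : ∀ r, 1 ≤ r → r ≤ ‖a‖ → r ≠ ‖c‖ →
      Real.circleAverage (fun z => h z / (1 - c / z)) 0 r =
        Real.circleAverage (fun z => z * dslope h c z) 0 r +
          h c * Real.circleAverage (fun z => z / (z - c)) 0 r := by
    intro r h1 h2 h3
    have hr : 0 < r := by linarith
    have hne : ∀ z ∈ sphere (0 : ℂ) r, z ≠ c := by
      rintro z hz rfl
      exact h3 (mem_sphere_zero_iff_norm.1 hz).symm
    have hci : ContinuousOn (fun z => z / (z - c)) (sphere 0 r) := by
      refine continuousOn_id.div (continuousOn_id.sub continuousOn_const) fun z hz => ?_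
      exact sub_ne_zero.2 (hne z hz)
    rw [← smul_eq_mul (h c), ← Real.circleAverage_fun_smul, ← Real.circleAverage_fun_add
      ((hcont r h1 h2).circleIntegrable hr.le)
      (ContinuousOn.circleIntegrable hr.le
        (f := fun z => h c • (z / (z - c))) (hci.const_smul (h c)))]
    refine Real.circleAverage_congr_sphere fun z hz => ?_
    rw [abs_of_pos hr] at hz
    refine key z ?_ (hne z hz)
    rw [mem_sphere_zero_iff_norm] at hz
    exact norm_pos_iff.1 (hz ▸ hr)
  have ha1 : 1 ≤ ‖a‖ := (hc.trans hca).le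
  rw [← circleAverage_norm_eq_cAvg (fun z => h z / (1 - c / z)) a, main ‖a‖ ha1 le_rfl hca.ne',
    cAvg, main 1 le_rfl ha1 hc.ne, circleAverage_div_sub_of_lt hca,
    circleAverage_div_sub_of_gt one_pos hc, circleAverage_eq_of_annulus one_pos ha1]
  · ring
  · exact fun z h1 h2 => differentiableAt_id.mul (hk z h1 h2)

end CAvg

/-- The basic antisymmetric theta function of two variables. -/
noncomputable def thP (p a z : ℂ) : ℂ := a⁻¹ * (ellTheta (a * z) p * ellTheta (a / z) p)

section ThP

variable {p : ℂ}

theorem thP_antisymm (hp : ‖p‖ < 1) {a z : ℂ} (ha : a ≠ 0) (hz : z ≠ 0) :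
    thP p a z = -thP p z a := by
  have h : z / a = (a / z)⁻¹ := by rw [inv_div]
  rw [thP, thP, h, ellTheta_inv hp (div_ne_zero ha hz), mul_comm z a]
  field_simp

theorem thP_inv_right (p a z : ℂ) : thP p a z⁻¹ = thP p a z := by
  rw [thP, thP, div_inv_eq_mul, div_eq_mul_inv, mul_comm (ellTheta (a * z⁻¹) p)]

theorem thP_inv_left (hp : ‖p‖ < 1) {a z : ℂ} (ha : a ≠ 0) (hz : z ≠ 0) :
    thP p a⁻¹ z = thP p a z := by
  rw [thP_antisymm hp (inv_ne_zero ha) hz, thP_inv_right, ← thP_antisymm hp ha hz]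

theorem thP_self (p : ℂ) {a : ℂ} (ha : a ≠ 0) : thP p a a = 0 := by
  simp [thP, div_self ha, ellTheta_one]

theorem thP_nome_mul_right (hp : ‖p‖ < 1) (hp0 : p ≠ 0) {a z : ℂ} (ha : a ≠ 0) (hz : z ≠ 0) :
    thP p a (p * z) = (p * z ^ 2)⁻¹ * thP p a z := by
  have h1 : a * (p * z) = p * (a * z) := by ring
  have h2 : a / z = p * (a / (p * z)) := by field_simp
  have h3 := ellTheta_mul_nome hp hp0 (div_ne_zero ha (mul_ne_zero hp0 hz))
  rw [thP, thP, h1, ellTheta_mul_nome hp hp0 (mul_ne_zero ha hz), h2, h3]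
  field_simp

theorem thP_ne_zero {a z : ℂ} (ha : a ≠ 0) (h1 : ellTheta (a * z) p ≠ 0)
    (h2 : ellTheta (a / z) p ≠ 0) : thP p a z ≠ 0 :=
  mul_ne_zero (inv_ne_zero ha) (mul_ne_zero h1 h2)

theorem differentiableAt_thP (hp : ‖p‖ < 1) {a z : ℂ} (ha : a ≠ 0) (hz : z ≠ 0) :
    DifferentiableAt ℂ (thP p a) z := by
  have h1 : DifferentiableAt ℂ (fun z => ellTheta (a * z) p) z :=
    (differentiableAt_ellTheta hp (mul_ne_zero ha hz)).comp z (by fun_prop)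
  have h2 : DifferentiableAt ℂ (fun z => ellTheta (a / z) p) z :=
    (differentiableAt_ellTheta hp (div_ne_zero ha hz)).comp z
      ((differentiableAt_const a).div differentiableAt_id hz)
  exact (h1.mul h2).const_mul _

theorem exists_ellTheta_sq_ne_zero (hp : ‖p‖ < 1) : ∃ z : ℂ, z ≠ 0 ∧ ellTheta (z ^ 2) p ≠ 0 := by
  have h0 := norm_nonneg p
  refine ⟨(Real.sqrt ((1 + ‖p‖) / 2) : ℝ), ?_, ?_⟩
  · simp only [ne_eq, Complex.ofReal_eq_zero]
    positivity
  · have h : ‖((Real.sqrt ((1 + ‖p‖) / 2) : ℝ) : ℂ) ^ 2‖ = (1 + ‖p‖) / 2 := by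
      rw [norm_pow, Complex.norm_real, Real.norm_eq_abs, sq_abs, Real.sq_sqrt (by positivity)]
    refine ellTheta_ne_zero_of_norm hp ?_ ?_ <;> rw [h] <;> linarith

theorem exists_thP_ne_zero (hp : ‖p‖ < 1) : ∃ a b : ℂ, a ≠ 0 ∧ b ≠ 0 ∧ thP p a b ≠ 0 := by
  have h0 := norm_nonneg p
  obtain ⟨z, hz, hz2⟩ := exists_ellTheta_sq_ne_zero hp
  refine ⟨z ^ 2, 1, pow_ne_zero 2 hz, one_ne_zero, thP_ne_zero (pow_ne_zero 2 hz) ?_ ?_⟩ <;> simpa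

/-- Holomorphic functions on `ℂ \ {0}`, odd under inversion, with theta quasi-periodicity. -/
structure IsOddTheta (p : ℂ) (D : ℕ) (F : ℂ → ℂ) : Prop where
  diff : ∀ z, z ≠ 0 → DifferentiableAt ℂ F z
  odd : ∀ z, z ≠ 0 → F z⁻¹ = -F z
  quasi : ∀ z, z ≠ 0 → F (p * z) = ((p * z ^ 2) ^ D)⁻¹ * F z

theorem eq_zero_of_mul_eq_zero_punctured {f g : ℂ → ℂ}
    (hf : ∀ z, z ≠ 0 → DifferentiableAt ℂ f z) (hg : ∀ z, z ≠ 0 → DifferentiableAt ℂ g z)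
    (h : ∀ z, z ≠ 0 → f z * g z = 0) {w : ℂ} (hw0 : w ≠ 0) (hw : f w ≠ 0) :
    ∀ z, z ≠ 0 → g z = 0 := by
  have hU : IsOpen ({0}ᶜ : Set ℂ) := isOpen_compl_singleton
  have hf' : AnalyticOnNhd ℂ f ({0}ᶜ) :=
    DifferentiableOn.analyticOnNhd (fun z hz => (hf z hz).differentiableWithinAt) hU
  have hg' : AnalyticOnNhd ℂ g ({0}ᶜ) :=
    DifferentiableOn.analyticOnNhd (fun z hz => (hg z hz).differentiableWithinAt) hU
  have hpc : IsPreconnected ({0}ᶜ : Set ℂ) :=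
    (isConnected_compl_singleton_of_one_lt_rank (by simp [Complex.rank_real_complex]) 0).isPreconnected
  rcases hf'.eq_zero_or_eq_zero_of_mul_eq_zero hg' (fun z hz => h z hz) hpc with h1 | h1
  · exact absurd (h1 w hw0) hw
  · exact fun z hz => h1 z hz

theorem eq_zero_at_one_of_fourier {F : ℂ → ℂ} (hF : ContinuousOn F (sphere 0 1))
    (h : ∀ k : ℤ, cAvg (fun z => z ^ k * F z) = 0) : F 1 = 0 := by
  have : Fact (0 < 2 * Real.pi) := ⟨Real.two_pi_pos⟩
  let f : C(AddCircle (2 * Real.pi), ℂ) :=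
    ⟨fun x => F (AddCircle.toCircle x), by
      refine hF.comp_continuous
        (continuous_subtype_val.comp AddCircle.continuous_toCircle) ?_
      intro x
      rw [mem_sphere_zero_iff_norm]
      exact Circle.norm_coe _⟩
  have hc : ∀ n : ℤ, fourierCoeff f n = 0 := by
    intro n
    rw [fourierCoeff_eq_intervalIntegral f n 0]
    have e := h (-n)
    rw [cAvg, Real.circleAverage_def] at e
    rw [zero_add, one_div]
    rw [← e]
    congr 1
    refine intervalIntegral.integral_congr fun x _ => ?_
    have e1 : ((AddCircle.toCircle (x : AddCircle (2 * Real.pi)) : Circle) : ℂ) =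
        circleMap 0 1 x := by
      rw [AddCircle.toCircle_apply_mk]
      simp [circleMap, Circle.coe_exp]
    have e2 : (fourier (-n) (x : AddCircle (2 * Real.pi)) : ℂ) = circleMap 0 1 x ^ (-n) := by
      rw [← e1, fourier_apply, AddCircle.toCircle_zsmul]
      simp
    simp only [f, ContinuousMap.coe_mk, e2, smul_eq_mul]
    rw [e1]
  have hs : Summable (fourierCoeff f) := by
    have : fourierCoeff f = 0 := funext hc
    rw [this]; exact summable_zero
  have h1 := has_pointwise_sum_fourier_series_of_summable hs 0
  simp only [hc, zero_smul] at h1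
  have h2 := h1.unique hasSum_zero
  simpa [f] using h2

theorem eq_zero_of_cAvg_eq_zero {F : ℂ → ℂ} (hF : ∀ z, z ≠ 0 → DifferentiableAt ℂ F z)
    (h : ∀ k : ℤ, cAvg (fun z => z ^ k * F z) = 0) {w : ℂ} (hw : w ≠ 0) : F w = 0 := by
  have hd : ∀ k : ℤ, ∀ z, z ≠ 0 → DifferentiableAt ℂ (fun z => z ^ k * F z) z := fun k z hz =>
    (differentiableAt_zpow.2 (Or.inl hz)).mul (hF z hz)
  have key : ∀ k : ℤ, cAvg (fun z => (w * z) ^ k * F (w * z)) = 0 := by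
    intro k
    rw [← h k]
    rcases le_total 1 ‖w‖ with h1 | h1
    · exact cAvg_comp_mul_of_one_le (f := fun z => z ^ k * F z) h1 fun z hz _ =>
        hd k z (norm_pos_iff.1 (by linarith))
    · exact cAvg_comp_mul_of_le_one (f := fun z => z ^ k * F z) hw h1 fun z hz _ =>
        hd k z (norm_pos_iff.1 ((norm_pos_iff.2 hw).trans_le hz))
  have := eq_zero_at_one_of_fourier (F := fun z => F (w * z)) ?_ ?_
  · simpa using this
  · intro z hz
    rw [mem_sphere_zero_iff_norm] at hz
    have hz0 : z ≠ 0 := norm_pos_iff.1 (by rw [hz]; exact one_pos)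
    exact ((hF _ (mul_ne_zero hw hz0)).continuousAt.comp (by fun_prop)).continuousWithinAt
  · intro k
    have e : (fun z => z ^ k * F (w * z)) = fun z => w ^ (-k) * ((w * z) ^ k * F (w * z)) := by
      funext z
      rw [mul_zpow, zpow_neg]
      have := zpow_ne_zero k hw
      field_simp
    rw [e, cAvg_const_mul, key, mul_zero]

theorem IsOddTheta.eq_zero (hp : ‖p‖ < 1) (hp0 : p ≠ 0) {D : ℕ} (hD : 0 < D) {F : ℂ → ℂ}
    (hF : IsOddTheta p D F)
    (h : ∀ k : ℕ, 0 < k → k < D → cAvg (fun z => z ^ (k : ℤ) * F z) = 0) {w : ℂ} (hw : w ≠ 0) :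
    F w = 0 := by
  set c : ℤ → ℂ := fun k => cAvg (fun z => z ^ k * F z) with hc
  have hodd : ∀ k, c (-k) = -c k := by
    intro k
    simp only [hc]
    rw [← cAvg_inv, ← neg_one_mul (cAvg _), ← cAvg_const_mul]
    refine cAvg_congr fun z hz => ?_
    have hz0 : z ≠ 0 := norm_pos_iff.1 (by rw [hz]; exact one_pos)
    rw [hF.odd z hz0, inv_zpow, zpow_neg, inv_inv]
    ring
  have hq : ∀ k : ℤ, c k = p ^ (k - D) * c (k - 2 * D) := by
    intro k
    simp only [hc]
    rw [← cAvg_const_mul, ← cAvg_comp_mul_of_le_one (a := p) hp0 hp.le]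
    · refine cAvg_congr fun z hz => ?_
      have hz0 : z ≠ 0 := norm_pos_iff.1 (by rw [hz]; exact one_pos)
      rw [hF.quasi z hz0, mul_zpow, zpow_sub₀ hp0, zpow_sub₀ hz0, mul_pow, ← pow_mul, zpow_natCast,
        show ((2 : ℤ) * (D : ℤ)) = ((2 * D : ℕ) : ℤ) by push_cast; ring, zpow_natCast]
      field_simp
    · intro z hz _
      have hz0 : z ≠ 0 := norm_pos_iff.1 ((norm_pos_iff.2 hp0).trans_le hz)
      exact (differentiableAt_zpow.2 (Or.inl hz0)).mul (hF.diff z hz0)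
  have hq0 : ∀ k : ℤ, c k = 0 ↔ c (k - 2 * D) = 0 := by
    intro k
    rw [hq k, mul_eq_zero, or_iff_right (zpow_ne_zero _ hp0)]
  have self_neg : ∀ x : ℂ, x = -x → x = 0 := fun x hx => by linear_combination hx / 2
  have hbase : ∀ k : ℤ, 0 ≤ k → k < 2 * D → c k = 0 := by
    intro k h0 h1
    obtain ⟨m, rfl⟩ := Int.eq_ofNat_of_zero_le h0
    rcases Nat.eq_zero_or_pos m with rfl | hm
    · exact self_neg _ (by simpa using hodd 0)
    rcases lt_trichotomy m D with h2 | rfl | h2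
    · exact h m hm h2
    · have e := hq m
      rw [sub_self, zpow_zero, one_mul, show (m : ℤ) - 2 * m = -m by ring, hodd] at e
      exact self_neg _ e
    · rw [hq0, show (m : ℤ) - 2 * D = -((2 * D - m : ℕ) : ℤ) by omega, hodd,
        show c ((2 * D - m : ℕ) : ℤ) = 0 from h _ (by omega) (by omega), neg_zero]
  have hall : ∀ k : ℤ, c k = 0 := by
    intro k
    have hDpos : (0 : ℤ) < 2 * D := by omega
    have h1 : ∀ j : ℤ, c (k % (2 * D) + 2 * D * j) = 0 := by
      intro j
      induction j using Int.induction_on with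
      | zero =>
        rw [mul_zero, add_zero]
        exact hbase _ (Int.emod_nonneg _ hDpos.ne') (Int.emod_lt_of_pos _ hDpos)
      | succ i ih =>
        rw [hq0]
        convert ih using 2
        ring
      | pred i ih =>
        rw [hq0] at ih
        convert ih using 2
        ring
    have h2 := h1 (k / (2 * D))
    rwa [Int.emod_add_mul_ediv] at h2
  exact eq_zero_of_cAvg_eq_zero hF.diff hall hw

end ThP

section ThMono

variable {p : ℂ}

/-- Holomorphic functions on `ℂ \ {0}`, even under inversion, with theta quasi-periodicity. -/
structure IsEvenTheta (p : ℂ) (d : ℕ) (f : ℂ → ℂ) : Prop where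
  diff : ∀ z, z ≠ 0 → DifferentiableAt ℂ f z
  even : ∀ z, z ≠ 0 → f z⁻¹ = f z
  quasi : ∀ z, z ≠ 0 → f (p * z) = ((p * z ^ 2) ^ d)⁻¹ * f z

/-- The odd theta function of lowest degree. -/
noncomputable def thSq (p z : ℂ) : ℂ := z⁻¹ * ellTheta (z ^ 2) p

theorem isEvenTheta_thP (hp : ‖p‖ < 1) (hp0 : p ≠ 0) {a : ℂ} (ha : a ≠ 0) :
    IsEvenTheta p 1 (thP p a) where
  diff _ hz := differentiableAt_thP hp ha hz
  even z _ := thP_inv_right p a z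
  quasi z hz := by rw [thP_nome_mul_right hp hp0 ha hz, pow_one]

theorem isEvenTheta_one (p : ℂ) : IsEvenTheta p 0 (fun _ => 1) where
  diff _ _ := differentiableAt_const _
  even _ _ := rfl
  quasi _ _ := by simp

theorem IsEvenTheta.mul {d e : ℕ} {f g : ℂ → ℂ} (hf : IsEvenTheta p d f)
    (hg : IsEvenTheta p e g) : IsEvenTheta p (d + e) (fun z => f z * g z) where
  diff z hz := (hf.diff z hz).mul (hg.diff z hz)
  even z hz := by rw [hf.even z hz, hg.even z hz]
  quasi z hz := by rw [hf.quasi z hz, hg.quasi z hz, pow_add, mul_inv]; ring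

theorem IsEvenTheta.pow {d : ℕ} {f : ℂ → ℂ} (hf : IsEvenTheta p d f) (k : ℕ) :
    IsEvenTheta p (k * d) (fun z => f z ^ k) := by
  induction k with
  | zero => simpa using isEvenTheta_one p
  | succ k ih => simpa only [pow_succ, Nat.succ_mul] using ih.mul hf

theorem IsEvenTheta.const_mul {d : ℕ} {f : ℂ → ℂ} (hf : IsEvenTheta p d f) (c : ℂ) :
    IsEvenTheta p d (fun z => c * f z) where
  diff z hz := (hf.diff z hz).const_mul c
  even z hz := by rw [hf.even z hz]
  quasi z hz := by rw [hf.quasi z hz]; ring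

theorem isEvenTheta_prod {ι : Type*} (s : Finset ι) {f : ι → ℂ → ℂ}
    (h : ∀ i ∈ s, IsEvenTheta p 1 (f i)) : IsEvenTheta p s.card (fun z => ∏ i ∈ s, f i z) := by
  classical
  induction s using Finset.induction_on with
  | empty => simpa using isEvenTheta_one p
  | insert a s ha ih =>
    simp only [Finset.prod_insert ha, Finset.card_insert_of_notMem ha]
    rw [add_comm]
    exact (h a (by simp)).mul (ih fun i hi => h i (by simp [hi]))

theorem IsOddTheta.mul_even {d e : ℕ} {f g : ℂ → ℂ} (hf : IsOddTheta p d f)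
    (hg : IsEvenTheta p e g) : IsOddTheta p (d + e) (fun z => f z * g z) where
  diff z hz := (hf.diff z hz).mul (hg.diff z hz)
  odd z hz := by rw [hf.odd z hz, hg.even z hz, neg_mul]
  quasi z hz := by rw [hf.quasi z hz, hg.quasi z hz, pow_add, mul_inv]; ring

theorem IsOddTheta.sub {d : ℕ} {f g : ℂ → ℂ} (hf : IsOddTheta p d f)
    (hg : IsOddTheta p d g) : IsOddTheta p d (fun z => f z - g z) where
  diff z hz := (hf.diff z hz).sub (hg.diff z hz)
  odd z hz := by rw [hf.odd z hz, hg.odd z hz]; ring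
  quasi z hz := by rw [hf.quasi z hz, hg.quasi z hz]; ring

theorem IsOddTheta.const_mul {d : ℕ} {f : ℂ → ℂ} (hf : IsOddTheta p d f) (c : ℂ) :
    IsOddTheta p d (fun z => c * f z) where
  diff z hz := (hf.diff z hz).const_mul c
  odd z hz := by rw [hf.odd z hz]; ring
  quasi z hz := by rw [hf.quasi z hz]; ring

theorem isOddTheta_sum {ι : Type*} (s : Finset ι) {d : ℕ} {f : ι → ℂ → ℂ}
    (h : ∀ i ∈ s, IsOddTheta p d (f i)) : IsOddTheta p d (fun z => ∑ i ∈ s, f i z) where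
  diff z hz := DifferentiableAt.fun_sum fun i hi => (h i hi).diff z hz
  odd z hz := by
    rw [← Finset.sum_neg_distrib]
    exact Finset.sum_congr rfl fun i hi => (h i hi).odd z hz
  quasi z hz := by
    rw [Finset.mul_sum]
    exact Finset.sum_congr rfl fun i hi => (h i hi).quasi z hz

/-- Antisymmetrizing a quasi-periodic function gives an odd theta function. -/
theorem isOddTheta_antisymm (hp0 : p ≠ 0) {d : ℕ} {G : ℂ → ℂ}
    (hG : ∀ z, z ≠ 0 → DifferentiableAt ℂ G z)
    (hq : ∀ z, z ≠ 0 → G (p * z) = ((p * z ^ 2) ^ d)⁻¹ * G z) :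
    IsOddTheta p d (fun z => G z - G z⁻¹) where
  diff z hz := (hG z hz).sub
    (DifferentiableAt.comp z (hG _ (inv_ne_zero hz)) (differentiableAt_inv hz))
  odd z hz := by rw [inv_inv]; ring
  quasi z hz := by
    have h1 := hq (p * z)⁻¹ (inv_ne_zero (mul_ne_zero hp0 hz))
    have h2 : p * (p * z)⁻¹ = z⁻¹ := by field_simp
    have h3 : p * ((p * z)⁻¹) ^ 2 = (p * z ^ 2)⁻¹ := by field_simp
    rw [h2, h3, inv_pow, inv_inv] at h1
    have h4 : (p * z ^ 2) ^ d ≠ 0 := pow_ne_zero _ (mul_ne_zero hp0 (pow_ne_zero 2 hz))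
    rw [hq z hz, h1]
    field_simp

theorem isOddTheta_thSq (hp : ‖p‖ < 1) (hp0 : p ≠ 0) : IsOddTheta p 2 (thSq p) where
  diff z hz := (differentiableAt_inv hz).mul
    (DifferentiableAt.comp z (g := fun x => ellTheta x p)
      (differentiableAt_ellTheta hp (pow_ne_zero 2 hz)) (differentiableAt_pow 2))
  odd z hz := by
    rw [thSq, thSq, inv_pow, ellTheta_inv hp (pow_ne_zero 2 hz)]
    field_simp
  quasi z hz := by
    have h1 : (p * z) ^ 2 = p * (p * z ^ 2) := by ring
    have h2 := pow_ne_zero 2 hz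
    rw [thSq, thSq, h1, ellTheta_mul_nome hp hp0 (mul_ne_zero hp0 h2),
      ellTheta_mul_nome hp hp0 h2]
    field_simp

theorem exists_thSq_ne_zero (hp : ‖p‖ < 1) : ∃ z : ℂ, z ≠ 0 ∧ thSq p z ≠ 0 := by
  obtain ⟨z, h0, h1⟩ := exists_ellTheta_sq_ne_zero hp
  exact ⟨z, h0, mul_ne_zero (inv_ne_zero h0) h1⟩

/-- Monomials of degree `n - 1` in the two theta functions `thP p α` and `thP p β`. -/
noncomputable def thMono (p α β : ℂ) (n : ℕ) (k : Fin n) (z : ℂ) : ℂ :=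
  thP p β z ^ (k : ℕ) * thP p α z ^ (k.rev : ℕ)

theorem isEvenTheta_thMono (hp : ‖p‖ < 1) (hp0 : p ≠ 0) {α β : ℂ} (hα : α ≠ 0) (hβ : β ≠ 0)
    {n : ℕ} (k : Fin n) : IsEvenTheta p (n - 1) (thMono p α β n k) := by
  have h := ((isEvenTheta_thP hp hp0 hβ).pow (k : ℕ)).mul
    ((isEvenTheta_thP hp hp0 hα).pow (k.rev : ℕ))
  have e : (k : ℕ) * 1 + (k.rev : ℕ) * 1 = n - 1 := by
    rw [Fin.val_rev]; omega
  rwa [e] at h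

theorem isOddTheta_thSq_mul_thMono (hp : ‖p‖ < 1) (hp0 : p ≠ 0) {α β : ℂ} (hα : α ≠ 0)
    (hβ : β ≠ 0) {n : ℕ} (k : Fin n) :
    IsOddTheta p (n + 1) (fun z => thSq p z * thMono p α β n k z) := by
  have h := (isOddTheta_thSq hp hp0).mul_even (isEvenTheta_thMono hp hp0 hα hβ k)
  have e : 2 + (n - 1) = n + 1 := by have := k.2; omega
  rwa [e] at h

theorem thMono_linearIndependent (hp : ‖p‖ < 1) {α β : ℂ} (hα : α ≠ 0) (hβ : β ≠ 0)
    (hαβ : thP p α β ≠ 0) {n : ℕ} {r : Fin n → ℂ}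
    (h : ∀ z, z ≠ 0 → ∑ k, r k * thMono p α β n k z = 0) : r = 0 := by
  induction n with
  | zero => exact Subsingleton.elim _ _
  | succ n ih =>
    have hβα : thP p β α ≠ 0 := by
      rw [thP_antisymm hp hβ hα]; exact neg_ne_zero.2 hαβ
    have e : ∀ z, ∑ k, r k * thMono p α β (n + 1) k z = r 0 * thP p α z ^ n +
        thP p β z * ∑ k : Fin n, r k.succ * thMono p α β n k z := by
      intro z
      rw [Fin.sum_univ_succ, Finset.mul_sum]
      congr 1
      · simp [thMono]
      · refine Finset.sum_congr rfl fun k _ => ?_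
        have : ((k.succ).rev : ℕ) = k.rev := by simp only [Fin.val_rev, Fin.val_succ]; omega
        rw [thMono, thMono, this, Fin.val_succ, pow_succ]
        ring
    have h0 : r 0 = 0 := by
      have := h β hβ
      rw [e, thP_self p hβ, zero_mul, add_zero] at this
      exact (mul_eq_zero.1 this).resolve_right (pow_ne_zero _ hαβ)
    have h1 : ∀ z, z ≠ 0 → ∑ k : Fin n, r k.succ * thMono p α β n k z = 0 := by
      refine eq_zero_of_mul_eq_zero_punctured (f := thP p β)
        (fun z hz => differentiableAt_thP hp hβ hz) (fun z hz => ?_) (fun z hz => ?_) hα hβα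
      · refine DifferentiableAt.fun_sum fun k _ => DifferentiableAt.const_mul ?_ _
        exact ((differentiableAt_thP hp hβ hz).pow _).mul ((differentiableAt_thP hp hα hz).pow _)
      · have := h z hz
        rwa [e, h0, zero_mul, zero_add] at this
    funext k
    refine Fin.cases h0 (fun k => ?_) k
    exact congrFun (ih h1) k

theorem continuousOn_sphere_of_differentiableAt {f : ℂ → ℂ}
    (hf : ∀ z, z ≠ 0 → DifferentiableAt ℂ f z) : ContinuousOn f (sphere 0 1) := by
  intro z hz
  rw [mem_sphere_zero_iff_norm] at hz
  exact (hf z (norm_pos_iff.1 (by rw [hz]; exact one_pos))).continuousAt.continuousWithinAt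

theorem IsOddTheta.exists_eq_sum (hp : ‖p‖ < 1) (hp0 : p ≠ 0) {α β : ℂ} (hα : α ≠ 0)
    (hβ : β ≠ 0) (hαβ : thP p α β ≠ 0) {n : ℕ} {F : ℂ → ℂ} (hF : IsOddTheta p (n + 1) F) :
    ∃ r : Fin n → ℂ, ∀ z, z ≠ 0 → F z = thSq p z * ∑ k, r k * thMono p α β n k z := by
  set e : Fin n → ℂ → ℂ := fun k z => thSq p z * thMono p α β n k z with he
  have heo : ∀ k, IsOddTheta p (n + 1) (e k) := fun k =>
    isOddTheta_thSq_mul_thMono hp hp0 hα hβ k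
  have hzd : ∀ (j : ℕ) {f : ℂ → ℂ}, IsOddTheta p (n + 1) f →
      ContinuousOn (fun z => z ^ (j : ℤ) * f z) (sphere 0 1) := fun j f hf =>
    continuousOn_sphere_of_differentiableAt fun z hz =>
      (differentiableAt_zpow.2 (Or.inl hz)).mul (hf.diff z hz)
  let M : Matrix (Fin n) (Fin n) ℂ := .of fun j k => cAvg fun z => z ^ (((j : ℕ) + 1 : ℕ) : ℤ) * e k z
  have hM : ∀ (r : Fin n → ℂ) (j : Fin n), (M.mulVecLin r) j =
      cAvg fun z => z ^ (((j : ℕ) + 1 : ℕ) : ℤ) * ∑ k, r k * e k z := by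
    intro r j
    rw [Matrix.mulVecLin_apply, Matrix.mulVec, dotProduct]
    simp only [Finset.mul_sum]
    rw [cAvg_sum]
    · refine Finset.sum_congr rfl fun k _ => ?_
      simp only [M, Matrix.of_apply]
      rw [mul_comm, ← cAvg_const_mul]
      exact cAvg_congr fun z _ => by ring
    · intro k _
      exact hzd _ ((heo k).const_mul _)
  have hsum : ∀ r : Fin n → ℂ, IsOddTheta p (n + 1) (fun z => ∑ k, r k * e k z) := fun r =>
    isOddTheta_sum _ fun k _ => (heo k).const_mul _
  have hinj : Function.Injective M.mulVecLin := by
    rw [← LinearMap.ker_eq_bot, LinearMap.ker_eq_bot']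
    intro r hr
    have h0 : ∀ z, z ≠ 0 → ∑ k, r k * e k z = 0 := by
      intro z hz
      refine (hsum r).eq_zero hp hp0 (Nat.succ_pos n) (fun k hk hk' => ?_) hz
      have := congrFun hr ⟨k - 1, by omega⟩
      rw [hM] at this
      simpa [Nat.sub_add_cancel hk] using this
    obtain ⟨w, hw0, hw⟩ := exists_thSq_ne_zero hp
    refine thMono_linearIndependent hp hα hβ hαβ ?_
    refine eq_zero_of_mul_eq_zero_punctured (f := thSq p) (isOddTheta_thSq hp hp0).diff
      (fun z hz => DifferentiableAt.fun_sum fun k _ =>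
        ((isEvenTheta_thMono hp hp0 hα hβ k).diff z hz).const_mul _) (fun z hz => ?_) hw0 hw
    rw [← h0 z hz, Finset.mul_sum]
    exact Finset.sum_congr rfl fun k _ => by simp only [he]; ring
  obtain ⟨r, hr⟩ := (LinearMap.injective_iff_surjective.1 hinj)
    (fun j => cAvg fun z => z ^ (((j : ℕ) + 1 : ℕ) : ℤ) * F z)
  refine ⟨r, fun z hz => ?_⟩
  have h0 : F z - ∑ k, r k * e k z = 0 := by
    refine (hF.sub (hsum r)).eq_zero hp hp0 (Nat.succ_pos n) (fun k hk hk' => ?_) hz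
    have := congrFun hr ⟨k - 1, by omega⟩
    rw [hM] at this
    simp only [Nat.sub_add_cancel hk] at this
    have e1 : (fun z => z ^ (k : ℤ) * (F z - ∑ k, r k * e k z)) = fun z =>
        z ^ (k : ℤ) * F z + (-1) * (z ^ (k : ℤ) * ∑ k, r k * e k z) := by
      funext z; ring
    rw [e1, cAvg_add (hzd k hF), cAvg_const_mul, this]
    · ring
    · exact (continuousOn_const).mul (hzd k (hsum r))
  rw [sub_eq_zero.1 h0, Finset.mul_sum]
  exact Finset.sum_congr rfl fun k _ => by simp only [he]; ring

theorem thP_pluecker (hp : ‖p‖ < 1) (hp0 : p ≠ 0) {α β a z : ℂ} (hα : α ≠ 0) (hβ : β ≠ 0)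
    (hαβ : thP p α β ≠ 0) (ha : a ≠ 0) (hz : z ≠ 0) :
    thP p a z * thP p α β = thP p a β * thP p α z - thP p a α * thP p β z := by
  have hF : IsOddTheta p (2 + 1) (fun z => thSq p z * thP p a z) :=
    (isOddTheta_thSq hp hp0).mul_even (isEvenTheta_thP hp hp0 ha)
  obtain ⟨r, hr⟩ := hF.exists_eq_sum hp hp0 hα hβ hαβ
  obtain ⟨w, hw0, hw⟩ := exists_thSq_ne_zero hp
  have h1 : ∀ z, z ≠ 0 → thP p a z - (r 0 * thP p α z + r 1 * thP p β z) = 0 := by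
    refine eq_zero_of_mul_eq_zero_punctured (f := thSq p) (isOddTheta_thSq hp hp0).diff
      (fun z hz => ?_) (fun z hz => ?_) hw0 hw
    · exact (differentiableAt_thP hp ha hz).sub (((differentiableAt_thP hp hα hz).const_mul _).add
        ((differentiableAt_thP hp hβ hz).const_mul _))
    · rw [mul_sub, hr z hz]
      simp [Fin.sum_univ_two, thMono]
  have hb := h1 β hβ
  have ha' := h1 α hα
  rw [thP_self p hβ] at hb
  rw [thP_self p hα, thP_antisymm hp hβ hα] at ha'
  linear_combination (thP p α β) * h1 z hz - thP p α z * hb + thP p β z * ha'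

theorem thP_mul_sub_mul (hp : ‖p‖ < 1) (hp0 : p ≠ 0) {α β a z : ℂ} (hα : α ≠ 0) (hβ : β ≠ 0)
    (hαβ : thP p α β ≠ 0) (ha : a ≠ 0) (hz : z ≠ 0) :
    thP p β z * thP p α a - thP p β a * thP p α z = thP p α β * thP p a z := by
  rw [thP_antisymm hp hα ha, thP_antisymm hp hβ ha]
  linear_combination -thP_pluecker hp hp0 hα hβ hαβ ha hz

theorem prod_Ioi_const {n : ℕ} (c : ℂ) :
    ∏ i : Fin n, ∏ _j ∈ Finset.Ioi i, c = c ^ (n.choose 2) := by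
  simp only [Finset.prod_const, Fin.card_Ioi]
  rw [Finset.prod_pow_eq_pow_sum]
  congr 1
  rw [← Fin.sum_univ_eq_sum_range (fun i => i) n |>.trans (Finset.sum_range_id n) |>.trans
    (Nat.choose_two_right n).symm]
  rw [← Equiv.sum_comp Fin.revPerm]
  refine Finset.sum_congr rfl fun i _ => ?_
  simp only [Fin.revPerm_apply, Fin.val_rev]
  omega

/-- The determinant of the theta monomials is a product of theta functions. -/
theorem det_thMono (hp : ‖p‖ < 1) (hp0 : p ≠ 0) {α β : ℂ} (hα : α ≠ 0) (hβ : β ≠ 0)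
    (hαβ : thP p α β ≠ 0) {n : ℕ} {z : Fin n → ℂ} (hz : ∀ i, z i ≠ 0) :
    (Matrix.of fun i k => thMono p α β n k (z i)).det =
      thP p α β ^ (n.choose 2) * ∏ i, ∏ j ∈ Finset.Ioi i, thP p (z i) (z j) := by
  have h : (Matrix.of fun i k => thMono p α β n k (z i)) =
      Matrix.projVandermonde (fun i => thP p β (z i)) (fun i => thP p α (z i)) := by
    ext i j; rfl
  rw [h, Matrix.det_projVandermonde, ← prod_Ioi_const, ← Finset.prod_mul_distrib]
  refine Finset.prod_congr rfl fun i _ => ?_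
  rw [← Finset.prod_mul_distrib]
  refine Finset.prod_congr rfl fun j _ => ?_
  exact thP_mul_sub_mul hp hp0 hα hβ hαβ (hz i) (hz j)

theorem IsOddTheta.eq_zero_of_zeros (hp : ‖p‖ < 1) (hp0 : p ≠ 0) {n : ℕ} {F : ℂ → ℂ}
    (hF : IsOddTheta p (n + 1) F) {a : Fin n → ℂ} (ha : ∀ i, a i ≠ 0)
    (ha2 : ∀ i, thSq p (a i) ≠ 0) (haa : ∀ i j, i < j → thP p (a i) (a j) ≠ 0)
    (h0 : ∀ i, F (a i) = 0) {z : ℂ} (hz : z ≠ 0) : F z = 0 := by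
  obtain ⟨α, β, hα, hβ, hαβ⟩ := exists_thP_ne_zero hp
  obtain ⟨r, hr⟩ := hF.exists_eq_sum hp hp0 hα hβ hαβ
  have hdet : (Matrix.of fun i k => thMono p α β n k (a i)).det ≠ 0 := by
    rw [det_thMono hp hp0 hα hβ hαβ ha]
    refine mul_ne_zero (pow_ne_zero _ hαβ) ?_
    exact Finset.prod_ne_zero_iff.2 fun i _ => Finset.prod_ne_zero_iff.2 fun j hj =>
      haa i j (Finset.mem_Ioi.1 hj)
  have hr0 : r = 0 := by
    refine Matrix.eq_zero_of_mulVec_eq_zero hdet ?_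
    funext i
    have := h0 i
    rw [hr _ (ha i)] at this
    rw [Matrix.mulVec, dotProduct, Pi.zero_apply,
      ← (mul_eq_zero.1 this).resolve_left (ha2 i)]
    exact Finset.sum_congr rfl fun k _ => by rw [Matrix.of_apply, mul_comm]
  rw [hr z hz, hr0]
  simp

end ThMono

section Andreief

theorem continuous_comp_exp {f : ℂ → ℂ} (hf : ContinuousOn f (sphere 0 1)) :
    Continuous fun t : ℝ => f (Complex.exp (Complex.I * t)) := by
  refine hf.comp_continuous (by fun_prop) fun t => ?_
  rw [mem_sphere_zero_iff_norm, mul_comm, Complex.norm_exp_ofReal_mul_I]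

theorem norm_exp_I_mul (t : ℝ) : ‖Complex.exp (Complex.I * t)‖ = 1 := by
  rw [mul_comm, Complex.norm_exp_ofReal_mul_I]

theorem cAvg_eq_setIntegral (f : ℂ → ℂ) :
    cAvg f = ((1 / (2 * Real.pi) : ℝ) : ℂ) *
      ∫ t in Icc (0 : ℝ) (2 * Real.pi), f (Complex.exp (Complex.I * t)) := by
  rw [cAvg, Real.circleAverage_def, integral_Icc_eq_integral_Ioc,
    ← intervalIntegral.integral_of_le Real.two_pi_pos.le, one_div, Complex.real_smul]
  congr 1
  refine intervalIntegral.integral_congr fun t _ => ?_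
  simp [circleMap, mul_comm]

theorem torusInt_congr {n : ℕ} {f g : (Fin n → ℂ) → ℂ}
    (h : ∀ z : Fin n → ℂ, (∀ i, ‖z i‖ = 1) → f z = g z) : torusInt n f = torusInt n g := by
  rw [torusInt, torusInt]
  congr 2
  funext t
  exact h _ fun i => norm_exp_I_mul _

theorem torusInt_const_mul {n : ℕ} (c : ℂ) (f : (Fin n → ℂ) → ℂ) :
    torusInt n (fun z => c * f z) = c * torusInt n f := by
  simp only [torusInt]
  rw [integral_const_mul]
  ring

theorem torusInt_prod {n : ℕ} (f : Fin n → ℂ → ℂ) :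
    torusInt n (fun z => ∏ i, f i (z i)) = ∏ i, cAvg (f i) := by
  simp only [cAvg_eq_setIntegral]
  rw [Finset.prod_mul_distrib, Finset.prod_const, Finset.card_univ, Fintype.card_fin, torusInt]
  congr 1
  have h := Measure.restrict_pi_pi (fun _ : Fin n => (volume : Measure ℝ))
    (fun _ => Icc (0 : ℝ) (2 * Real.pi))
  rw [← volume_pi] at h
  rw [h]
  exact integral_fintype_prod_eq_prod (𝕜 := ℂ)
    (fun i (t : ℝ) => f i (Complex.exp (Complex.I * t)))

theorem integrableOn_torus {n : ℕ} {f : (Fin n → ℝ) → ℂ} (hf : Continuous f) :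
    IntegrableOn f (Set.univ.pi fun _ : Fin n => Icc (0 : ℝ) (2 * Real.pi)) :=
  hf.continuousOn.integrableOn_compact (isCompact_univ_pi fun _ => isCompact_Icc)

theorem torusInt_sum {n : ℕ} {ι : Type*} (s : Finset ι) {f : ι → (Fin n → ℂ) → ℂ}
    (hf : ∀ k ∈ s, Continuous fun t : Fin n → ℝ => f k fun i => Complex.exp (Complex.I * t i)) :
    torusInt n (fun z => ∑ k ∈ s, f k z) = ∑ k ∈ s, torusInt n (f k) := by
  simp only [torusInt]
  rw [integral_finsetSum _ fun k hk => integrableOn_torus (hf k hk), Finset.mul_sum]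

theorem det_of_apply_row {n : ℕ} (M : Matrix (Fin n) (Fin n) ℂ) :
    M.det = ∑ σ : Equiv.Perm (Fin n), ((Equiv.Perm.sign σ : ℤ) : ℂ) * ∏ i, M i (σ i) := by
  rw [← Matrix.det_transpose, Matrix.det_apply']
  rfl

/-- Andréief's identity on the torus. -/
theorem torusInt_det_mul_det {n : ℕ} {w : ℂ → ℂ} {f g : Fin n → ℂ → ℂ}
    (hw : ContinuousOn w (sphere 0 1)) (hf : ∀ k, ContinuousOn (f k) (sphere 0 1))
    (hg : ∀ k, ContinuousOn (g k) (sphere 0 1)) :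
    torusInt n (fun z => (Matrix.of fun i k => f k (z i)).det *
        (Matrix.of fun i k => g k (z i)).det * ∏ i, w (z i)) =
      (n.factorial : ℂ) * (Matrix.of fun j k => cAvg fun z => f j z * g k z * w z).det := by
  have e : ∀ z : Fin n → ℂ, (Matrix.of fun i k => f k (z i)).det *
        (Matrix.of fun i k => g k (z i)).det * ∏ i, w (z i) =
      ∑ τ : Equiv.Perm (Fin n), ∑ σ : Equiv.Perm (Fin n),
        ((Equiv.Perm.sign σ : ℤ) : ℂ) * ((Equiv.Perm.sign τ : ℤ) : ℂ) *
          ∏ i, (f (σ i) (z i) * g (τ i) (z i) * w (z i)) := by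
    intro z
    rw [det_of_apply_row, det_of_apply_row, Finset.sum_mul_sum, Finset.sum_comm, Finset.sum_mul]
    refine Finset.sum_congr rfl fun τ _ => ?_
    rw [Finset.sum_mul]
    refine Finset.sum_congr rfl fun σ _ => ?_
    simp only [Finset.prod_mul_distrib, Matrix.of_apply]
    ring
  have hc : ∀ τ σ : Equiv.Perm (Fin n), Continuous fun t : Fin n → ℝ =>
      ((Equiv.Perm.sign σ : ℤ) : ℂ) * ((Equiv.Perm.sign τ : ℤ) : ℂ) *
        ∏ i, (f (σ i) (Complex.exp (Complex.I * t i)) * g (τ i) (Complex.exp (Complex.I * t i)) *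
          w (Complex.exp (Complex.I * t i))) := by
    intro τ σ
    refine continuous_const.mul (continuous_finsetProd _ fun i _ => ?_)
    exact (((continuous_comp_exp (hf (σ i))).comp (continuous_apply i)).mul
      ((continuous_comp_exp (hg (τ i))).comp (continuous_apply i))).mul
      ((continuous_comp_exp hw).comp (continuous_apply i))
  simp only [e]
  refine (torusInt_sum (f := fun τ z => ∑ σ : Equiv.Perm (Fin n),
    ((Equiv.Perm.sign σ : ℤ) : ℂ) * ((Equiv.Perm.sign τ : ℤ) : ℂ) *
      ∏ i, (f (σ i) (z i) * g (τ i) (z i) * w (z i))) Finset.univ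
    fun τ _ => continuous_finsetSum _ fun σ _ => hc τ σ).trans ?_
  have key : ∀ τ : Equiv.Perm (Fin n), torusInt n (fun z => ∑ σ : Equiv.Perm (Fin n),
        ((Equiv.Perm.sign σ : ℤ) : ℂ) * ((Equiv.Perm.sign τ : ℤ) : ℂ) *
          ∏ i, (f (σ i) (z i) * g (τ i) (z i) * w (z i))) =
      (Matrix.of fun j k => cAvg fun z => f j z * g k z * w z).det := by
    intro τ
    rw [torusInt_sum _ fun σ _ => hc τ σ, Matrix.det_apply', ← Equiv.sum_comp (Equiv.mulRight τ)]
    refine Finset.sum_congr rfl fun σ _ => ?_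
    rw [torusInt_const_mul, torusInt_prod fun i z => f (Equiv.mulRight τ σ i) z * g (τ i) z * w z,
      ← Equiv.prod_comp τ fun i => Matrix.of (fun j k => cAvg fun z => f j z * g k z * w z) (σ i) i]
    simp only [Equiv.coe_mulRight, Equiv.Perm.sign_mul, Equiv.Perm.mul_apply, Matrix.of_apply,
      Units.val_mul, Int.cast_mul]
    rcases Int.units_eq_one_or (Equiv.Perm.sign τ) with h | h <;> simp [h]
  rw [Finset.sum_congr rfl fun τ _ => key τ]
  simp [Fintype.card_perm]

/-- The torus average of `∏ W (z i)` against the elliptic Vandermonde densities. -/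
noncomputable def thAvg (p q : ℂ) (n : ℕ) (W : ℂ → ℂ) : ℂ :=
  torusInt n fun z => (∏ i, ∏ j ∈ Finset.Ioi i, thP p (z i) (z j) * thP q (z i) (z j)) *
    ∏ i, W (z i)

theorem thAvg_congr {p q : ℂ} {n : ℕ} {W V : ℂ → ℂ} (h : ∀ z, ‖z‖ = 1 → W z = V z) :
    thAvg p q n W = thAvg p q n V :=
  torusInt_congr fun z hz => by
    rw [Finset.prod_congr rfl fun i _ => h (z i) (hz i)]

theorem thAvg_const_mul {p q : ℂ} {n : ℕ} (c : ℂ) (W : ℂ → ℂ) :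
    thAvg p q n (fun z => c * W z) = c ^ n * thAvg p q n W := by
  simp only [thAvg]
  rw [← torusInt_const_mul]
  refine torusInt_congr fun z _ => ?_
  rw [Finset.prod_mul_distrib, Finset.prod_const, Finset.card_univ, Fintype.card_fin]
  ring

theorem thAvg_swap (p q : ℂ) (n : ℕ) (W : ℂ → ℂ) : thAvg p q n W = thAvg q p n W :=
  torusInt_congr fun z _ => by simp only [mul_comm]

theorem thAvg_zero (p q : ℂ) (W : ℂ → ℂ) : thAvg p q 0 W = 1 := by
  have h : (Set.univ.pi fun _ : Fin 0 => Icc (0 : ℝ) (2 * Real.pi)) = Set.univ :=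
    Set.eq_univ_of_forall fun _ i => i.elim0
  rw [thAvg, torusInt, h, volume_pi, Measure.pi_of_empty]
  simp

theorem continuousOn_thMono {p α β : ℂ} (hp : ‖p‖ < 1) (hp0 : p ≠ 0) (hα : α ≠ 0) (hβ : β ≠ 0)
    {n : ℕ} (k : Fin n) : ContinuousOn (thMono p α β n k) (sphere 0 1) :=
  continuousOn_sphere_of_differentiableAt (isEvenTheta_thMono hp hp0 hα hβ k).diff

theorem thAvg_eq_det {p q : ℂ} (hp : ‖p‖ < 1) (hp0 : p ≠ 0) (hq : ‖q‖ < 1) (hq0 : q ≠ 0)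
    {α β γ δ : ℂ} (hα : α ≠ 0) (hβ : β ≠ 0) (hγ : γ ≠ 0) (hδ : δ ≠ 0)
    (hαβ : thP q α β ≠ 0) (hγδ : thP p γ δ ≠ 0) (n : ℕ) {W : ℂ → ℂ}
    (hW : ContinuousOn W (sphere 0 1)) :
    thP q α β ^ (n.choose 2) * thP p γ δ ^ (n.choose 2) * thAvg p q n W = (n.factorial : ℂ) *
      (Matrix.of fun j k : Fin n =>
        cAvg fun z => thMono q α β n j z * thMono p γ δ n k z * W z).det := by
  rw [← torusInt_det_mul_det hW (fun k => continuousOn_thMono hq hq0 hα hβ k)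
    (fun k => continuousOn_thMono hp hp0 hγ hδ k), thAvg, ← torusInt_const_mul]
  refine torusInt_congr fun z hz => ?_
  have hz0 : ∀ i, z i ≠ 0 := fun i => norm_pos_iff.1 (by rw [hz i]; exact one_pos)
  rw [det_thMono hq hq0 hα hβ hαβ hz0, det_thMono hp hp0 hγ hδ hγδ hz0]
  simp only [Finset.prod_mul_distrib]
  ring

end Andreief

section Weight

variable {p q : ℂ} {ι : Type*} [Fintype ι]

/-- The weight function of the elliptic beta integral with parameters `t`. -/
noncomputable def thW (p q : ℂ) (t : ι → ℂ) (z : ℂ) : ℂ :=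
  ellTheta (z ^ 2) p * ellTheta (z⁻¹ ^ 2) q *
    ∏ r, (ellGamma (t r * z) p q * ellGamma (t r / z) p q)

theorem ne_zero_of_norm_one {z : ℂ} (hz : ‖z‖ = 1) : z ≠ 0 :=
  norm_pos_iff.1 (by rw [hz]; exact one_pos)

theorem differentiableAt_ellGamma_mul (hp : ‖p‖ < 1) (hq : ‖q‖ < 1) {a z : ℂ} (ha : a ≠ 0)
    (hz : z ≠ 0) (h : ‖a‖ * ‖z‖ < 1) :
    DifferentiableAt ℂ (fun z => ellGamma (a * z) p q) z :=
  (differentiableAt_ellGamma hp hq (mul_ne_zero ha hz) (by rwa [norm_mul])).comp z (by fun_prop)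

theorem differentiableAt_ellGamma_div (hp : ‖p‖ < 1) (hq : ‖q‖ < 1) {a z : ℂ} (ha : a ≠ 0)
    (hz : z ≠ 0) (h : ‖a‖ < ‖z‖) :
    DifferentiableAt ℂ (fun z => ellGamma (a / z) p q) z :=
  (differentiableAt_ellGamma hp hq (div_ne_zero ha hz)
    (by rw [norm_div, div_lt_one (norm_pos_iff.2 hz)]; exact h)).comp z
      ((differentiableAt_const a).div differentiableAt_id hz)

theorem differentiableAt_ellTheta_sq (hp : ‖p‖ < 1) {z : ℂ} (hz : z ≠ 0) :
    DifferentiableAt ℂ (fun z => ellTheta (z ^ 2) p) z :=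
  DifferentiableAt.comp z (g := fun x => ellTheta x p)
    (differentiableAt_ellTheta hp (pow_ne_zero 2 hz)) (differentiableAt_pow 2)

theorem differentiableAt_ellTheta_inv_sq (hp : ‖p‖ < 1) {z : ℂ} (hz : z ≠ 0) :
    DifferentiableAt ℂ (fun z => ellTheta (z⁻¹ ^ 2) p) z :=
  DifferentiableAt.comp z (g := fun x => ellTheta (x ^ 2) p)
    (differentiableAt_ellTheta_sq hp (inv_ne_zero hz)) (differentiableAt_inv hz)

theorem differentiableAt_thW (hp : ‖p‖ < 1) (hq : ‖q‖ < 1) {t : ι → ℂ} (ht0 : ∀ r, t r ≠ 0)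
    {z : ℂ} (hz0 : z ≠ 0) (h1 : ∀ r, ‖t r‖ * ‖z‖ < 1) (h2 : ∀ r, ‖t r‖ < ‖z‖) :
    DifferentiableAt ℂ (thW p q t) z := by
  refine ((differentiableAt_ellTheta_sq hp hz0).mul (differentiableAt_ellTheta_inv_sq hq hz0)).mul
    (DifferentiableAt.fun_finsetProd fun r _ => ?_)
  exact (differentiableAt_ellGamma_mul hp hq (ht0 r) hz0 (h1 r)).mul
    (differentiableAt_ellGamma_div hp hq (ht0 r) hz0 (h2 r))

theorem continuousOn_thW (hp : ‖p‖ < 1) (hq : ‖q‖ < 1) {t : ι → ℂ} (ht0 : ∀ r, t r ≠ 0)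
    (ht1 : ∀ r, ‖t r‖ < 1) : ContinuousOn (thW p q t) (sphere 0 1) := by
  intro z hz
  rw [mem_sphere_zero_iff_norm] at hz
  exact (differentiableAt_thW hp hq ht0 (ne_zero_of_norm_one hz)
    (fun r => by rw [hz, mul_one]; exact ht1 r)
    (fun r => by rw [hz]; exact ht1 r)).continuousAt.continuousWithinAt

theorem ellGamma_nome_mul_of_norm (hp : ‖p‖ < 1) (hp0 : p ≠ 0) (hq : ‖q‖ < 1) {x : ℂ}
    (hx0 : x ≠ 0) (hx : ‖x‖ < 1) : ellGamma (p * x) p q = ellTheta x q * ellGamma x p q :=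
  ellGamma_nome_mul hp hp0 hq hx0 (qp1_ne_zero_of_norm_lt hq hx)

/-- Multiplying a parameter by `p` multiplies the weight by a theta function of nome `q`. -/
theorem thP_mul_thW [DecidableEq ι] (hp : ‖p‖ < 1) (hp0 : p ≠ 0) (hq : ‖q‖ < 1) {t : ι → ℂ}
    {b : ι} (hb0 : t b ≠ 0) (hb1 : ‖t b‖ < 1) {z : ℂ} (hz : ‖z‖ = 1) :
    thP q (t b) z * thW p q t z = (t b)⁻¹ * thW p q (Function.update t b (p * t b)) z := by
  have hz0 := ne_zero_of_norm_one hz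
  have e : ∀ s : ι → ℂ, ∏ r, (ellGamma (s r * z) p q * ellGamma (s r / z) p q) =
      (ellGamma (s b * z) p q * ellGamma (s b / z) p q) *
        ∏ r ∈ Finset.univ.erase b, (ellGamma (s r * z) p q * ellGamma (s r / z) p q) := fun s =>
    (Finset.mul_prod_erase _ _ (Finset.mem_univ b)).symm
  have e2 : ∏ r ∈ Finset.univ.erase b, (ellGamma (Function.update t b (p * t b) r * z) p q *
      ellGamma (Function.update t b (p * t b) r / z) p q) =
      ∏ r ∈ Finset.univ.erase b, (ellGamma (t r * z) p q * ellGamma (t r / z) p q) :=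
    Finset.prod_congr rfl fun r hr => by
      rw [Function.update_of_ne (Finset.ne_of_mem_erase hr)]
  rw [thW, thW, thP, e t, e (Function.update _ _ _), e2, Function.update_self, mul_assoc p, mul_div_assoc p,
    ellGamma_nome_mul_of_norm hp hp0 hq (mul_ne_zero hb0 hz0) (by rwa [norm_mul, hz, mul_one]),
    ellGamma_nome_mul_of_norm hp hp0 hq (div_ne_zero hb0 hz0) (by rwa [norm_div, hz, div_one])]
  ring

theorem differentiableAt_pow_inv (N : ℕ) {z : ℂ} (hz : z ≠ 0) :
    DifferentiableAt ℂ (fun z : ℂ => (z ^ N)⁻¹) z :=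
  DifferentiableAt.fun_inv (differentiableAt_pow N) (pow_ne_zero N hz)

/-- The un-symmetrized numerator theta function. -/
noncomputable def thG (q : ℂ) (N : ℕ) (t : ι → ℂ) (z : ℂ) : ℂ := (z ^ N)⁻¹ * ∏ r, ellTheta (t r * z) q

theorem differentiableAt_thG (hq : ‖q‖ < 1) (N : ℕ) {t : ι → ℂ} (ht0 : ∀ r, t r ≠ 0) {z : ℂ}
    (hz : z ≠ 0) : DifferentiableAt ℂ (thG q N t) z := by
  refine (differentiableAt_pow_inv N hz).mul
    (DifferentiableAt.fun_finsetProd fun r _ => ?_)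
  exact (differentiableAt_ellTheta hq (mul_ne_zero (ht0 r) hz)).comp z (by fun_prop)

theorem isOddTheta_thG (hq : ‖q‖ < 1) (hq0 : q ≠ 0) {n : ℕ} (hι : Fintype.card ι = 2 * n + 4)
    {t : ι → ℂ} (ht0 : ∀ r, t r ≠ 0) (ht : ∏ r, t r = q) :
    IsOddTheta q (n + 1 + 1) (fun z => thG q (n + 1) t z - thG q (n + 1) t z⁻¹) := by
  refine isOddTheta_antisymm hq0 (fun z hz => differentiableAt_thG hq _ ht0 hz) fun z hz => ?_
  have e : ∏ r, ellTheta (t r * (q * z)) q = (q * z ^ (2 * n + 4))⁻¹ * ∏ r, ellTheta (t r * z) q := by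
    have : ∀ r, ellTheta (t r * (q * z)) q = (-1 * z⁻¹ * (t r)⁻¹) * ellTheta (t r * z) q := by
      intro r
      rw [show t r * (q * z) = q * (t r * z) by ring,
        ellTheta_mul_nome hq hq0 (mul_ne_zero (ht0 r) hz), mul_inv]
      ring
    simp only [this, Finset.prod_mul_distrib, Finset.prod_const, Finset.card_univ, hι,
      Finset.prod_inv_distrib, ht]
    rw [Even.neg_one_pow ⟨n + 2, by ring⟩, mul_inv, inv_pow]
    ring
  rw [thG, thG, e]
  field_simp
  ring

/-- The half-sum whose symmetrization is the weight times a theta function. -/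
noncomputable def thH (p q : ℂ) (N : ℕ) (t : ι → ℂ) (f : ℂ → ℂ) (z : ℂ) : ℂ :=
  -((z ^ (N + 1))⁻¹ * ellTheta (z ^ 2) p * f z *
    ∏ r, (ellGamma (p * t r * z) p q * ellGamma (t r / z) p q))

theorem differentiableAt_thH (hp : ‖p‖ < 1) (hp0 : p ≠ 0) (hq : ‖q‖ < 1) (N : ℕ) {t : ι → ℂ}
    (ht0 : ∀ r, t r ≠ 0) (ht1 : ∀ r, ‖t r‖ < 1) {f : ℂ → ℂ} {z : ℂ} (h1 : 1 ≤ ‖z‖)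
    (h2 : ‖z‖ ≤ ‖p‖⁻¹) (hf : DifferentiableAt ℂ f z) :
    DifferentiableAt ℂ (thH p q N t f) z := by
  have hz0 : z ≠ 0 := norm_pos_iff.1 (by linarith)
  refine (DifferentiableAt.mul (((differentiableAt_pow_inv _ hz0).mul
    (differentiableAt_ellTheta_sq hp hz0)).mul hf)
    (DifferentiableAt.fun_finsetProd fun r _ => ?_)).neg
  refine (differentiableAt_ellGamma_mul hp hq (mul_ne_zero hp0 (ht0 r)) hz0 ?_).mul
    (differentiableAt_ellGamma_div hp hq (ht0 r) hz0 ((ht1 r).trans_le h1))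
  have h3 : ‖p‖ * ‖z‖ ≤ 1 := by rwa [← le_inv_mul_iff₀ (norm_pos_iff.2 hp0), mul_one]
  have h4 := norm_pos_iff.2 (ht0 r)
  calc ‖p * t r‖ * ‖z‖ = ‖t r‖ * (‖p‖ * ‖z‖) := by rw [norm_mul]; ring
    _ ≤ ‖t r‖ * 1 := by gcongr
    _ < 1 := by rw [mul_one]; exact ht1 r

theorem thH_inv_nome_mul (hp : ‖p‖ < 1) (hp0 : p ≠ 0) (q : ℂ) (M : ℕ) (t : ι → ℂ) {f : ℂ → ℂ} {z : ℂ}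
    (hz : z ≠ 0) (hf : f (p * z)⁻¹ = p * z ^ 2 * ((p * z ^ 2) ^ M)⁻¹ * f z) :
    thH p q (M + 1) t f (p * z)⁻¹ = -thH p q (M + 1) t f z := by
  have hpz := mul_ne_zero hp0 hz
  have hz2 := pow_ne_zero 2 hz
  have e1 : ∏ r, (ellGamma (p * t r * (p * z)⁻¹) p q * ellGamma (t r / (p * z)⁻¹) p q) =
      ∏ r, (ellGamma (p * t r * z) p q * ellGamma (t r / z) p q) := by
    refine Finset.prod_congr rfl fun r _ => ?_
    rw [mul_comm (ellGamma (p * t r * z) p q)]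
    congr 2
    · field_simp
    · field_simp
  have e2 : ellTheta ((p * z)⁻¹ ^ 2) p = -((p * z) ^ 2)⁻¹ * (p * z ^ 4)⁻¹ * ellTheta (z ^ 2) p := by
    rw [inv_pow, ellTheta_inv hp (pow_ne_zero 2 hpz), show (p * z) ^ 2 = p * (p * z ^ 2) by ring,
      ellTheta_mul_nome hp hp0 (mul_ne_zero hp0 hz2), ellTheta_mul_nome hp hp0 hz2]
    field_simp
  rw [thH, thH, e1, e2, hf]
  generalize ∏ r, (ellGamma (p * t r * z) p q * ellGamma (t r / z) p q) = Y
  rw [inv_pow, inv_inv]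
  field_simp
  ring

theorem mul_thW_eq_thH_add (hp : ‖p‖ < 1) (hp0 : p ≠ 0) (hq : ‖q‖ < 1) {N : ℕ}
    {t : ι → ℂ} (ht0 : ∀ r, t r ≠ 0) (ht1 : ∀ r, ‖t r‖ < 1) {φ f : ℂ → ℂ} {z : ℂ} (hz : ‖z‖ = 1)
    (hφ : thSq q z * φ z = thG q N t z - thG q N t z⁻¹) (hf : f z⁻¹ = f z) :
    φ z * f z * thW p q t z = thH p q N t f z + thH p q N t f z⁻¹ := by
  have hz0 := ne_zero_of_norm_one hz
  have hz2 := pow_ne_zero 2 hz0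
  have e1 : ∏ r, (ellGamma (p * t r * z) p q * ellGamma (t r / z) p q) =
      (∏ r, ellTheta (t r * z) q) * ∏ r, (ellGamma (t r * z) p q * ellGamma (t r / z) p q) := by
    rw [← Finset.prod_mul_distrib]
    refine Finset.prod_congr rfl fun r _ => ?_
    rw [mul_assoc p, ellGamma_nome_mul_of_norm hp hp0 hq (mul_ne_zero (ht0 r) hz0)
      (by rw [norm_mul, hz, mul_one]; exact ht1 r)]
    ring
  have e2 : ∏ r, (ellGamma (p * t r * z⁻¹) p q * ellGamma (t r / z⁻¹) p q) =
      (∏ r, ellTheta (t r * z⁻¹) q) * ∏ r, (ellGamma (t r * z) p q * ellGamma (t r / z) p q) := by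
    rw [← Finset.prod_mul_distrib]
    refine Finset.prod_congr rfl fun r _ => ?_
    rw [mul_assoc p, ellGamma_nome_mul_of_norm hp hp0 hq (mul_ne_zero (ht0 r) (inv_ne_zero hz0))
      (by rw [norm_mul, norm_inv, hz, inv_one, mul_one]; exact ht1 r), div_inv_eq_mul,
      div_eq_mul_inv]
    ring
  have e3 : thW p q t z = -(z⁻¹ * thSq q z) * ellTheta (z ^ 2) p *
      ∏ r, (ellGamma (t r * z) p q * ellGamma (t r / z) p q) := by
    rw [thW, thSq, inv_pow, ellTheta_inv hq hz2]
    ring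
  have e4 : φ z * f z * thW p q t z = -(thSq q z * φ z) * (z⁻¹ * f z * ellTheta (z ^ 2) p *
      ∏ r, (ellGamma (t r * z) p q * ellGamma (t r / z) p q)) := by
    rw [e3]; ring
  rw [e4, hφ, thH, thH, e1, e2, hf, inv_pow z 2, ellTheta_inv hp hz2, thG, thG]
  simp only [inv_pow, inv_inv]
  generalize ∏ r, (ellGamma (t r * z) p q * ellGamma (t r / z) p q) = Y
  generalize ∏ r, ellTheta (t r * z⁻¹) q = Y₁
  generalize ∏ r, ellTheta (t r * z) q = Y₂
  field_simp
  ring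

theorem cAvg_add_inv {H : ℂ → ℂ} (hH : ContinuousOn H (sphere 0 1)) :
    cAvg (fun z => H z + H z⁻¹) = 2 * cAvg H := by
  rw [cAvg_add hH, cAvg_inv]
  · ring
  refine hH.comp (continuousOn_inv₀.mono fun z hz => ?_) fun z hz => ?_
  · exact ne_zero_of_norm_one (mem_sphere_zero_iff_norm.1 hz)
  · rw [mem_sphere_zero_iff_norm] at hz ⊢
    rw [norm_inv, hz, inv_one]

theorem cAvg_eq_zero_of_inv_nome_mul {s : ℂ} (hs0 : s ≠ 0) {H : ℂ → ℂ}
    (hsym : ∀ z, z ≠ 0 → H (s ^ 2 * z)⁻¹ = -H z) : cAvg (fun z => H (s⁻¹ * z)) = 0 := by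
  have h2 : cAvg (fun z => H (s⁻¹ * z)) = -1 * cAvg (fun z => H (s⁻¹ * z)) := by
    rw [← cAvg_const_mul, ← cAvg_inv]
    refine cAvg_congr fun z hz => ?_
    have hz0 := ne_zero_of_norm_one hz
    rw [neg_one_mul, ← hsym _ (mul_ne_zero (inv_ne_zero hs0) hz0)]
    congr 1
    field_simp
  linear_combination h2 / 2

theorem exists_sqrt_nome (hp : ‖p‖ < 1) (hp0 : p ≠ 0) :
    ∃ s : ℂ, s ≠ 0 ∧ s ^ 2 = p ∧ ‖s‖ ^ 2 = ‖p‖ ∧ 1 ≤ ‖s⁻¹‖ ∧ ‖s⁻¹‖ ≤ ‖p‖⁻¹ := by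
  obtain ⟨s, hs⟩ := IsAlgClosed.exists_pow_nat_eq p two_pos
  have hs0 : s ≠ 0 := fun h => hp0 (by rw [← hs, h]; simp)
  have hsn : ‖s‖ ^ 2 = ‖p‖ := by rw [← hs, norm_pow]
  have hs1 : ‖s‖ < 1 := by
    by_contra h
    push Not at h
    nlinarith
  refine ⟨s, hs0, hs, hsn, ?_, ?_⟩
  · rw [norm_inv]; exact (one_le_inv₀ (norm_pos_iff.2 hs0)).2 hs1.le
  · rw [norm_inv]
    refine inv_anti₀ (norm_pos_iff.2 hp0) ?_
    rw [← hsn]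
    nlinarith [norm_nonneg s]

theorem cAvg_thG_vanish (hp : ‖p‖ < 1) (hp0 : p ≠ 0) (hq : ‖q‖ < 1) {d : ℕ}
    {t : ι → ℂ} (ht0 : ∀ r, t r ≠ 0)
    (ht1 : ∀ r, ‖t r‖ < 1) {φ f : ℂ → ℂ}
    (hφ : ∀ z, z ≠ 0 → thSq q z * φ z = thG q (d + 2) t z - thG q (d + 2) t z⁻¹)
    (hf : IsEvenTheta p d f) : cAvg (fun z => φ z * f z * thW p q t z) = 0 := by
  set H : ℂ → ℂ := thH p q (d + 2) t f with hH
  have hHd : ∀ z, 1 ≤ ‖z‖ → ‖z‖ ≤ ‖p‖⁻¹ → DifferentiableAt ℂ H z := fun z h1 h2 =>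
    differentiableAt_thH hp hp0 hq _ ht0 ht1 h1 h2 (hf.diff z (norm_pos_iff.1 (by linarith)))
  have hHc : ContinuousOn H (sphere 0 1) := fun z hz => by
    rw [mem_sphere_zero_iff_norm] at hz
    exact (hHd z hz.ge (hz.le.trans
      ((one_le_inv₀ (norm_pos_iff.2 hp0)).2 hp.le))).continuousAt.continuousWithinAt
  obtain ⟨s, hs0, hs, -, hs1, hsp⟩ := exists_sqrt_nome hp hp0
  have h1 : cAvg (fun z => H (s⁻¹ * z)) = cAvg H :=
    cAvg_comp_mul_of_one_le hs1 fun z h1 h2 => hHd z h1 (h2.trans hsp)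
  have h2 : cAvg (fun z => H (s⁻¹ * z)) = 0 := by
    refine cAvg_eq_zero_of_inv_nome_mul hs0 fun z hz => ?_
    rw [hs]
    refine thH_inv_nome_mul hp hp0 q (d + 1) t hz ?_
    have hpz := mul_ne_zero hp0 (pow_ne_zero 2 hz)
    rw [hf.even _ (mul_ne_zero hp0 hz), hf.quasi z hz]
    field_simp
    ring
  rw [cAvg_congr fun z hz => mul_thW_eq_thH_add hp hp0 hq ht0 ht1 hz
    (hφ z (ne_zero_of_norm_one hz)) (hf.even z (ne_zero_of_norm_one hz)), cAvg_add_inv hHc, ← h1, h2,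
    mul_zero]

end Weight

section TwoTerm

variable {p q : ℂ} {ι : Type*} [Fintype ι]

/-- The elliptic Selberg-type average with parameters `t`. -/
noncomputable def thI (p q : ℂ) (n : ℕ) (t : ι → ℂ) : ℂ := thAvg p q n (thW p q t)

theorem thI_zero (p q : ℂ) (t : ι → ℂ) : thI p q 0 t = 1 := thAvg_zero p q _

theorem thAvg_thP_mul_thW [DecidableEq ι] (hp : ‖p‖ < 1) (hp0 : p ≠ 0) (hq : ‖q‖ < 1) (n : ℕ)
    {t : ι → ℂ} {b : ι} (hb0 : t b ≠ 0) (hb1 : ‖t b‖ < 1) :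
    thAvg p q n (fun z => thP q (t b) z * thW p q t z) =
      ((t b)⁻¹) ^ n * thI p q n (Function.update t b (p * t b)) := by
  rw [thI, ← thAvg_const_mul]
  exact thAvg_congr fun z hz => thP_mul_thW hp hp0 hq hb0 hb1 hz

/-- A vector in the left kernel of an `(n + 1) × n` matrix is proportional to the maximal minors. -/
theorem mul_det_succ_eq_mul_det_castSucc {n : ℕ} (K : Matrix (Fin (n + 1)) (Fin n) ℂ)
    {r : Fin (n + 1) → ℂ} (hr : Matrix.vecMul r K = 0) :
    r (Fin.last n) * (K.submatrix Fin.succ id).det =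
      (-1) ^ n * r 0 * (K.submatrix Fin.castSucc id).det := by
  by_cases hr0 : r = 0
  · simp [hr0]
  rcases Nat.eq_zero_or_pos n with rfl | hn
  · simp
  let v : Fin (n + 1) → ℂ := Function.update (Function.update 0 (Fin.last n) (-r 0)) 0 (r (Fin.last n))
  let Y : Matrix (Fin (n + 1)) (Fin (n + 1)) ℂ := .of fun i => Fin.cons (v i) (K i)
  have hne : Fin.last n ≠ 0 := by
    intro h
    have := congrArg Fin.val h
    simp at this
    omega
  have hv : ∀ i, v i = (if i = 0 then r (Fin.last n) else 0) + if i = Fin.last n then -r 0 else 0 := by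
    intro i
    simp only [v, Function.update_apply, Pi.zero_apply]
    by_cases h1 : i = 0
    · subst h1
      simp [hne.symm]
    · simp [h1]
  have hY : Y.det = 0 := by
    rw [← Matrix.exists_vecMul_eq_zero_iff]
    refine ⟨r, hr0, ?_⟩
    funext k
    refine Fin.cases ?_ (fun k => ?_) k
    · simp only [Matrix.vecMul, dotProduct, Y, Matrix.of_apply, Fin.cons_zero, hv, mul_add, mul_ite,
        mul_zero, Finset.sum_add_distrib, Finset.sum_ite_eq', Finset.mem_univ, if_true, Pi.zero_apply]
      ring
    · exact congrFun hr k
  rw [Matrix.det_succ_column_zero] at hY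
  have e : ∀ i, Y.submatrix (Fin.succAbove i) Fin.succ = K.submatrix (Fin.succAbove i) id := fun i => rfl
  have e0 : ∀ i, Y i 0 = v i := fun i => rfl
  simp only [e, e0, hv, add_mul, mul_add, ite_mul, mul_ite, zero_mul, mul_zero,
    Finset.sum_add_distrib, Finset.sum_ite_eq', Finset.mem_univ, if_true] at hY
  rw [Fin.val_zero, pow_zero, one_mul, Fin.val_last] at hY
  have e1 : (Fin.succAbove (0 : Fin (n + 1))) = Fin.succ := Fin.succAbove_zero
  have e2 : (Fin.succAbove (Fin.last n)) = Fin.castSucc := Fin.succAbove_last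
  rw [e1, e2] at hY
  linear_combination hY

theorem thMono_succ (p α β : ℂ) {n : ℕ} (k : Fin n) (z : ℂ) :
    thMono p α β (n + 1) k.succ z = thP p β z * thMono p α β n k z := by
  have : ((k.succ).rev : ℕ) = k.rev := by simp only [Fin.val_rev, Fin.val_succ]; omega
  rw [thMono, thMono, this, Fin.val_succ, pow_succ]
  ring

theorem thMono_castSucc (p α β : ℂ) {n : ℕ} (k : Fin n) (z : ℂ) :
    thMono p α β (n + 1) k.castSucc z = thP p α z * thMono p α β n k z := by
  have : ((k.castSucc).rev : ℕ) = k.rev + 1 := by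
    simp only [Fin.val_rev, Fin.val_castSucc]; omega
  rw [thMono, thMono, this, Fin.val_castSucc, pow_succ]
  ring

theorem thG_inv_eq_zero (q : ℂ) (N : ℕ) {t : ι → ℂ} {a : ι} (ha : t a ≠ 0) :
    thG q N t (t a)⁻¹ = 0 := by
  rw [thG, Finset.prod_eq_zero (Finset.mem_univ a), mul_zero]
  rw [mul_inv_cancel₀ ha, ellTheta_one]

/-- Coefficients at the two extreme monomials of the theta function attached to the parameters. -/
theorem exists_coeff_thG [DecidableEq ι] (hq : ‖q‖ < 1) (hq0 : q ≠ 0) {n : ℕ}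
    (hι : Fintype.card ι = 2 * n + 4) {t : ι → ℂ} (ht0 : ∀ r, t r ≠ 0) (ht : ∏ r, t r = q)
    {α β : ℂ} (hα : α ≠ 0) (hβ : β ≠ 0) (hαβ : thP q α β ≠ 0) :
    ∃ r : Fin (n + 1) → ℂ,
      (∀ z, z ≠ 0 → thSq q z * ∑ k, r k * thMono q α β (n + 1) k z =
        thG q (n + 1) t z - thG q (n + 1) t z⁻¹) ∧
      (∀ b, t b = β → ellTheta (β ^ 2) q ≠ 0 →
        r 0 * thP q α β ^ n = (β ^ n)⁻¹ * ∏ s ∈ Finset.univ.erase b, ellTheta (t b * t s) q) ∧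
      (∀ a, t a = α → ellTheta (α ^ 2) q ≠ 0 →
        r (Fin.last n) * (-thP q α β) ^ n =
          (α ^ n)⁻¹ * ∏ s ∈ Finset.univ.erase a, ellTheta (t a * t s) q) := by
  obtain ⟨r, hr⟩ := (isOddTheta_thG hq hq0 hι ht0 ht).exists_eq_sum hq hq0 hα hβ hαβ
  have hval : ∀ a, ellTheta (t a ^ 2) q ≠ 0 → ∑ k, r k * thMono q α β (n + 1) k (t a) =
      (t a ^ n)⁻¹ * ∏ s ∈ Finset.univ.erase a, ellTheta (t a * t s) q := by
    intro a ha
    have h := hr (t a) (ht0 a)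
    rw [thG_inv_eq_zero q _ (ht0 a), sub_zero, thG, ← Finset.mul_prod_erase _ _ (Finset.mem_univ a),
      thSq, ← sq] at h
    have h2 : t a ≠ 0 := ht0 a
    simp only [mul_comm (t a) (t _)]
    field_simp at h ⊢
    refine mul_left_cancel₀ h2 ?_
    linear_combination -h
  refine ⟨r, fun z hz => (hr z hz).symm, fun b hb hb2 => ?_, fun a ha ha2 => ?_⟩
  · rw [← hb] at hb2
    have h := hval b hb2
    rw [Fin.sum_univ_succ] at h
    simp only [thMono_succ] at h
    rw [hb] at h ⊢
    simp only [thP_self q hβ] at h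
    rw [← h]
    simp [thMono]
  · rw [← ha] at ha2
    have h := hval a ha2
    rw [Fin.sum_univ_castSucc] at h
    simp only [thMono_castSucc] at h
    rw [ha] at h ⊢
    simp only [thP_self q hα] at h
    rw [← h, ← thP_antisymm hq hβ hα]
    simp [thMono]

theorem thI_two_term [DecidableEq ι] (hp : ‖p‖ < 1) (hp0 : p ≠ 0) (hq : ‖q‖ < 1) (hq0 : q ≠ 0)
    {n : ℕ} (hι : Fintype.card ι = 2 * n + 4) {t : ι → ℂ} (ht0 : ∀ r, t r ≠ 0)
    (ht1 : ∀ r, ‖t r‖ < 1) (ht : ∏ r, t r = q) {a b : ι} (hab : thP q (t a) (t b) ≠ 0)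
    (ha2 : ellTheta (t a ^ 2) q ≠ 0) (hb2 : ellTheta (t b ^ 2) q ≠ 0) :
    (∏ s ∈ Finset.univ.erase b, ellTheta (t b * t s) q) *
        thI p q n (Function.update t a (p * t a)) =
      (∏ s ∈ Finset.univ.erase a, ellTheta (t a * t s) q) *
        thI p q n (Function.update t b (p * t b)) := by
  obtain ⟨γ, δ, hγ, hδ, hγδ⟩ := exists_thP_ne_zero hp
  obtain ⟨r, hr, h0, hl⟩ := exists_coeff_thG hq hq0 hι ht0 ht (ht0 a) (ht0 b) hab
  have h0 := h0 b rfl hb2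
  have hl := hl a rfl ha2
  have hWc := continuousOn_thW hp hq ht0 ht1
  let K : Matrix (Fin (n + 1)) (Fin n) ℂ := .of fun j k =>
    cAvg fun z => thMono q (t a) (t b) (n + 1) j z * thMono p γ δ n k z * thW p q t z
  have hK : Matrix.vecMul r K = 0 := by
    funext k
    obtain ⟨d, rfl⟩ : ∃ d, n = d + 1 := ⟨n - 1, by have := k.2; omega⟩
    have hv := cAvg_thG_vanish hp hp0 hq ht0 ht1 hr
      (f := thMono p γ δ (d + 1) k) (d := d) (by simpa using isEvenTheta_thMono hp hp0 hγ hδ k)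
    rw [Pi.zero_apply, ← hv, Matrix.vecMul, dotProduct]
    simp only [Finset.sum_mul]
    rw [cAvg_sum]
    · refine Finset.sum_congr rfl fun j _ => ?_
      simp only [K, Matrix.of_apply]
      rw [← cAvg_const_mul]
      exact cAvg_congr fun z _ => by ring
    · intro j _
      exact ((continuousOn_const.mul (continuousOn_thMono hq hq0 (ht0 a) (ht0 b) j)).mul
        (continuousOn_thMono hp hp0 hγ hδ k)).mul hWc
  have hdet := mul_det_succ_eq_mul_det_castSucc K hK
  have hPc : ∀ c, c ≠ 0 → ContinuousOn (fun z => thP q c z * thW p q t z) (sphere 0 1) := fun c hc =>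
    (continuousOn_sphere_of_differentiableAt fun z hz => differentiableAt_thP hq hc hz).mul hWc
  have eA := thAvg_eq_det hp hp0 hq hq0 (ht0 a) (ht0 b) hγ hδ hab hγδ n (hPc _ (ht0 a))
  have eB := thAvg_eq_det hp hp0 hq hq0 (ht0 a) (ht0 b) hγ hδ hab hγδ n (hPc _ (ht0 b))
  have fA : (Matrix.of fun j k : Fin n => cAvg fun z => thMono q (t a) (t b) n j z *
      thMono p γ δ n k z * (thP q (t a) z * thW p q t z)) = K.submatrix Fin.castSucc id := by
    ext j k
    simp only [K, Matrix.of_apply, Matrix.submatrix_apply, id, thMono_castSucc]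
    exact cAvg_congr fun z _ => by ring
  have fB : (Matrix.of fun j k : Fin n => cAvg fun z => thMono q (t a) (t b) n j z *
      thMono p γ δ n k z * (thP q (t b) z * thW p q t z)) = K.submatrix Fin.succ id := by
    ext j k
    simp only [K, Matrix.of_apply, Matrix.submatrix_apply, id, thMono_succ]
    exact cAvg_congr fun z _ => by ring
  rw [thAvg_thP_mul_thW hp hp0 hq n (ht0 a) (ht1 a), fA] at eA
  rw [thAvg_thP_mul_thW hp hp0 hq n (ht0 b) (ht1 b), fB] at eB
  set X := thP q (t a) (t b)
  set C := X ^ (n.choose 2) * thP p γ δ ^ (n.choose 2)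
  have hC : C ≠ 0 := mul_ne_zero (pow_ne_zero _ hab) (pow_ne_zero _ hγδ)
  have hta := pow_ne_zero n (ht0 a)
  have htb := pow_ne_zero n (ht0 b)
  rw [inv_pow] at eA eB
  have hs : ((-1 : ℂ) ^ n) * (-1) ^ n = 1 := by rw [← mul_pow]; simp
  rw [neg_pow] at hl
  refine mul_left_cancel₀ (mul_ne_zero hC (mul_ne_zero (inv_ne_zero hta) (inv_ne_zero htb))) ?_
  linear_combination (-((t a ^ n)⁻¹ * C * thI p q n (Function.update t a (p * t a)))) * h0 +
    (t b ^ n)⁻¹ * C * thI p q n (Function.update t b (p * t b)) * hl +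
    r 0 * X ^ n * eA - r (Fin.last n) * ((-1) ^ n * X ^ n) * eB
    - (-1) ^ n * X ^ n * (n.factorial : ℂ) * hdet
    - X ^ n * (n.factorial : ℂ) * r 0 * (K.submatrix Fin.castSucc id).det * hs

end TwoTerm

section Recursion

variable {p q : ℂ}

theorem countable_thP_eq_zero (hp : ‖p‖ < 1) (hp0 : p ≠ 0) {a : ℂ} (ha : a ≠ 0) :
    {z : ℂ | z ≠ 0 ∧ thP p a z = 0}.Countable := by
  refine ((countable_range fun k : ℤ => p ^ k / a).union
    (countable_range fun k : ℤ => a / p ^ k)).mono ?_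
  rintro z ⟨hz, h⟩
  rcases mul_eq_zero.1 ((mul_eq_zero.1 h).resolve_left (inv_ne_zero ha)) with h | h
  · obtain ⟨k, hk⟩ := exists_zpow_of_ellTheta_eq_zero hp hp0 (mul_ne_zero ha hz) h
    exact Or.inl ⟨k, by simp only [← hk]; field_simp⟩
  · obtain ⟨k, hk⟩ := exists_zpow_of_ellTheta_eq_zero hp hp0 (div_ne_zero ha hz) h
    exact Or.inr ⟨k, by simp only [← hk]; field_simp⟩

theorem exists_thP_left_ne_zero (hp : ‖p‖ < 1) (hp0 : p ≠ 0) {a : ℂ} (ha : a ≠ 0) :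
    ∃ z, z ≠ 0 ∧ thP p a z ≠ 0 := by
  have h := (((countable_thP_eq_zero hp hp0 ha).union (countable_singleton 0)).dense_compl ℝ).nonempty
  obtain ⟨z, hz⟩ := h
  simp only [mem_compl_iff, mem_union, Set.mem_ofPred_eq, mem_singleton_iff, not_or, not_and] at hz
  exact ⟨z, hz.2, hz.1 hz.2⟩

theorem ellTheta_ne_zero_of_one_lt_norm (hp : ‖p‖ < 1) {x : ℂ} (h1 : 1 < ‖x‖)
    (h2 : ‖p‖ * ‖x‖ < 1) : ellTheta x p ≠ 0 := by
  have hx : x ≠ 0 := norm_pos_iff.1 (by linarith)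
  have h3 : ellTheta x⁻¹ p ≠ 0 := by
    refine ellTheta_ne_zero_of_norm hp ?_ ?_
    · rwa [norm_inv, ← one_mul ‖x‖⁻¹, lt_mul_inv_iff₀ (by linarith)]
    · rw [norm_inv]; exact inv_lt_one_of_one_lt₀ h1
  rw [ellTheta_inv hp hx] at h3
  exact right_ne_zero_of_mul h3

theorem ellGamma_nome_mul_mul_ellGamma_inv (hp : ‖p‖ < 1) (hp0 : p ≠ 0) (hq : ‖q‖ < 1) {x : ℂ}
    (h1 : 1 < ‖x‖) (h2 : ‖p‖ * ‖x‖ < 1) :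
    ellGamma (p * x) p q * ellGamma x⁻¹ p q = (ellTheta x⁻¹ p)⁻¹ := by
  have hx : x ≠ 0 := norm_pos_iff.1 (by linarith)
  have hp' := norm_pos_iff.2 hp0
  have n1 : qp2 p q (q * x⁻¹) ≠ 0 := qp2_ne_zero_of_norm_lt hp hq (by
    rw [norm_mul, norm_inv]
    have := inv_lt_one_of_one_lt₀ h1
    have := norm_nonneg q
    nlinarith)
  have n2 : qp2 p q (q * (p * x)) ≠ 0 := qp2_ne_zero_of_norm_lt hp hq (by
    rw [norm_mul, norm_mul]
    have := norm_nonneg q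
    nlinarith [mul_pos hp' (zero_lt_one.trans h1)])
  rw [ellGamma_eq hp hq, ellGamma_eq hp hq, ellTheta_eq hp,
    qp2_step' hp hq (p * x), qp2_step' hp hq x⁻¹, show p * q / (p * x) = q * x⁻¹ by field_simp,
    show p * q / x⁻¹ = q * (p * x) by field_simp, div_inv_eq_mul]
  generalize qp2 p q (q * x⁻¹) = A at *
  generalize qp2 p q (q * (p * x)) = B at *
  field_simp

theorem thW_cons_cons (hp : ‖p‖ < 1) (hp0 : p ≠ 0) (hq : ‖q‖ < 1) {N : ℕ} (t : Fin N → ℂ) {c : ℂ}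
    (h1 : 1 < ‖c‖) (h2 : ‖p‖ * ‖c‖ < 1) {z : ℂ} (hz : ‖z‖ = 1) :
    thW p q (Fin.cons (p * c) (Fin.cons c⁻¹ t) : Fin (N + 2) → ℂ) z = c / thP p c z * thW p q t z := by
  have hz0 := ne_zero_of_norm_one hz
  have hc : c ≠ 0 := norm_pos_iff.1 (by linarith)
  have e1 := ellGamma_nome_mul_mul_ellGamma_inv hp hp0 hq (x := c * z) (by rwa [norm_mul, hz, mul_one])
    (by rwa [norm_mul, hz, mul_one])
  have e2 := ellGamma_nome_mul_mul_ellGamma_inv hp hp0 hq (x := c / z) (by rwa [norm_div, hz, div_one])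
    (by rwa [norm_div, hz, div_one])
  have n1 := ellTheta_ne_zero_of_one_lt_norm hp (x := c * z) (by rwa [norm_mul, hz, mul_one])
    (by rwa [norm_mul, hz, mul_one])
  have n2 := ellTheta_ne_zero_of_one_lt_norm hp (x := c / z) (by rwa [norm_div, hz, div_one])
    (by rwa [norm_div, hz, div_one])
  rw [ellTheta_inv hp (mul_ne_zero hc hz0)] at e1
  rw [ellTheta_inv hp (div_ne_zero hc hz0)] at e2
  rw [thW, thW, Fin.prod_univ_succ, Fin.prod_univ_succ, thP]
  simp only [Fin.cons_zero, Fin.cons_succ]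
  rw [show p * c * z = p * (c * z) by ring, show p * c / z = p * (c / z) by ring,
    show c⁻¹ * z = (c / z)⁻¹ by field_simp, show c⁻¹ / z = (c * z)⁻¹ by field_simp]
  set P := ∏ r, (ellGamma (t r * z) p q * ellGamma (t r / z) p q)
  rw [show c / (c⁻¹ * (ellTheta (c * z) p * ellTheta (c / z) p)) =
    (-(c * z)⁻¹ * ellTheta (c * z) p)⁻¹ * (-(c / z)⁻¹ * ellTheta (c / z) p)⁻¹ by field_simp,
    ← e1, ← e2]
  ring

theorem cAvg_thH_div_thP (hp : ‖p‖ < 1) (hp0 : p ≠ 0) (hq : ‖q‖ < 1) {N : ℕ} {t : Fin N → ℂ}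
    (ht0 : ∀ r, t r ≠ 0) (ht1 : ∀ r, ‖t r‖ < 1) {c : ℂ} (hc1 : 1 < ‖c‖) (hc2 : ‖p‖ * ‖c‖ ^ 2 < 1)
    {d : ℕ} {f : ℂ → ℂ} (hf : IsEvenTheta p d f) :
    cAvg (thH p q (d + 1) t fun z => f z / thP p c z) =
      (c ^ (d + 1))⁻¹ * f c * (qPoch p ^ 2)⁻¹ *
        ∏ r, (ellGamma (p * c * t r) p q * ellGamma (c⁻¹ * t r) p q) := by
  have hc : c ≠ 0 := norm_pos_iff.1 (by linarith)
  have hp' := norm_pos_iff.2 hp0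
  obtain ⟨s, hs0, hs, hsn, hs1, hsp⟩ := exists_sqrt_nome hp hp0
  have hs' := norm_pos_iff.2 hs0
  have hcs : ‖s‖ * ‖c‖ < 1 := by
    rw [← hsn, ← mul_pow] at hc2
    exact (pow_lt_one_iff_of_nonneg (by positivity) two_ne_zero).1 hc2
  have hca : ‖c‖ < ‖s⁻¹‖ := by
    rwa [norm_inv, lt_inv_comm₀ (by linarith) hs', ← one_mul ‖c‖⁻¹, lt_mul_inv_iff₀ (by linarith)]
  let g : ℂ → ℂ := fun z => f z * c / (ellTheta (c * z) p * (qp1 p (p * c / z) * qp1 p (p * z / c)))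
  have hz0 : ∀ z : ℂ, 1 ≤ ‖z‖ → z ≠ 0 := fun z h => norm_pos_iff.1 (by linarith)
  have hsz : ∀ z : ℂ, ‖z‖ ≤ ‖s⁻¹‖ → ‖s‖ * ‖z‖ ≤ 1 := fun z h => by
    rw [norm_inv] at h
    calc ‖s‖ * ‖z‖ ≤ ‖s‖ * ‖s‖⁻¹ := by gcongr
      _ = 1 := mul_inv_cancel₀ hs'.ne'
  have n1 : ∀ z, 1 ≤ ‖z‖ → ‖z‖ ≤ ‖s⁻¹‖ → ellTheta (c * z) p ≠ 0 := fun z h1 h2 => by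
    refine ellTheta_ne_zero_of_one_lt_norm hp ?_ ?_
    · rw [norm_mul]; nlinarith
    · rw [norm_mul, ← hsn]
      nlinarith [hsz z h2, mul_pos hs' (zero_lt_one.trans_le h1)]
  have n2 : ∀ z, 1 ≤ ‖z‖ → qp1 p (p * c / z) ≠ 0 := fun z h1 => by
    refine qp1_ne_zero_of_norm_lt hp ?_
    rw [norm_div, div_lt_one (by linarith), norm_mul]
    nlinarith
  have n3 : ∀ z, 1 ≤ ‖z‖ → ‖z‖ ≤ ‖s⁻¹‖ → qp1 p (p * z / c) ≠ 0 := fun z h1 h2 => by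
    refine qp1_ne_zero_of_norm_lt hp ?_
    rw [norm_div, div_lt_one (by linarith), norm_mul]
    have h3 : ‖p‖ * ‖z‖ ≤ 1 := by
      have := hsz z h2
      rw [← hsn]
      have hs2 : ‖s‖ ≤ 1 := by nlinarith
      nlinarith
    linarith
  have hg : ∀ z, 1 ≤ ‖z‖ → ‖z‖ ≤ ‖s⁻¹‖ → DifferentiableAt ℂ g z := fun z h1 h2 => by
    have hz := hz0 z h1
    refine ((hf.diff z hz).mul_const c).div (DifferentiableAt.mul ?_ (DifferentiableAt.mul ?_ ?_))
      (mul_ne_zero (n1 z h1 h2) (mul_ne_zero (n2 z h1) (n3 z h1 h2)))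
    · exact (differentiableAt_ellTheta hp (mul_ne_zero hc hz)).comp z (by fun_prop)
    · exact (differentiable_qp1 hp _).comp z ((differentiableAt_const _).div differentiableAt_id hz)
    · exact (differentiable_qp1 hp _).comp z (by fun_prop)
  have key : ∀ z, z ≠ 0 → thH p q (d + 1) t (fun z => f z / thP p c z) z =
      thH p q (d + 1) t g z / (1 - c / z) := fun z hz => by
    have e : f z / thP p c z = g z / (1 - c / z) := by
      rw [thP, ellTheta_eq hp (c / z), qp1_step hp (c / z), show p / (c / z) = p * z / c by field_simp,
        show p * (c / z) = p * c / z by ring]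
      simp only [g, div_eq_mul_inv, mul_inv, inv_inv]
      ring
    rw [thH, thH, e]
    ring
  have hpole := cAvg_comp_mul_of_pole hc1 hca (h := thH p q (d + 1) t g) fun z h1 h2 =>
    differentiableAt_thH hp hp0 hq _ ht0 ht1 h1 (h2.trans hsp) (hg z h1 h2)
  rw [cAvg_congr (g := thH p q (d + 1) t fun z => f z / thP p c z) fun z hz =>
    (key z (ne_zero_of_norm_one hz)).symm] at hpole
  have hv : cAvg (fun z => thH p q (d + 1) t g (s⁻¹ * z) / (1 - c / (s⁻¹ * z))) = 0 := by
    rw [cAvg_congr (g := fun z => thH p q (d + 1) t (fun z => f z / thP p c z) (s⁻¹ * z)) fun z hz =>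
      (key _ (mul_ne_zero (inv_ne_zero hs0) (ne_zero_of_norm_one hz))).symm]
    refine cAvg_eq_zero_of_inv_nome_mul hs0 fun z hz => ?_
    rw [hs]
    refine thH_inv_nome_mul hp hp0 q d t hz ?_
    have hpz := mul_ne_zero hp0 (pow_ne_zero 2 hz)
    rw [hf.even _ (mul_ne_zero hp0 hz), thP_inv_right, hf.quasi z hz,
      thP_nome_mul_right hp hp0 hc hz]
    field_simp
  rw [hv] at hpole
  have hcc : ellTheta (c ^ 2) p ≠ 0 := sq c ▸ n1 c hc1.le hca.le
  have hP := qPoch_ne_zero hp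
  have hgc : thH p q (d + 1) t g c = -((c ^ (d + 1))⁻¹ * f c * (qPoch p ^ 2)⁻¹ *
        ∏ r, (ellGamma (p * c * t r) p q * ellGamma (c⁻¹ * t r) p q)) := by
    have e : ∀ r, ellGamma (p * t r * c) p q * ellGamma (t r / c) p q =
        ellGamma (p * c * t r) p q * ellGamma (c⁻¹ * t r) p q := fun r => by
      rw [mul_right_comm, div_eq_inv_mul]
    simp only [thH, g, e, mul_div_cancel_right₀ p hc, ← qPoch_eq, ← sq c]
    field_simp
    ring
  rw [hgc] at hpole
  linear_combination -hpole

theorem thI_recursion (hp : ‖p‖ < 1) (hp0 : p ≠ 0) (hq : ‖q‖ < 1) (hq0 : q ≠ 0) {n N : ℕ}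
    (hN : N = 2 * n + 4) {t : Fin N → ℂ} (ht0 : ∀ r, t r ≠ 0) (ht1 : ∀ r, ‖t r‖ < 1)
    (ht : ∏ r, t r = q) {c : ℂ} (hc1 : 1 < ‖c‖) (hc2 : ‖p‖ * ‖c‖ ^ 2 < 1) {a : Fin N}
    (ha2 : ellTheta (t a ^ 2) q ≠ 0) :
    (∏ s ∈ Finset.univ.erase a, ellTheta (t a * t s) q) *
        thI p q (n + 1) (Fin.cons (p * c) (Fin.cons c⁻¹ t) : Fin (N + 2) → ℂ) =
      2 * (n + 1) * (qPoch p ^ 2)⁻¹ *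
        (∏ r, (ellGamma (p * c * t r) p q * ellGamma (c⁻¹ * t r) p q)) *
        thI p q n (Function.update t a (p * t a)) := by
  have hc : c ≠ 0 := norm_pos_iff.1 (by linarith)
  have hc3 : ‖p‖ * ‖c‖ < 1 := by nlinarith [norm_nonneg p, mul_nonneg (norm_nonneg p) (norm_nonneg c)]
  obtain ⟨β, hβ, hαβ⟩ := exists_thP_left_ne_zero hq hq0 (ht0 a)
  obtain ⟨δ, hδ, hγδ⟩ := exists_thP_left_ne_zero hp hp0 hc
  obtain ⟨r, hr, -, hl⟩ := exists_coeff_thG hq hq0 (by simpa using hN) ht0 ht (ht0 a) hβ hαβ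
  have hl := hl a rfl ha2
  have hWc := continuousOn_thW hp hq ht0 ht1
  have hPc : ∀ z ∈ sphere (0 : ℂ) 1, thP p c z ≠ 0 := fun z hz => by
    rw [mem_sphere_zero_iff_norm] at hz
    refine thP_ne_zero hc (ellTheta_ne_zero_of_one_lt_norm hp ?_ ?_)
      (ellTheta_ne_zero_of_one_lt_norm hp ?_ ?_) <;> simpa [hz]
  have hPd : ∀ b, b ≠ 0 → ContinuousOn (thP p b) (sphere 0 1) := fun b hb =>
    continuousOn_sphere_of_differentiableAt fun z hz => differentiableAt_thP hp hb hz
  set W : ℂ → ℂ := fun z => c / thP p c z * thW p q t z with hW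
  have hWW : ContinuousOn W (sphere 0 1) := (continuousOn_const.div (hPd c hc) hPc).mul hWc
  let M : Matrix (Fin (n + 1)) (Fin (n + 1)) ℂ := .of fun j k =>
    cAvg fun z => thMono q (t a) β (n + 1) j z * thMono p c δ (n + 1) k z * W z
  set φ : ℂ → ℂ := fun z => ∑ k, r k * thMono q (t a) β (n + 1) k z
  have hsum : ∀ k, Matrix.vecMul r M k = cAvg fun z => φ z * thMono p c δ (n + 1) k z * W z := by
    intro k
    simp only [Matrix.vecMul, dotProduct, φ, Finset.sum_mul]
    rw [cAvg_sum]
    · refine Finset.sum_congr rfl fun j _ => ?_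
      simp only [M, Matrix.of_apply]
      rw [← cAvg_const_mul]
      exact cAvg_congr fun z _ => by ring
    · intro j _
      exact ((continuousOn_const.mul (continuousOn_thMono hq hq0 (ht0 a) hβ j)).mul
        (continuousOn_thMono hp hp0 hc hδ k)).mul hWW
  have hM0 : ∀ k : Fin n, Matrix.vecMul r M k.castSucc = 0 := by
    intro k
    obtain ⟨d, rfl⟩ : ∃ d, n = d + 1 := ⟨n - 1, by have := k.2; omega⟩
    have hv := cAvg_thG_vanish hp hp0 hq ht0 ht1 hr
      (f := thMono p c δ (d + 1) k) (d := d) (by simpa using isEvenTheta_thMono hp hp0 hc hδ k)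
    rw [hsum, ← mul_zero c, ← hv, ← cAvg_const_mul]
    refine cAvg_congr fun z hz => ?_
    have := hPc z (mem_sphere_zero_iff_norm.2 hz)
    simp only [hW, thMono_castSucc, φ]
    field_simp
  set Y := thP p c δ
  set X := thP q (t a) β
  set Q := ∏ r, (ellGamma (p * c * t r) p q * ellGamma (c⁻¹ * t r) p q)
  have hM1 : Matrix.vecMul r M (Fin.last n) = 2 * (c ^ n)⁻¹ * (-Y) ^ n * (qPoch p ^ 2)⁻¹ * Q := by
    have hf := (isEvenTheta_thP hp hp0 hδ).pow n
    rw [mul_one] at hf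
    have h1 := cAvg_thH_div_thP hp hp0 hq ht0 ht1 hc1 hc2 hf
    have hHc : ContinuousOn (thH p q (n + 1) t fun z => thP p δ z ^ n / thP p c z) (sphere 0 1) := by
      intro z hz
      have hz' := mem_sphere_zero_iff_norm.1 hz
      have hz0 := ne_zero_of_norm_one hz'
      exact (differentiableAt_thH hp hp0 hq _ ht0 ht1 hz'.ge
        (hz'.le.trans ((one_le_inv₀ (norm_pos_iff.2 hp0)).2 hp.le))
        ((hf.diff z hz0).div (differentiableAt_thP hp hc hz0) (hPc z hz))).continuousAt.continuousWithinAt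
    have h2 := cAvg_add_inv hHc
    rw [h1, thP_antisymm hp hδ hc] at h2
    rw [hsum]
    have h3 : cAvg (fun z => φ z * thMono p c δ (n + 1) (Fin.last n) z * W z) = c * cAvg (fun z =>
        thH p q (n + 1) t (fun z => thP p δ z ^ n / thP p c z) z +
        thH p q (n + 1) t (fun z => thP p δ z ^ n / thP p c z) z⁻¹) := by
      rw [← cAvg_const_mul]
      refine cAvg_congr fun z hz => ?_
      have hz0 := ne_zero_of_norm_one hz
      rw [← mul_thW_eq_thH_add hp hp0 hq ht0 ht1 hz (φ := φ) (hr z hz0)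
        (by rw [thP_inv_right, thP_inv_right])]
      simp only [hW, thMono, Fin.val_last, Fin.rev_last, Fin.val_zero, pow_zero, mul_one, φ]
      ring
    change _ = 2 * ((c ^ (n + 1))⁻¹ * (-Y) ^ n * (qPoch p ^ 2)⁻¹ * Q) at h2
    rw [h3, h2, pow_succ]
    field_simp
  have hminor : r (Fin.last n) * M.det = 2 * (c ^ n)⁻¹ * (-Y) ^ n * (qPoch p ^ 2)⁻¹ * Q *
      (M.submatrix Fin.castSucc Fin.castSucc).det := by
    have h1 : Matrix.vecMul (Matrix.vecMul r M) M.adjugate (Fin.last n) = r (Fin.last n) * M.det := by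
      rw [Matrix.vecMul_vecMul, Matrix.mul_adjugate, Matrix.vecMul_smul, Matrix.vecMul_one]
      simp [mul_comm]
    rw [← h1, Matrix.vecMul, dotProduct, Fin.sum_univ_castSucc]
    simp only [hM0, zero_mul, Finset.sum_const_zero, zero_add, hM1]
    rw [Matrix.adjugate_fin_succ_eq_det_submatrix, Fin.succAbove_last]
    simp
  have e1 := thAvg_eq_det hp hp0 hq hq0 (ht0 a) hβ hc hδ hαβ hγδ (n + 1) hWW
  have e2 := thAvg_eq_det hp hp0 hq hq0 (ht0 a) hβ hc hδ hαβ hγδ n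
    (W := fun z => c * (thP q (t a) z * thW p q t z)) (continuousOn_const.mul
      ((continuousOn_sphere_of_differentiableAt fun z hz => differentiableAt_thP hq (ht0 a) hz).mul hWc))
  have f1 : thAvg p q (n + 1) W =
      thI p q (n + 1) (Fin.cons (p * c) (Fin.cons c⁻¹ t) : Fin (N + 2) → ℂ) :=
    thAvg_congr fun z hz => (thW_cons_cons hp hp0 hq t hc1 hc3 hz).symm
  have f2 : (Matrix.of fun j k : Fin n => cAvg fun z => thMono q (t a) β n j z *
      thMono p c δ n k z * (c * (thP q (t a) z * thW p q t z))) =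
      M.submatrix Fin.castSucc Fin.castSucc := by
    ext j k
    simp only [M, Matrix.of_apply, Matrix.submatrix_apply, thMono_castSucc]
    refine cAvg_congr fun z hz => ?_
    have := hPc z (mem_sphere_zero_iff_norm.2 hz)
    simp only [hW]
    field_simp
  rw [f1] at e1
  rw [f2, thAvg_const_mul, thAvg_thP_mul_thW hp hp0 hq n (ht0 a) (ht1 a)] at e2
  have hch : (n + 1).choose 2 = n.choose 2 + n := by
    rw [Nat.choose_succ_succ' n 1, Nat.choose_one_right, add_comm]
  rw [hch, Nat.factorial_succ, pow_add, pow_add] at e1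
  push_cast at e1
  set D := (M.submatrix Fin.castSucc Fin.castSucc).det
  set I1 := thI p q (n + 1) (Fin.cons (p * c) (Fin.cons c⁻¹ t) : Fin (N + 2) → ℂ)
  set I0 := thI p q n (Function.update t a (p * t a))
  set Θ := ∏ s ∈ Finset.univ.erase a, ellTheta (t a * t s) q
  change _ = _ * M.det at e1
  have hX := pow_ne_zero (n.choose 2) hαβ
  have hY := pow_ne_zero (n.choose 2) hγδ
  have hXn := pow_ne_zero n hαβ
  have hYn := pow_ne_zero n hγδ
  have hta := pow_ne_zero n (ht0 a)
  have hcn := pow_ne_zero n hc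
  rw [neg_pow] at hl hminor
  rw [inv_pow] at e2
  have hs : ((-1 : ℂ) ^ n) * (-1) ^ n = 1 := by rw [← mul_pow]; simp
  have hcc := inv_mul_cancel₀ hcn
  refine mul_left_cancel₀ (mul_ne_zero (mul_ne_zero (mul_ne_zero hX hY) (mul_ne_zero hXn hYn))
    (inv_ne_zero hta)) ?_
  linear_combination (-(X ^ n.choose 2 * Y ^ n.choose 2 * X ^ n * Y ^ n * I1)) * hl +
    r (Fin.last n) * (-1) ^ n * X ^ n * e1 + (-1) ^ n * X ^ n * (n + 1) * n.factorial * hminor -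
    X ^ n * Y ^ n * (n + 1) * 2 * (c ^ n)⁻¹ * (qPoch p ^ 2)⁻¹ * Q * e2 +
    X ^ n * Y ^ n * (n + 1) * n.factorial * 2 * (c ^ n)⁻¹ * (qPoch p ^ 2)⁻¹ * Q * D * hs +
    X ^ n.choose 2 * Y ^ n.choose 2 * X ^ n * Y ^ n * (t a ^ n)⁻¹ * 2 * (n + 1) * (qPoch p ^ 2)⁻¹ *
      Q * I0 * hcc

end Recursion

section Parameter

theorem differentiableOn_cAvg {f : ℂ → ℂ → ℂ} {U : Set ℂ} (hU : IsOpen U)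
    (hc : ContinuousOn (Function.uncurry f) (U ×ˢ sphere 0 1))
    (hd : ∀ z, ‖z‖ = 1 → DifferentiableOn ℂ (fun w => f w z) U) :
    DifferentiableOn ℂ (fun w => cAvg (f w)) U := by
  intro w₀ hw₀
  obtain ⟨ε, hε, hball⟩ := Metric.isOpen_iff.1 hU w₀ hw₀
  set r := ε / 4 with hr
  have hr0 : 0 < r := by positivity
  have hsub : closedBall w₀ (2 * r) ⊆ U := (closedBall_subset_ball (by linarith)).trans hball
  have hsub' : ∀ w ∈ ball w₀ r, closedBall w r ⊆ closedBall w₀ (2 * r) := fun w hw =>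
    closedBall_subset_closedBall' (by rw [mem_ball] at hw; linarith)
  obtain ⟨B, hB⟩ := ((isCompact_closedBall w₀ (2 * r)).prod
    (isCompact_sphere (0 : ℂ) 1)).exists_bound_of_continuousOn (hc.mono (prod_mono_left hsub))
  set e : ℝ → ℂ := fun t => Complex.exp (Complex.I * t) with he
  have hen : ∀ t, ‖e t‖ = 1 := fun t => by simp [he, Complex.norm_exp]
  have hec : Continuous e := by fun_prop
  have hcont : ∀ w ∈ U, Continuous fun t => f w (e t) := fun w hw =>
    continuousOn_univ.1 <| hc.comp (f := fun t => (w, e t)) (by fun_prop) fun t _ =>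
      ⟨hw, mem_sphere_zero_iff_norm.2 (hen t)⟩
  have hder : ∀ w ∈ ball w₀ r, ∀ t, HasDerivAt (fun w => f w (e t)) (deriv (fun w => f w (e t)) w) w :=
    fun w hw t => ((hd _ (hen t)).differentiableAt (hU.mem_nhds
      (hsub (hsub' w hw (mem_closedBall_self hr0.le))))).hasDerivAt
  have hbound : ∀ t, ∀ w ∈ ball w₀ r, ‖deriv (fun w => f w (e t)) w‖ ≤ B / r := by
    intro t w hw
    refine Complex.norm_deriv_le_of_forall_mem_sphere_norm_le hr0 ?_ fun z hz => ?_
    · refine ((hd _ (hen t)).mono ((hsub' w hw).trans hsub)).diffContOnCl_ball subset_rfl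
    · exact hB (z, e t) ⟨hsub' w hw (sphere_subset_closedBall hz),
        mem_sphere_zero_iff_norm.2 (hen t)⟩
  have hmeas : AEStronglyMeasurable (fun t => deriv (fun w => f w (e t)) w₀)
      (volume.restrict (Icc (0 : ℝ) (2 * Real.pi))) := by
    obtain ⟨x, -, hx0, hx⟩ : ∃ x : ℕ → ℝ, True ∧ (∀ n, 0 < x n) ∧ Tendsto x atTop (𝓝 0) :=
      ⟨fun n => 1 / ((n : ℝ) + 1), trivial, fun n => by positivity, tendsto_one_div_add_atTop_nhds_zero_nat⟩
    have hx' : Tendsto (fun n => w₀ + (x n : ℂ)) atTop (𝓝[≠] w₀) := by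
      refine tendsto_nhdsWithin_iff.2 ⟨?_, Eventually.of_forall fun n => ?_⟩
      · simpa using (tendsto_const_nhds (x := w₀)).add
          ((Complex.continuous_ofReal.tendsto 0).comp hx)
      · simpa using (hx0 n).ne'
    have hxU : ∀ᶠ n in atTop, w₀ + (x n : ℂ) ∈ U :=
      (hx'.mono_right nhdsWithin_le_nhds).eventually (hU.mem_nhds hw₀)
    obtain ⟨N, hN⟩ := eventually_atTop.1 hxU
    refine aestronglyMeasurable_of_tendsto_ae (u := atTop)
      (f := fun n t => slope (fun w => f w (e t)) w₀ (w₀ + (x (n + N) : ℂ))) (fun n => ?_)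
      (Eventually.of_forall fun t => ?_)
    · simp only [slope_def_field]
      exact (((hcont _ (hN _ (by omega))).sub (hcont _ hw₀)).div_const _).aestronglyMeasurable
    · exact (hasDerivAt_iff_tendsto_slope.1 (hder w₀ (mem_ball_self hr0) t)).comp
        (hx'.comp (tendsto_add_atTop_nat N))
  have h := hasDerivAt_integral_of_dominated_loc_of_deriv_le
    (μ := volume.restrict (Icc (0 : ℝ) (2 * Real.pi))) (F := fun w t => f w (e t))
    (F' := fun w t => deriv (fun w => f w (e t)) w) (bound := fun _ => B / r)
    (ball_mem_nhds w₀ hr0) ?_ ?_ hmeas (Eventually.of_forall hbound) ?_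
    (Eventually.of_forall fun t w hw => hder w hw t)
  · have := h.2.differentiableAt.const_mul ((1 / (2 * Real.pi) : ℝ) : ℂ)
    simp only [cAvg_eq_setIntegral]
    exact this.differentiableWithinAt
  · filter_upwards [hU.mem_nhds hw₀] with w hw
    exact (hcont w hw).aestronglyMeasurable
  · exact (hcont w₀ hw₀).continuousOn.integrableOn_Icc
  · exact integrable_const _

variable {p q : ℂ} {ι : Type*} [Fintype ι]

theorem continuousOn_thW_param (hp : ‖p‖ < 1) (hq : ‖q‖ < 1) {u : ℂ → ι → ℂ} {U : Set ℂ}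
    (hu : ∀ r, ContinuousOn (fun w => u w r) U) (h0 : ∀ w ∈ U, ∀ r, u w r ≠ 0)
    (h1 : ∀ w ∈ U, ∀ r, ‖u w r‖ < 1) :
    ContinuousOn (Function.uncurry fun w z => thW p q (u w) z) (U ×ˢ sphere 0 1) := by
  have hz0 : ∀ x ∈ U ×ˢ sphere (0 : ℂ) 1, x.2 ≠ 0 := fun x hx =>
    ne_zero_of_norm_one (mem_sphere_zero_iff_norm.1 hx.2)
  have hG : ∀ x : ℂ, x ≠ 0 → ‖x‖ < 1 → ContinuousAt (fun x => ellGamma x p q) x := fun x h h' =>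
    (differentiableAt_ellGamma hp hq h h').continuousAt
  have hT : ∀ a, ‖a‖ < 1 → ∀ x : ℂ, x ≠ 0 → ContinuousAt (fun x => ellTheta x a) x := fun a ha x h =>
    (differentiableAt_ellTheta ha h).continuousAt
  have hu' : ∀ r, ContinuousOn (fun x : ℂ × ℂ => u x.1 r) (U ×ˢ sphere 0 1) := fun r =>
    (hu r).comp continuousOn_fst fun x hx => hx.1
  simp only [Function.uncurry_def, thW]
  refine ContinuousOn.mul (ContinuousOn.mul ?_ ?_) (continuousOn_finsetProd _ fun r _ => ?_)
  · exact fun x hx => ContinuousAt.comp_continuousWithinAt (f := fun x : ℂ × ℂ => x.2 ^ 2)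
      (hT p hp _ (pow_ne_zero 2 (hz0 x hx))) (by fun_prop)
  · exact fun x hx => ContinuousAt.comp_continuousWithinAt (f := fun x : ℂ × ℂ => x.2⁻¹ ^ 2)
      (hT q hq _ (pow_ne_zero 2 (inv_ne_zero (hz0 x hx))))
      ((continuousAt_snd.inv₀ (hz0 x hx)).pow 2).continuousWithinAt
  · refine ContinuousOn.mul (fun x hx => ?_) fun x hx => ?_
    · refine ContinuousAt.comp_continuousWithinAt (f := fun x : ℂ × ℂ => u x.1 r * x.2)
        (hG _ (mul_ne_zero (h0 _ hx.1 r) (hz0 x hx)) ?_) ((hu' r x hx).mul continuousWithinAt_snd)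
      rw [norm_mul, mem_sphere_zero_iff_norm.1 hx.2, mul_one]
      exact h1 _ hx.1 r
    · refine ContinuousAt.comp_continuousWithinAt (f := fun x : ℂ × ℂ => u x.1 r / x.2)
        (hG _ (div_ne_zero (h0 _ hx.1 r) (hz0 x hx)) ?_)
        ((hu' r x hx).div continuousWithinAt_snd (hz0 x hx))
      rw [norm_div, mem_sphere_zero_iff_norm.1 hx.2, div_one]
      exact h1 _ hx.1 r

theorem differentiableOn_thW_param (hp : ‖p‖ < 1) (hq : ‖q‖ < 1) {u : ℂ → ι → ℂ} {U : Set ℂ}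
    (hu : ∀ r, DifferentiableOn ℂ (fun w => u w r) U) (h0 : ∀ w ∈ U, ∀ r, u w r ≠ 0)
    (h1 : ∀ w ∈ U, ∀ r, ‖u w r‖ < 1) {z : ℂ} (hz : ‖z‖ = 1) :
    DifferentiableOn ℂ (fun w => thW p q (u w) z) U := by
  have hz0 := ne_zero_of_norm_one hz
  refine DifferentiableOn.const_mul (DifferentiableOn.fun_finsetProd fun r _ => ?_) _
  intro w hw
  refine DifferentiableWithinAt.mul ?_ ?_
  · refine (differentiableAt_ellGamma hp hq (mul_ne_zero (h0 w hw r) hz0)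
      ?_).comp_differentiableWithinAt w ((hu r w hw).mul_const z)
    rw [norm_mul, hz, mul_one]
    exact h1 w hw r
  · refine (differentiableAt_ellGamma hp hq (div_ne_zero (h0 w hw r) hz0)
      ?_).comp_differentiableWithinAt w ((hu r w hw).div_const z)
    rw [norm_div, hz, div_one]
    exact h1 w hw r

theorem differentiableOn_thAvg (hp : ‖p‖ < 1) (hp0 : p ≠ 0) (hq : ‖q‖ < 1) (hq0 : q ≠ 0) (n : ℕ)
    {W : ℂ → ℂ → ℂ} {U : Set ℂ} (hU : IsOpen U)
    (hc : ContinuousOn (Function.uncurry W) (U ×ˢ sphere 0 1))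
    (hd : ∀ z, ‖z‖ = 1 → DifferentiableOn ℂ (fun w => W w z) U) :
    DifferentiableOn ℂ (fun w => thAvg p q n (W w)) U := by
  obtain ⟨α, β, hα, hβ, hαβ⟩ := exists_thP_ne_zero hq
  obtain ⟨γ, δ, hγ, hδ, hγδ⟩ := exists_thP_ne_zero hp
  set C := thP q α β ^ n.choose 2 * thP p γ δ ^ n.choose 2
  have hC : C ≠ 0 := mul_ne_zero (pow_ne_zero _ hαβ) (pow_ne_zero _ hγδ)
  have e : ∀ w ∈ U, thAvg p q n (W w) = C⁻¹ * ((n.factorial : ℂ) * (Matrix.of fun j k : Fin n =>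
      cAvg fun z => thMono q α β n j z * thMono p γ δ n k z * W w z).det) := fun w hw => by
    rw [eq_inv_mul_iff_mul_eq₀ hC]
    exact thAvg_eq_det hp hp0 hq hq0 hα hβ hγ hδ hαβ hγδ n
      (hc.comp (f := fun z => (w, z)) (by fun_prop) fun z hz => ⟨hw, hz⟩)
  refine DifferentiableOn.congr ?_ e
  refine ((DifferentiableOn.const_mul ?_ _).const_mul _)
  simp only [Matrix.det_apply]
  refine DifferentiableOn.fun_sum fun σ _ => DifferentiableOn.const_smul
    (DifferentiableOn.fun_finsetProd fun i _ => ?_) _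
  simp only [Matrix.of_apply]
  refine differentiableOn_cAvg hU ?_ fun z hz => (hd z hz).const_mul _
  simp only [Function.uncurry_def]
  refine ContinuousOn.mul (ContinuousOn.mul ?_ ?_) hc
  · exact (continuousOn_thMono hq hq0 hα hβ _).comp continuousOn_snd fun x hx => hx.2
  · exact (continuousOn_thMono hp hp0 hγ hδ _).comp continuousOn_snd fun x hx => hx.2

theorem differentiableOn_thI (hp : ‖p‖ < 1) (hp0 : p ≠ 0) (hq : ‖q‖ < 1) (hq0 : q ≠ 0) (n : ℕ)
    {u : ℂ → ι → ℂ} {U : Set ℂ} (hU : IsOpen U) (hu : ∀ r, DifferentiableOn ℂ (fun w => u w r) U)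
    (h0 : ∀ w ∈ U, ∀ r, u w r ≠ 0) (h1 : ∀ w ∈ U, ∀ r, ‖u w r‖ < 1) :
    DifferentiableOn ℂ (fun w => thI p q n (u w)) U :=
  differentiableOn_thAvg hp hp0 hq hq0 n hU
    (continuousOn_thW_param hp hq (fun r => (hu r).continuousOn) h0 h1)
    fun _ hz => differentiableOn_thW_param hp hq hu h0 h1 hz

end Parameter

section GammaProduct

variable {p q : ℂ}

/-- The product of elliptic Gamma functions over pairs of parameters. -/
noncomputable def thR (p q : ℂ) {N : ℕ} (u : Fin N → ℂ) : ℂ :=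
  ∏ i, ∏ j ∈ Finset.Ioi i, ellGamma (u i * u j) p q

theorem norm_prod_lt_norm_mul {N : ℕ} (hN : 3 ≤ N) {u : Fin N → ℂ} (h0 : ∀ r, u r ≠ 0)
    (h1 : ∀ r, ‖u r‖ < 1) {i j : Fin N} (hij : i ≠ j) : ‖∏ r, u r‖ < ‖u i * u j‖ := by
  rw [← Finset.mul_prod_erase _ _ (Finset.mem_univ i),
    ← Finset.mul_prod_erase (Finset.univ.erase i) _ (Finset.mem_erase.2 ⟨hij.symm, Finset.mem_univ j⟩),
    ← mul_assoc, norm_mul, norm_prod]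
  refine mul_lt_of_lt_one_right (norm_pos_iff.2 (mul_ne_zero (h0 i) (h0 j))) ?_
  have hne : ((Finset.univ.erase i).erase j).Nonempty := by
    rw [← Finset.card_pos, Finset.card_erase_of_mem (Finset.mem_erase.2 ⟨hij.symm, Finset.mem_univ j⟩),
      Finset.card_erase_of_mem (Finset.mem_univ i), Finset.card_univ, Fintype.card_fin]
    omega
  calc _ < ∏ r ∈ (Finset.univ.erase i).erase j, (1 : ℝ) :=
        Finset.prod_lt_prod_of_nonempty (fun r _ => norm_pos_iff.2 (h0 r)) (fun r _ => h1 r) hne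
    _ = 1 := Finset.prod_const_one

theorem norm_mul_lt_one {x y : ℂ} (hx : ‖x‖ < 1) (hy : ‖y‖ < 1) : ‖x * y‖ < 1 := by
  rw [norm_mul]
  exact mul_lt_one_of_nonneg_of_lt_one_left (norm_nonneg x) hx hy.le

theorem thR_ne_zero (hp : ‖p‖ < 1) (hp0 : p ≠ 0) (hq : ‖q‖ < 1) (hq0 : q ≠ 0) {N : ℕ} (hN : 3 ≤ N)
    {u : Fin N → ℂ} (h0 : ∀ r, u r ≠ 0) (h1 : ∀ r, ‖u r‖ < 1) (hu : ‖p * q‖ ≤ ‖∏ r, u r‖) :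
    thR p q u ≠ 0 :=
  Finset.prod_ne_zero_iff.2 fun i _ => Finset.prod_ne_zero_iff.2 fun j hj =>
    ellGamma_ne_zero hp hp0 hq hq0 (norm_mul_lt_one (h1 i) (h1 j))
      (hu.trans_lt (norm_prod_lt_norm_mul hN h0 h1 (Finset.mem_Ioi.1 hj).ne))

theorem prod_Ioi_mul_symm {N : ℕ} (a : Fin N) (g : Fin N → ℂ) :
    ∏ i, ∏ j ∈ Finset.Ioi i, ((if i = a then g j else 1) * if j = a then g i else 1) =
      ∏ s ∈ Finset.univ.erase a, g s := by
  simp only [Finset.prod_mul_distrib, Finset.prod_ite_irrel, Finset.prod_const_one,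
    Finset.prod_ite_eq', Finset.mem_univ, if_true, Finset.mem_Ioi]
  rw [← Finset.prod_filter, ← Finset.prod_union]
  · refine Finset.prod_congr ?_ fun _ _ => rfl
    ext s
    simp [lt_or_lt_iff_ne, eq_comm]
  · rw [Finset.disjoint_left]
    intro s hs
    simp only [Finset.mem_Ioi, Finset.mem_filter] at hs ⊢
    exact fun h => absurd (hs.trans h.2) (lt_irrefl _)

theorem thR_update (hp : ‖p‖ < 1) (hp0 : p ≠ 0) (hq : ‖q‖ < 1) {N : ℕ} {u : Fin N → ℂ}
    (h0 : ∀ r, u r ≠ 0) (h1 : ∀ r, ‖u r‖ < 1) (a : Fin N) :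
    thR p q (Function.update u a (p * u a)) =
      (∏ s ∈ Finset.univ.erase a, ellTheta (u a * u s) q) * thR p q u := by
  rw [← prod_Ioi_mul_symm, thR, thR, ← Finset.prod_mul_distrib]
  refine Finset.prod_congr rfl fun i _ => ?_
  rw [← Finset.prod_mul_distrib]
  refine Finset.prod_congr rfl fun j hj => ?_
  have hij := (Finset.mem_Ioi.1 hj).ne
  have key : ∀ s, ellGamma (p * u a * u s) p q = ellTheta (u a * u s) q * ellGamma (u a * u s) p q :=
    fun s => by
      rw [mul_assoc, ellGamma_nome_mul_of_norm hp hp0 hq (mul_ne_zero (h0 a) (h0 s))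
        (norm_mul_lt_one (h1 a) (h1 s))]
  by_cases hi : i = a
  · subst hi
    rw [Function.update_self, Function.update_of_ne hij.symm, if_pos rfl, if_neg hij.symm, key, mul_one]
  · rw [Function.update_of_ne hi, if_neg hi, one_mul]
    by_cases hja : j = a
    · subst hja
      rw [Function.update_self, if_pos rfl, mul_comm (u i), key, mul_comm (u i)]
    · rw [Function.update_of_ne hja, if_neg hja, one_mul]

theorem thR_cons {N : ℕ} (x : ℂ) (t : Fin N → ℂ) :
    thR p q (Fin.cons x t : Fin (N + 1) → ℂ) = (∏ r, ellGamma (x * t r) p q) * thR p q t := by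
  rw [thR, Fin.prod_univ_succ, Fin.prod_Ioi_zero]
  simp [Fin.prod_Ioi_succ, thR]

theorem differentiableOn_thR (hp : ‖p‖ < 1) (hq : ‖q‖ < 1) {N : ℕ}
    {u : ℂ → Fin N → ℂ} {U : Set ℂ} (hu : ∀ r, DifferentiableOn ℂ (fun w => u w r) U)
    (h0 : ∀ w ∈ U, ∀ r, u w r ≠ 0) (h1 : ∀ w ∈ U, ∀ r, ‖u w r‖ < 1) :
    DifferentiableOn ℂ (fun w => thR p q (u w)) U := by
  refine DifferentiableOn.fun_finsetProd fun i _ => DifferentiableOn.fun_finsetProd fun j _ => ?_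
  intro w hw
  exact (differentiableAt_ellGamma hp hq (mul_ne_zero (h0 w hw i) (h0 w hw j))
    (norm_mul_lt_one (h1 w hw i) (h1 w hw j))).comp_differentiableWithinAt w
    ((hu i w hw).mul (hu j w hw))

/-- The normalizing constant. -/
noncomputable def thC (p q : ℂ) (n : ℕ) : ℂ := 2 ^ n * n.factorial / (qPoch p * qPoch q) ^ n

theorem thR_four (hp : ‖p‖ < 1) (hp0 : p ≠ 0) (hq : ‖q‖ < 1) (hq0 : q ≠ 0)
    {u : Fin 4 → ℂ} (h0 : ∀ r, u r ≠ 0) (h1 : ∀ r, ‖u r‖ < 1) (hu : ∏ r, u r = p * q) :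
    thR p q u = 1 := by
  have key : ∀ i j k l, i ≠ j → u i * u j * (u k * u l) = p * q →
      ellGamma (u i * u j) p q * ellGamma (u k * u l) p q = 1 := by
    intro i j k l hij h
    have hr := ellGamma_reflection hp hp0 hq hq0 (norm_mul_lt_one (h1 i) (h1 j))
      (by rw [← hu]; exact norm_prod_lt_norm_mul (by norm_num) h0 h1 hij)
    rwa [← h, mul_div_cancel_left₀ _ (mul_ne_zero (h0 i) (h0 j))] at hr
  rw [Fin.prod_univ_four] at hu
  have k1 := key 0 1 2 3 (by decide) (by rw [← hu]; ring)
  have k2 := key 0 2 1 3 (by decide) (by rw [← hu]; ring)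
  have k3 := key 0 3 1 2 (by decide) (by rw [← hu]; ring)
  have e0 : Finset.Ioi (0 : Fin 4) = {1, 2, 3} := by decide
  have e1 : Finset.Ioi (1 : Fin 4) = {2, 3} := by decide
  have e2 : Finset.Ioi (2 : Fin 4) = {3} := by decide
  have e3 : Finset.Ioi (3 : Fin 4) = ∅ := by decide
  rw [thR, Fin.prod_univ_four, e0, e1, e2, e3]
  simp only [Finset.prod_insert, Finset.mem_insert, Finset.mem_singleton, Finset.prod_singleton,
    Finset.prod_empty, mul_one, Fin.reduceEq, or_self, not_false_eq_true]
  linear_combination ellGamma (u 0 * u 2) p q * ellGamma (u 1 * u 3) p q * ellGamma (u 0 * u 3) p q *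
    ellGamma (u 1 * u 2) p q * k1 + ellGamma (u 0 * u 3) p q * ellGamma (u 1 * u 2) p q * k2 + k3

end GammaProduct

section Evaluation

variable {p q : ℂ}

theorem eventually_ellTheta_ne_zero (hq : ‖q‖ < 1) {x c : ℂ} (hx : x ≠ 0) (hc : c ≠ 0) :
    ∀ᶠ w in 𝓝[≠] (0 : ℂ), ellTheta (x * Complex.exp (c * w)) q ≠ 0 := by
  have hd : Differentiable ℂ fun w => ellTheta (x * Complex.exp (c * w)) q := fun w =>
    DifferentiableAt.comp w (g := fun y => ellTheta y q)
      (differentiableAt_ellTheta hq (mul_ne_zero hx (Complex.exp_ne_zero _)))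
      (((differentiableAt_id.const_mul c).cexp).const_mul x)
  have ha : AnalyticOnNhd ℂ (fun w => ellTheta (x * Complex.exp (c * w)) q) univ :=
    hd.differentiableOn.analyticOnNhd isOpen_univ
  refine ((ha 0 (mem_univ _)).eventually_eq_zero_or_eventually_ne_zero).resolve_left fun h => ?_
  have hz := ha.eqOn_zero_of_preconnected_of_eventuallyEq_zero isPreconnected_univ (mem_univ _) h
  obtain ⟨r, hr1, hr2⟩ := exists_between hq
  have hr0 : (r : ℂ) ≠ 0 := by
    exact_mod_cast ((norm_nonneg q).trans_lt hr1).ne'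
  have hrn : ‖(r : ℂ)‖ = r := by
    rw [Complex.norm_real, Real.norm_of_nonneg ((norm_nonneg q).trans hr1.le)]
  have h1 := hz (mem_univ (c⁻¹ * Complex.log (x⁻¹ * r)))
  simp only [Pi.zero_apply] at h1
  rw [mul_inv_cancel_left₀ hc, Complex.exp_log (mul_ne_zero (inv_ne_zero hx) hr0),
    mul_inv_cancel_left₀ hx] at h1
  exact ellTheta_ne_zero_of_norm hq (by rwa [hrn]) (by rwa [hrn]) h1

theorem thI_update_mul_thR_update (hp : ‖p‖ < 1) (hp0 : p ≠ 0) (hq : ‖q‖ < 1) (hq0 : q ≠ 0)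
    {n N : ℕ} (hN : N = 2 * n + 4) {t : Fin N → ℂ} (ht0 : ∀ r, t r ≠ 0)
    (ht1 : ∀ r, ‖t r‖ < 1) (ht : ∏ r, t r = q) {a b : Fin N} (hab : a ≠ b) :
    thI p q n (Function.update t a (p * t a)) * thR p q (Function.update t b (p * t b)) =
      thI p q n (Function.update t b (p * t b)) * thR p q (Function.update t a (p * t a)) := by
  set T : ℂ → Fin N → ℂ := fun w r => t r * Complex.exp ((Pi.single a 1 - Pi.single b 1 : Fin N → ℂ) r * w)
    with hT
  have hTd : ∀ r, Differentiable ℂ fun w => T w r := fun r =>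
    ((differentiable_id.const_mul _).cexp).const_mul _
  have hT0 : ∀ w r, T w r ≠ 0 := fun w r => mul_ne_zero (ht0 r) (Complex.exp_ne_zero _)
  have hTz : T 0 = t := by funext r; simp [hT]
  have hTp : ∀ w, ∏ r, T w r = q := fun w => by
    simp only [hT]
    rw [Finset.prod_mul_distrib, ht, ← Complex.exp_sum, ← Finset.sum_mul]
    simp
  set U : Set ℂ := {w | ∀ r, ‖T w r‖ < 1} with hU
  have hUo : IsOpen U := by
    have : U = ⋂ r, {w | ‖T w r‖ < 1} := by ext; simp [hU]
    rw [this]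
    exact isOpen_iInter_of_finite fun r => isOpen_lt (hTd r).continuous.norm continuous_const
  have h0U : (0 : ℂ) ∈ U := fun r => by rw [hTz]; exact ht1 r
  have hud : ∀ c r, Differentiable ℂ fun w => Function.update (T w) c (p * T w c) r := fun c r => by
    by_cases h : r = c
    · subst h; simpa using (hTd r).const_mul p
    · simpa [Function.update_of_ne h] using hTd r
  have hu0 : ∀ c, ∀ w ∈ U, ∀ r, Function.update (T w) c (p * T w c) r ≠ 0 := fun c w _ r => by
    by_cases h : r = c
    · subst h; simpa using ⟨hp0, hT0 w r⟩
    · simpa [Function.update_of_ne h] using hT0 w r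
  have hu1 : ∀ c, ∀ w ∈ U, ∀ r, ‖Function.update (T w) c (p * T w c) r‖ < 1 := fun c w hw r => by
    by_cases h : r = c
    · subst h; rw [Function.update_self]; exact norm_mul_lt_one hp (hw r)
    · simpa [Function.update_of_ne h] using hw r
  have hI : ∀ c, ContinuousAt (fun w => thI p q n (Function.update (T w) c (p * T w c))) 0 := fun c =>
    (differentiableOn_thI hp hp0 hq hq0 n hUo (fun r => (hud c r).differentiableOn)
      (hu0 c) (hu1 c)).continuousOn.continuousAt (hUo.mem_nhds h0U)
  have hR : ∀ c, ContinuousAt (fun w => thR p q (Function.update (T w) c (p * T w c))) 0 := fun c =>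
    (differentiableOn_thR hp hq (fun r => (hud c r).differentiableOn)
      (hu0 c) (hu1 c)).continuousOn.continuousAt (hUo.mem_nhds h0U)
  have e1 := (((hI a).mul (hR b)).tendsto).mono_left (nhdsWithin_le_nhds (s := {0}ᶜ))
  have e2 := (((hI b).mul (hR a)).tendsto).mono_left (nhdsWithin_le_nhds (s := {0}ᶜ))
  rw [Pi.mul_apply, hTz] at e1 e2
  refine tendsto_nhds_unique_of_eventuallyEq e1 e2 ?_
  have hTa : ∀ w, T w a = t a * Complex.exp w := fun w => by simp [hT, hab]
  have hTb : ∀ w, T w b = t b * Complex.exp (-w) := fun w => by simp [hT, hab.symm]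
  filter_upwards [eventually_ellTheta_ne_zero hq (pow_ne_zero 2 (ht0 a)) (two_ne_zero (α := ℂ)),
    eventually_ellTheta_ne_zero hq (pow_ne_zero 2 (ht0 b)) (neg_ne_zero.2 (two_ne_zero (α := ℂ))),
    eventually_ellTheta_ne_zero hq (div_ne_zero (ht0 a) (ht0 b)) (two_ne_zero (α := ℂ)),
    nhdsWithin_le_nhds (hUo.mem_nhds h0U)] with w w1 w2 w3 hw
  have w1' : ellTheta (T w a ^ 2) q ≠ 0 := by
    rw [hTa, mul_pow, ← Complex.exp_nat_mul]; exact_mod_cast w1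
  have w2' : ellTheta (T w b ^ 2) q ≠ 0 := by
    rw [hTb, mul_pow, ← Complex.exp_nat_mul]
    convert w2 using 4
    push_cast; ring
  have w3' : ellTheta (T w a / T w b) q ≠ 0 := by
    rw [hTa, hTb, mul_div_mul_comm, ← Complex.exp_sub]
    convert w3 using 4
    ring
  have w4 : ellTheta (T w a * T w b) q ≠ 0 :=
    ellTheta_ne_zero_of_norm hq
      (by rw [← hTp w]; exact norm_prod_lt_norm_mul (by omega) (hT0 w) hw hab)
      (norm_mul_lt_one (hw a) (hw b))
  have h2 := thI_two_term hp hp0 hq hq0 (by simpa using hN) (hT0 w) hw (hTp w)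
    (thP_ne_zero (hT0 w a) w4 w3') w1' w2'
  rw [Pi.mul_apply, Pi.mul_apply, thR_update hp hp0 hq (hT0 w) hw, thR_update hp hp0 hq (hT0 w) hw]
  linear_combination thR p q (T w) * h2

end Evaluation

section Special

variable {p q : ℂ}

theorem thC_succ (n : ℕ) : thC p q (n + 1) = 2 * (n + 1) * thC p q n / (qPoch p * qPoch q) := by
  rw [thC, thC, Nat.factorial_succ]
  push_cast
  rw [pow_succ, pow_succ]
  ring

theorem thI_eq_of_mul_eq_nome (hp : ‖p‖ < 1) (hp0 : p ≠ 0) (hq : ‖q‖ < 1) (hq0 : q ≠ 0) {n N : ℕ}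
    (hN : N = 2 * n + 4)
    (ih : ∀ t : Fin N → ℂ, (∀ r, t r ≠ 0) → (∀ r, ‖t r‖ < 1) → ∏ r, t r = p * q →
      thI p q n t = thC p q n * thR p q t)
    {x y : ℂ} {t : Fin N → ℂ} (hy1 : ‖y‖ < 1) (ht0 : ∀ r, t r ≠ 0)
    (ht1 : ∀ r, ‖t r‖ < 1) (ht : ∏ r, t r = q) (hxy : x * y = p) (hy : ‖p‖ < ‖y‖ ^ 2) {a : Fin N}
    (ha : ‖q‖ < ‖t a‖ ^ 2) :
    thI p q (n + 1) (Fin.cons x (Fin.cons y t) : Fin (N + 2) → ℂ) =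
      thC p q (n + 1) * thR p q (Fin.cons x (Fin.cons y t) : Fin (N + 2) → ℂ) := by
  have hy0 : y ≠ 0 := fun h => hp0 (by rw [← hxy, h, mul_zero])
  have hyn : 0 < ‖y‖ := norm_pos_iff.2 hy0
  have hx : x = p * y⁻¹ := by rw [← hxy, mul_inv_cancel_right₀ hy0]
  have hP : ∏ s ∈ Finset.univ.erase a, ellTheta (t a * t s) q ≠ 0 :=
    Finset.prod_ne_zero_iff.2 fun s hs => ellTheta_ne_zero_of_norm hq
      (by rw [← ht]; exact norm_prod_lt_norm_mul (by omega) ht0 ht1 (Finset.ne_of_mem_erase hs).symm)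
      (norm_mul_lt_one (ht1 a) (ht1 s))
  have hrec := thI_recursion hp hp0 hq hq0 hN ht0 ht1 ht (c := y⁻¹)
    (by rw [norm_inv]; exact one_lt_inv_iff₀.2 ⟨hyn, hy1⟩)
    (by rw [norm_inv, inv_pow, ← div_eq_mul_inv, div_lt_one (pow_pos hyn 2)]; exact hy)
    (ellTheta_ne_zero_of_norm hq (by rwa [norm_pow])
      (by rw [norm_pow]; exact pow_lt_one₀ (norm_nonneg _) (ht1 a) two_ne_zero))
  rw [ih (Function.update t a (p * t a)), thR_update hp hp0 hq ht0 ht1, ← hx, inv_inv] at hrec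
  · rw [thR_cons, thR_cons, Fin.prod_univ_succ, Fin.cons_zero, hxy, ellGamma_nome hp hp0 hq]
    simp only [Fin.cons_succ]
    refine mul_left_cancel₀ hP ?_
    rw [hrec, thC_succ, Finset.prod_mul_distrib]
    have h1 := qPoch_ne_zero hp
    have h2 := qPoch_ne_zero hq
    field_simp
  · intro r
    by_cases h : r = a
    · subst h; simpa using ⟨hp0, ht0 r⟩
    · simpa [Function.update_of_ne h] using ht0 r
  · intro r
    by_cases h : r = a
    · subst h; rw [Function.update_self]; exact norm_mul_lt_one hp (ht1 r)
    · simpa [Function.update_of_ne h] using ht1 r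
  · rw [Finset.prod_update_of_mem (Finset.mem_univ a), mul_assoc, ← Finset.erase_eq,
      Finset.mul_prod_erase _ _ (Finset.mem_univ a), ht]

theorem eq_of_nome_periodic (hp : ‖p‖ < 1) (hp0 : p ≠ 0) {g : ℂ → ℂ} {a b : ℝ} (ha : 0 < a)
    (hg : DifferentiableOn ℂ g {s | a < ‖s‖ ∧ ‖s‖ < b})
    (hgp : ∀ s, a < ‖p * s‖ → ‖s‖ < b → g (p * s) = g s) (hab : a < ‖p‖ * b) {s s' : ℂ}
    (h1 : a < ‖s‖) (h2 : ‖s‖ < b) (h3 : a < ‖s'‖) (h4 : ‖s'‖ < b) : g s = g s' := by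
  have hpn : 0 < ‖p‖ := norm_pos_iff.2 hp0
  obtain ⟨m, hm1, hm2⟩ := exists_between ((div_lt_iff₀' hpn).2 hab)
  rw [div_lt_iff₀' hpn] at hm1
  have hm0 : 0 < m := pos_of_mul_pos_right (ha.trans hm1) hpn.le
  set A : Set ℂ := {s | a < ‖s‖ ∧ ‖s‖ < b} with hA
  have hAo : IsOpen A :=
    (isOpen_lt continuous_const continuous_norm).inter (isOpen_lt continuous_norm continuous_const)
  set K : Set ℂ := closedBall 0 m \ ball 0 (‖p‖ * m) with hK
  have hKm : ∀ z, z ∈ K ↔ ‖z‖ ≤ m ∧ ‖p‖ * m ≤ ‖z‖ := fun z => by simp [hK]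
  have hKA : K ⊆ A := fun z hz => ⟨hm1.trans_le ((hKm z).1 hz).2, ((hKm z).1 hz).1.trans_lt hm2⟩
  have hpm : ‖p‖ * m < m := mul_lt_of_lt_one_left hm0 hp
  obtain ⟨c, hc, hmax⟩ := ((isCompact_closedBall (0 : ℂ) m).diff isOpen_ball).exists_isMaxOn
    (f := fun z => ‖g z‖) ⟨(m : ℂ), (hKm _).2 (by
      rw [Complex.norm_real, Real.norm_of_nonneg hm0.le]; exact ⟨le_rfl, hpm.le⟩)⟩
    (hg.continuousOn.norm.mono hKA)
  have hc' := (hKm c).1 hc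
  have hloc : IsLocalMax (norm ∘ g) c := by
    have n1 : ∀ᶠ z in 𝓝 c, ‖z‖ < b := (continuous_norm.tendsto c).eventually_lt_const (hKA hc).2
    have n2 : ∀ᶠ z in 𝓝 c, a < ‖z‖ := (continuous_norm.tendsto c).eventually_const_lt (hKA hc).1
    have n3 : ∀ᶠ z in 𝓝 c, ‖p‖ * ‖z‖ < m :=
      ((continuous_norm.tendsto c).const_mul ‖p‖).eventually_lt_const
        ((mul_le_mul_of_nonneg_left hc'.1 hpn.le).trans_lt hpm)
    have n4 : ∀ᶠ z in 𝓝 c, ‖p‖ * (‖p‖ * m) < ‖z‖ := (continuous_norm.tendsto c).eventually_const_lt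
      ((mul_lt_of_lt_one_left (mul_pos hpn hm0) hp).trans_le hc'.2)
    filter_upwards [n1, n2, n3, n4] with z z1 z2 z3 z4
    by_cases k1 : ‖z‖ ≤ m
    · by_cases k2 : ‖p‖ * m ≤ ‖z‖
      · exact hmax ((hKm z).2 ⟨k1, k2⟩)
      · push Not at k2
        have e : g z = g (p⁻¹ * z) := by
          have := hgp (p⁻¹ * z) (by rwa [mul_inv_cancel_left₀ hp0]) (by
            rw [norm_mul, norm_inv, inv_mul_lt_iff₀ hpn]
            exact k2.trans (mul_lt_mul_of_pos_left hm2 hpn))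
          rwa [mul_inv_cancel_left₀ hp0] at this
        simp only [Function.comp, e]
        refine hmax ((hKm _).2 ?_)
        rw [norm_mul, norm_inv, inv_mul_le_iff₀ hpn, le_inv_mul_iff₀ hpn]
        exact ⟨k2.le, z4.le⟩
    · push Not at k1
      have e : g z = g (p * z) := by
        refine (hgp z ?_ z1).symm
        rw [norm_mul]
        exact hm1.trans (mul_lt_mul_of_pos_left k1 hpn)
      simp only [Function.comp, e]
      refine hmax ((hKm _).2 ?_)
      rw [norm_mul]
      exact ⟨z3.le, mul_le_mul_of_nonneg_left k1.le hpn.le⟩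
  have hev := Complex.eventually_eq_of_isLocalMax_norm
    (by filter_upwards [hAo.mem_nhds (hKA hc)] with z hz using hg.differentiableAt (hAo.mem_nhds hz)) hloc
  have h0 : ∀ z ∈ A, z ≠ 0 := fun z hz h => by
    have := hz.1; rw [h, norm_zero] at this; linarith
  set S : Set ℂ := Complex.reCLM ⁻¹' Ioo (Real.log a) (Real.log b) with hS
  have hb0 : 0 < b := hm0.trans hm2
  have hSA : ∀ w ∈ S, Complex.exp w ∈ A := fun w hw => by
    have h := mem_preimage.1 hw
    rw [Complex.reCLM_apply] at h
    refine ⟨?_, ?_⟩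
    · rw [Complex.norm_exp]; exact (Real.log_lt_iff_lt_exp ha).1 h.1
    · rw [Complex.norm_exp]; exact (Real.lt_log_iff_exp_lt hb0).1 h.2
  have hAS : ∀ z ∈ A, Complex.log z ∈ S := fun z hz => by
    rw [hS, mem_preimage, Complex.reCLM_apply, Complex.log_re]
    have hz0 := norm_pos_iff.2 (h0 z hz)
    exact ⟨Real.log_lt_log ha hz.1, Real.log_lt_log hz0 hz.2⟩
  have hSo : IsOpen S := isOpen_Ioo.preimage Complex.reCLM.continuous
  have hSc : IsPreconnected S :=
    ((convex_Ioo _ _).linear_preimage Complex.reCLM.toLinearMap).isPreconnected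
  have hd : DifferentiableOn ℂ (fun w => g (Complex.exp w)) S :=
    hg.comp Complex.differentiable_exp.differentiableOn hSA
  have hlog : Complex.exp (Complex.log c) = c := Complex.exp_log (h0 c (hKA hc))
  have heq := (hd.analyticOnNhd hSo).eqOn_of_preconnected_of_eventuallyEq
    (g := fun _ => g c) analyticOnNhd_const hSc (hAS c (hKA hc)) (by
      have ht : Tendsto Complex.exp (𝓝 (Complex.log c)) (𝓝 c) := by
        conv => rhs; rw [← hlog]
        exact Complex.continuous_exp.tendsto _
      exact ht.eventually hev)
  have fin : ∀ z ∈ A, g z = g c := fun z hz => by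
    have := heq (hAS z hz)
    simpa only [Complex.exp_log (h0 z hz)] using this
  rw [fin s ⟨h1, h2⟩, fin s' ⟨h3, h4⟩]

end Special

section Region

variable {p q : ℂ}

theorem thI_eq_of_region (hp : ‖p‖ < 1) (hp0 : p ≠ 0) (hq : ‖q‖ < 1) (hq0 : q ≠ 0) {n N : ℕ}
    (hN : N = 2 * n + 4)
    (ih : ∀ t : Fin N → ℂ, (∀ r, t r ≠ 0) → (∀ r, ‖t r‖ < 1) → ∏ r, t r = p * q →
      thI p q n t = thC p q n * thR p q t)
    {x y : ℂ} {t : Fin N → ℂ} (hx0 : x ≠ 0) (hx1 : ‖x‖ < 1) (hy1 : ‖y‖ < 1) (ht0 : ∀ r, t r ≠ 0)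
    (ht1 : ∀ r, ‖t r‖ < 1) (ht : x * (y * ∏ r, t r) = p * q) {e a : Fin N} (hea : a ≠ e)
    (he : ‖x * t e‖ < ‖p‖) (hy : ‖p‖ < ‖y‖ ^ 2) (ha : ‖q‖ < ‖t a‖ ^ 2) :
    thI p q (n + 1) (Fin.cons x (Fin.cons y t) : Fin (N + 2) → ℂ) =
      thC p q (n + 1) * thR p q (Fin.cons x (Fin.cons y t) : Fin (N + 2) → ℂ) := by
  have hpn : 0 < ‖p‖ := norm_pos_iff.2 hp0
  have hxn : 0 < ‖x‖ := norm_pos_iff.2 hx0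
  have hen : 0 < ‖t e‖ := norm_pos_iff.2 (ht0 e)
  have hy0 : y ≠ 0 := fun h => by rw [h, norm_zero] at hy; norm_num at hy; linarith [norm_nonneg p]
  have hyn : 0 < ‖y‖ := norm_pos_iff.2 hy0
  set v : ℂ → Fin (N + 2) → ℂ := fun s =>
    Fin.cons (x * s) (Fin.cons y (Function.update t e (t e / s))) with hv
  have h0 : ∀ s, s ≠ 0 → ∀ r, v s r ≠ 0 := fun s hs r => by
    refine Fin.cases (mul_ne_zero hx0 hs) (fun r => Fin.cases hy0 (fun r => ?_) r) r
    simp only [hv, Fin.cons_succ]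
    by_cases h : r = e
    · subst h; rw [Function.update_self]; exact div_ne_zero (ht0 r) hs
    · rw [Function.update_of_ne h]; exact ht0 r
  have h1 : ∀ s, ‖t e‖ < ‖s‖ → ‖s‖ < ‖x‖⁻¹ → ∀ r, ‖v s r‖ < 1 := fun s hs1 hs2 r => by
    refine Fin.cases ?_ (fun r => Fin.cases hy1 (fun r => ?_) r) r
    · simp only [hv, Fin.cons_zero]
      rwa [norm_mul, ← lt_inv_mul_iff₀ hxn, mul_one]
    simp only [hv, Fin.cons_succ]
    by_cases h : r = e
    · subst h; rwa [Function.update_self, norm_div, div_lt_one (hen.trans hs1)]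
    · rw [Function.update_of_ne h]; exact ht1 r
  have hprod : ∀ s, s ≠ 0 → ∏ r, v s r = p * q := fun s hs => by
    simp only [hv]
    rw [Fin.prod_univ_succ, Fin.prod_univ_succ]
    simp only [Fin.cons_zero, Fin.cons_succ]
    rw [Finset.prod_update_of_mem (Finset.mem_univ e), ← Finset.erase_eq, ← ht,
      ← Finset.mul_prod_erase Finset.univ t (Finset.mem_univ e)]
    field_simp
  have hne : ∀ s : ℂ, ‖t e‖ < ‖s‖ → s ≠ 0 := fun s hs => norm_pos_iff.1 (hen.trans hs)
  have hRne : ∀ s, ‖t e‖ < ‖s‖ → ‖s‖ < ‖x‖⁻¹ → thR p q (v s) ≠ 0 := fun s hs1 hs2 =>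
    thR_ne_zero hp hp0 hq hq0 (by omega) (h0 s (hne s hs1)) (h1 s hs1 hs2)
      (by rw [hprod s (hne s hs1)])
  set A : Set ℂ := {s | ‖t e‖ < ‖s‖ ∧ ‖s‖ < ‖x‖⁻¹} with hA
  have hAo : IsOpen A :=
    (isOpen_lt continuous_const continuous_norm).inter (isOpen_lt continuous_norm continuous_const)
  have hvd : ∀ r, DifferentiableOn ℂ (fun s => v s r) A := fun r => by
    intro s hs
    refine DifferentiableAt.differentiableWithinAt ?_
    refine Fin.cases (differentiableAt_id.const_mul x)
      (fun r => Fin.cases (differentiableAt_const y) (fun r => ?_) r) r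
    simp only [hv, Fin.cons_succ]
    by_cases h : r = e
    · subst h
      simp only [Function.update_self]
      exact (differentiableAt_const _).div differentiableAt_id (hne s hs.1)
    · simp only [Function.update_of_ne h]; exact differentiableAt_const _
  have hd : DifferentiableOn ℂ (fun s => thI p q (n + 1) (v s) / thR p q (v s)) A :=
    (differentiableOn_thI hp hp0 hq hq0 (n + 1) hAo hvd (fun s hs => h0 s (hne s hs.1))
      (fun s hs => h1 s hs.1 hs.2)).fun_div
    (differentiableOn_thR hp hq hvd (fun s hs => h0 s (hne s hs.1)) (fun s hs => h1 s hs.1 hs.2))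
    (fun s hs => hRne s hs.1 hs.2)
  have hs2 : ‖p / (x * y)‖ < ‖x‖⁻¹ := by
    rw [norm_div, norm_mul, div_lt_iff₀ (mul_pos hxn hyn), inv_mul_cancel_left₀ hxn.ne']
    nlinarith
  have hs1 : ‖t e‖ < ‖p / (x * y)‖ := by
    rw [norm_div, norm_mul, lt_div_iff₀ (mul_pos hxn hyn)]
    rw [norm_mul] at he
    have := mul_lt_of_lt_one_right (mul_pos hxn hen) hy1
    linarith
  have hone : ‖(1 : ℂ)‖ < ‖x‖⁻¹ := by rw [norm_one]; exact one_lt_inv_iff₀.2 ⟨hxn, hx1⟩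
  have hone' : ‖t e‖ < ‖(1 : ℂ)‖ := by rw [norm_one]; exact ht1 e
  have hs0 : p / (x * y) ≠ 0 := hne _ hs1
  have key := eq_of_nome_periodic hp hp0 hen hd ?_ ?_ hone' hone hs1 hs2
  · have hv1 : v 1 = Fin.cons x (Fin.cons y t) := by simp [hv]
    have hspec : thI p q (n + 1) (v (p / (x * y))) =
        thC p q (n + 1) * thR p q (v (p / (x * y))) := by
      refine thI_eq_of_mul_eq_nome hp hp0 hq hq0 hN ih hy1
        (fun r => h0 _ hs0 r.succ.succ) (fun r => h1 _ hs1 hs2 r.succ.succ) ?_ (by field_simp) hy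
        (a := a) (by rwa [Function.update_of_ne hea])
      have h := hprod _ hs0
      simp only [hv] at h
      rw [Fin.prod_univ_succ, Fin.prod_univ_succ] at h
      simp only [Fin.cons_zero, Fin.cons_succ] at h
      refine mul_left_cancel₀ hp0 (Eq.trans ?_ h)
      field_simp
    rw [hspec, mul_div_cancel_right₀ _ (hRne _ hs1 hs2), div_eq_iff (hRne _ hone' hone), hv1] at key
    exact key
  · intro s g1 g2
    have hps0 := hne _ g1
    have hs0' : s ≠ 0 := right_ne_zero_of_mul hps0
    have g3 : ‖t e‖ < ‖s‖ := g1.trans_le (by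
      rw [norm_mul]; exact mul_le_of_le_one_left (norm_nonneg s) hp.le)
    have g4 : ‖p * s‖ < ‖x‖⁻¹ := lt_of_le_of_lt (by
      rw [norm_mul]; exact mul_le_of_le_one_left (norm_nonneg s) hp.le) g2
    set T : Fin (N + 2) → ℂ := Fin.cons (x * s) (Fin.cons y (Function.update t e (t e / (p * s))))
      with hT
    have e1 : Function.update T 0 (p * T 0) = v (p * s) := by
      simp only [hT, hv, Fin.cons_zero, Fin.update_cons_zero]
      rw [mul_left_comm]
    have e2 : Function.update T e.succ.succ (p * T e.succ.succ) = v s := by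
      simp only [hT, hv, Fin.cons_succ, ← Fin.cons_update, Function.update_self, Function.update_idem]
      have e5 : p * (t e / (p * s)) = t e / s := by field_simp
      rw [e5]
    have T0 : ∀ r, T r ≠ 0 := fun r => by
      refine Fin.cases (mul_ne_zero hx0 hs0') (fun r => ?_) r
      exact h0 _ hps0 r.succ
    have T1 : ∀ r, ‖T r‖ < 1 := fun r => by
      refine Fin.cases (h1 s g3 g2 0) (fun r => ?_) r
      exact h1 _ g1 g4 r.succ
    have Tp : ∏ r, T r = q := by
      have h := hprod _ hps0
      rw [Fin.prod_univ_succ] at h ⊢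
      have e3 : v (p * s) 0 = p * T 0 := by simp only [hT, hv, Fin.cons_zero]; ring
      have e4 : ∀ i : Fin (N + 1), v (p * s) i.succ = T i.succ := fun i => rfl
      simp only [e3, e4] at h
      refine mul_left_cancel₀ hp0 (Eq.trans ?_ h)
      ring
    have h2 := thI_update_mul_thR_update hp hp0 hq hq0 (n := n + 1) (by omega) T0 T1 Tp
      (a := 0) (b := e.succ.succ) (Fin.succ_ne_zero _).symm
    rw [e1, e2] at h2
    rw [div_eq_div_iff (hRne _ g1 g4) (hRne _ g3 g2)]
    exact h2
  · rw [← div_eq_mul_inv, lt_div_iff₀ hxn, mul_comm, ← norm_mul]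
    exact he

end Region

section Selberg

variable {p q : ℂ}

theorem thI_succ_eq (hp : ‖p‖ < 1) (hp0 : p ≠ 0) (hq : ‖q‖ < 1) (hq0 : q ≠ 0) {n N : ℕ}
    (hN : N = 2 * n + 4)
    (ih : ∀ t : Fin N → ℂ, (∀ r, t r ≠ 0) → (∀ r, ‖t r‖ < 1) → ∏ r, t r = p * q →
      thI p q n t = thC p q n * thR p q t)
    {u : Fin (N + 2) → ℂ} (hu0 : ∀ r, u r ≠ 0) (hu1 : ∀ r, ‖u r‖ < 1) (hu : ∏ r, u r = p * q) :
    thI p q (n + 1) u = thC p q (n + 1) * thR p q u := by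
  have hpn : 0 < ‖p‖ := norm_pos_iff.2 hp0
  have hqn : 0 < ‖q‖ := norm_pos_iff.2 hq0
  set P := -Real.log ‖p‖ with hP
  set Q := -Real.log ‖q‖ with hQ
  have hP0 : 0 < P := neg_pos.2 (Real.log_neg hpn hp)
  have hQ0 : 0 < Q := neg_pos.2 (Real.log_neg hqn hq)
  have hPe : ‖p‖ = Real.exp (-P) := by rw [hP, neg_neg, Real.exp_log hpn]
  have hQe : ‖q‖ = Real.exp (-Q) := by rw [hQ, neg_neg, Real.exp_log hqn]
  obtain ⟨η, hη0, hη1, hη2⟩ : ∃ η : ℝ, 0 < η ∧ (N + 3) * η ≤ P ∧ (N + 3) * η ≤ Q := by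
    refine ⟨min P Q / (N + 3), by positivity, ?_, ?_⟩ <;>
      rw [mul_div_cancel₀ _ (by positivity)]
    exacts [min_le_left _ _, min_le_right _ _]
  have hNη : 0 ≤ (N : ℝ) * η := by positivity
  set A := (P + Q - N * η) / 2 with hA
  have hA0 : 0 < A := by rw [hA]; linarith
  set β : Fin (N + 2) → ℂ := fun r => Complex.log (u r) with hβ
  have hβe : ∀ r, Complex.exp (β r) = u r := fun r => Complex.exp_log (hu0 r)
  have hβr : ∀ r, (β r).re < 0 := fun r => by
    rw [hβ, Complex.log_re]; exact Real.log_neg (norm_pos_iff.2 (hu0 r)) (hu1 r)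
  set e : Fin N := ⟨0, by omega⟩ with he
  set a : Fin N := ⟨1, by omega⟩ with ha
  have hae : a ≠ e := by simp [he, ha]
  set α : Fin (N + 2) → ℂ := Fin.cons (-A + (∑ r, β r).im * Complex.I)
    (Fin.cons (-η : ℂ) (Function.update (fun _ => (-η : ℂ)) e (-A : ℂ))) with hα
  have hα0 : (α 0).re = -A := by simp only [hα, Fin.cons_zero]; simp
  have hα1 : (α 1).re = -η := by
    rw [hα, ← Fin.succ_zero_eq_one, Fin.cons_succ, Fin.cons_zero]; simp
  have hαe : (α e.succ.succ).re = -A := by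
    simp only [hα, Fin.cons_succ, Function.update_self]; simp
  have hαs : ∀ r, r ≠ e → (α r.succ.succ).re = -η := fun r h => by
    simp only [hα, Fin.cons_succ, Function.update_of_ne h]; simp
  have hαr : ∀ r, (α r).re < 0 := fun r => by
    refine Fin.cases ?_ (fun r => Fin.cases ?_ (fun r => ?_) r) r
    · rw [hα0]; linarith
    · rw [Fin.succ_zero_eq_one, hα1]; linarith
    · by_cases h : r = e
      · rw [h, hαe]; linarith
      · rw [hαs r h]; linarith
  have hsum : ∑ r, α r = ∑ r, β r := by
    have h1 : (∑ r, β r).re = -(P + Q) := by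
      have h2 : ‖∏ r, u r‖ = Real.exp (∑ r, β r).re := by
        rw [← Complex.norm_exp, Complex.exp_sum]
        simp only [hβe]
      rw [hu, norm_mul, hPe, hQe, ← Real.exp_add] at h2
      rw [← Real.exp_injective h2]; ring
    have h3 : ∑ r, α r = (-(P + Q) : ℝ) + (∑ r, β r).im * Complex.I := by
      rw [Fin.sum_univ_succ, Fin.sum_univ_succ]
      simp only [hα, Fin.cons_zero, Fin.cons_succ]
      rw [Finset.sum_update_of_mem (Finset.mem_univ e), ← Finset.erase_eq, Finset.sum_const,
        Finset.card_erase_of_mem (Finset.mem_univ e), Finset.card_univ, Fintype.card_fin, nsmul_eq_mul,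
        Nat.cast_sub (by omega)]
      rw [hA]
      push_cast
      ring
    rw [h3, ← h1, Complex.re_add_im]
  set V : ℂ → Fin (N + 2) → ℂ := fun w r => Complex.exp (α r + w * (β r - α r)) with hV
  have hV0 : ∀ w r, V w r ≠ 0 := fun w r => Complex.exp_ne_zero _
  have hVd : ∀ r, Differentiable ℂ fun w => V w r := fun r =>
    ((differentiable_id.mul_const _).const_add _).cexp
  have hVp : ∀ w, ∏ r, V w r = p * q := fun w => by
    simp only [hV]
    rw [← Complex.exp_sum, Finset.sum_add_distrib, ← Finset.mul_sum, Finset.sum_sub_distrib, hsum,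
      sub_self, mul_zero, add_zero, Complex.exp_sum]
    simp only [hβe, hu]
  set U : Set ℂ := ⋂ r, {w | ‖V w r‖ < 1} with hU
  have hUo : IsOpen U :=
    isOpen_iInter_of_finite fun r => isOpen_lt (hVd r).continuous.norm continuous_const
  have hU1 : ∀ w ∈ U, ∀ r, ‖V w r‖ < 1 := fun w hw r => mem_iInter.1 hw r
  have hUc : Convex ℝ U := by
    refine convex_iInter fun r => ?_
    have h4 : {w | ‖V w r‖ < 1} = (fun w => α r + w * (β r - α r)) ⁻¹' {z | z.re < 0} := by
      ext w
      simp [hV, Complex.norm_exp]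
    rw [h4]
    intro w1 h1 w2 h2 c1 c2 hc1 hc2 hc
    have h5 : α r + (c1 • w1 + c2 • w2) * (β r - α r) =
        c1 • (α r + w1 * (β r - α r)) + c2 • (α r + w2 * (β r - α r)) := by
      simp only [Complex.real_smul]
      have : (c1 : ℂ) + c2 = 1 := by exact_mod_cast hc
      linear_combination -(α r) * this
    rw [mem_preimage, h5]
    exact convex_halfSpace_re_lt 0 h1 h2 hc1 hc2 hc
  have hVz : ∀ r, V 0 r = Complex.exp (α r) := fun r => by simp [hV]
  have hVone : V 1 = u := funext fun r => by simp [hV, hβe]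
  have h0U : (0 : ℂ) ∈ U := mem_iInter.2 fun r => by
    rw [mem_ofPred_eq, hVz, Complex.norm_exp]; exact Real.exp_lt_one_iff.2 (hαr r)
  have h1U : (1 : ℂ) ∈ U := mem_iInter.2 fun r => by rw [mem_ofPred_eq, hVone]; exact hu1 r
  have hd : DifferentiableOn ℂ
      (fun w => thI p q (n + 1) (V w) - thC p q (n + 1) * thR p q (V w)) U :=
    (differentiableOn_thI hp hp0 hq hq0 (n + 1) hUo (fun r => (hVd r).differentiableOn)
      (fun w _ => hV0 w) hU1).sub ((differentiableOn_thR hp hq (fun r => (hVd r).differentiableOn)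
      (fun w _ => hV0 w) hU1).const_mul _)
  have hev : ∀ᶠ w in 𝓝 (0 : ℂ),
      thI p q (n + 1) (V w) - thC p q (n + 1) * thR p q (V w) = 0 := by
    have c1 : ∀ᶠ w in 𝓝 (0 : ℂ), ‖V w 0 * V w e.succ.succ‖ < ‖p‖ := by
      refine (((hVd 0).continuous.mul (hVd e.succ.succ).continuous).norm.tendsto 0).eventually_lt_const ?_
      rw [Pi.mul_apply, hVz, hVz, norm_mul, Complex.norm_exp, Complex.norm_exp, ← Real.exp_add, hPe]
      refine Real.exp_lt_exp.2 ?_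
      rw [hα0, hαe, hA]; linarith
    have c2 : ∀ᶠ w in 𝓝 (0 : ℂ), ‖p‖ < ‖V w 1‖ ^ 2 := by
      refine (((hVd 1).continuous.norm.pow 2).tendsto 0).eventually_const_lt ?_
      rw [Pi.pow_apply, hVz, Complex.norm_exp, ← Real.exp_nat_mul, hPe]
      refine Real.exp_lt_exp.2 ?_
      rw [hα1]
      push_cast
      linarith
    have c3 : ∀ᶠ w in 𝓝 (0 : ℂ), ‖q‖ < ‖V w a.succ.succ‖ ^ 2 := by
      refine (((hVd a.succ.succ).continuous.norm.pow 2).tendsto 0).eventually_const_lt ?_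
      rw [Pi.pow_apply, hVz, Complex.norm_exp, ← Real.exp_nat_mul, hQe]
      refine Real.exp_lt_exp.2 ?_
      rw [hαs a hae]
      push_cast
      linarith
    filter_upwards [c1, c2, c3, hUo.mem_nhds h0U] with w w1 w2 w3 hw
    have hVc : V w = Fin.cons (V w 0) (Fin.cons (V w 1) fun r => V w r.succ.succ) := by
      funext r
      exact Fin.cases rfl (fun r => Fin.cases rfl (fun r => rfl) r) r
    have hVp' := hVp w
    rw [Fin.prod_univ_succ, Fin.prod_univ_succ] at hVp'
    rw [sub_eq_zero, hVc]
    exact thI_eq_of_region hp hp0 hq hq0 hN ih (hV0 w 0) (hU1 w hw 0) (hU1 w hw 1)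
      (fun r => hV0 w _) (fun r => hU1 w hw _) hVp' hae w1 w2 w3
  have h := (hd.analyticOnNhd hUo).eqOn_zero_of_preconnected_of_eventuallyEq_zero
    hUc.isPreconnected h0U hev h1U
  simp only [hVone, Pi.zero_apply] at h
  exact sub_eq_zero.1 h

/-- The type I elliptic Selberg-type evaluation. -/
theorem thI_eq (hp : ‖p‖ < 1) (hp0 : p ≠ 0) (hq : ‖q‖ < 1) (hq0 : q ≠ 0) (n : ℕ) :
    ∀ {N : ℕ}, N = 2 * n + 4 → ∀ {u : Fin N → ℂ}, (∀ r, u r ≠ 0) → (∀ r, ‖u r‖ < 1) →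
      ∏ r, u r = p * q → thI p q n u = thC p q n * thR p q u := by
  induction n with
  | zero =>
    rintro N rfl u h0 h1 hu
    rw [thI_zero, thR_four hp hp0 hq hq0 h0 h1 hu]
    simp [thC]
  | succ n ih =>
    rintro N rfl u h0 h1 hu
    exact thI_succ_eq hp hp0 hq hq0 (N := 2 * n + 4) rfl
      (fun t => ih rfl (u := t)) h0 h1 hu

end Selberg

section Insertion

variable {p q : ℂ}

theorem isEvenTheta_sum {ι : Type*} (s : Finset ι) {d : ℕ} {f : ι → ℂ → ℂ}
    (h : ∀ i ∈ s, IsEvenTheta p d (f i)) : IsEvenTheta p d fun z => ∑ i ∈ s, f i z where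
  diff z hz := DifferentiableAt.fun_sum fun i hi => (h i hi).diff z hz
  even z hz := Finset.sum_congr rfl fun i hi => (h i hi).even z hz
  quasi z hz := by
    rw [Finset.mul_sum]
    exact Finset.sum_congr rfl fun i hi => (h i hi).quasi z hz

theorem IsEvenTheta.add {d : ℕ} {f g : ℂ → ℂ} (hf : IsEvenTheta p d f)
    (hg : IsEvenTheta p d g) : IsEvenTheta p d fun z => f z + g z where
  diff z hz := (hf.diff z hz).add (hg.diff z hz)
  even z hz := by rw [hf.even z hz, hg.even z hz]
  quasi z hz := by rw [hf.quasi z hz, hg.quasi z hz, mul_add]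

theorem IsEvenTheta.congr (hp0 : p ≠ 0) {d : ℕ} {f g : ℂ → ℂ} (hf : IsEvenTheta p d f)
    (hfg : ∀ z, z ≠ 0 → g z = f z) : IsEvenTheta p d g where
  diff z hz := (hf.diff z hz).congr_of_eventuallyEq <| by
    filter_upwards [isOpen_ne.mem_nhds hz] with w hw using hfg w hw
  even z hz := by rw [hfg _ (inv_ne_zero hz), hfg z hz, hf.even z hz]
  quasi z hz := by rw [hfg _ (mul_ne_zero hp0 hz), hfg z hz, hf.quasi z hz]

theorem isEvenTheta_det {n : ℕ} {M : ℂ → Matrix (Fin n) (Fin n) ℂ}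
    (h : ∀ i j, IsEvenTheta p 1 fun x => M x i j) : IsEvenTheta p n fun x => (M x).det := by
  simp only [Matrix.det_apply']
  refine isEvenTheta_sum _ fun σ _ => IsEvenTheta.const_mul ?_ _
  simpa using isEvenTheta_prod Finset.univ (f := fun i x => M x (σ i) i) fun i _ => h (σ i) i

theorem continuousOn_thP (hp : ‖p‖ < 1) {a : ℂ} (ha : a ≠ 0) : ContinuousOn (thP p a) (sphere 0 1) :=
  continuousOn_sphere_of_differentiableAt fun _ hz => differentiableAt_thP hp ha hz

theorem cAvg_mul_sub_mul {f g : ℂ → ℂ} (hf : ContinuousOn f (sphere 0 1))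
    (hg : ContinuousOn g (sphere 0 1)) (a b : ℂ) :
    cAvg (fun z => a * f z - b * g z) = a * cAvg f - b * cAvg g := by
  have h := cAvg_add (f := fun z => a * f z) (g := fun z => -b * g z)
    (continuousOn_const.mul hf) (continuousOn_const.mul hg)
  rw [cAvg_const_mul, cAvg_const_mul] at h
  rw [sub_eq_add_neg, ← neg_mul, ← h]
  exact cAvg_congr fun z _ => by ring

theorem isEvenTheta_thAvg (hp : ‖p‖ < 1) (hp0 : p ≠ 0) (hq : ‖q‖ < 1) (hq0 : q ≠ 0) (n : ℕ)
    {W : ℂ → ℂ} (hW : ContinuousOn W (sphere 0 1)) :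
    IsEvenTheta q n fun x => thAvg p q n fun z => thP q x z * W z := by
  obtain ⟨α, β, hα, hβ, hαβ⟩ := exists_thP_ne_zero hq
  obtain ⟨γ, δ, hγ, hδ, hγδ⟩ := exists_thP_ne_zero hp
  set C := thP q α β ^ n.choose 2 * thP p γ δ ^ n.choose 2
  have hC : C ≠ 0 := mul_ne_zero (pow_ne_zero _ hαβ) (pow_ne_zero _ hγδ)
  set m : Fin n → Fin n → ℂ → ℂ := fun j k z => thMono q α β n j z * thMono p γ δ n k z * W z
  have hm : ∀ j k, ContinuousOn (m j k) (sphere 0 1) := fun j k =>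
    ((continuousOn_thMono hq hq0 hα hβ j).mul (continuousOn_thMono hp hp0 hγ hδ k)).mul hW
  set A : Fin n → Fin n → ℂ := fun j k => cAvg fun z => thP q α z * m j k z
  set B : Fin n → Fin n → ℂ := fun j k => cAvg fun z => thP q β z * m j k z
  have hE : IsEvenTheta q n fun x => C⁻¹ * (n.factorial : ℂ) * (Matrix.of fun j k =>
      (-(thP q α β)⁻¹ * A j k) * thP q β x + ((thP q α β)⁻¹ * B j k) * thP q α x).det := by
    refine IsEvenTheta.const_mul (isEvenTheta_det fun j k => ?_) _
    simpa using ((isEvenTheta_thP hq hq0 hβ).const_mul (-(thP q α β)⁻¹ * A j k)).add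
      ((isEvenTheta_thP hq hq0 hα).const_mul ((thP q α β)⁻¹ * B j k))
  refine hE.congr hq0 fun x hx => ?_
  have h := thAvg_eq_det hp hp0 hq hq0 hα hβ hγ hδ hαβ hγδ n
    ((continuousOn_thP hq hx).mul hW)
  rw [mul_assoc, eq_inv_mul_iff_mul_eq₀ hC]
  refine h.trans ?_
  congr 3
  ext j k
  have e : ∀ z ∈ sphere (0 : ℂ) 1, thMono q α β n j z * thMono p γ δ n k z * (thP q x z * W z) =
      ((thP q α β)⁻¹ * thP q x β) * (thP q α z * m j k z) -
        ((thP q α β)⁻¹ * thP q x α) * (thP q β z * m j k z) := by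
    intro z hz
    have := thP_pluecker hq hq0 hα hβ hαβ hx (ne_zero_of_norm_one (mem_sphere_zero_iff_norm.1 hz))
    simp only [m]
    field_simp
    linear_combination (thMono q α β n j z * thMono p γ δ n k z * W z) * this
  have e2 := (cAvg_congr fun z hz => e z (by simpa using hz)).trans
    (cAvg_mul_sub_mul ((continuousOn_thP hq hα).mul (hm j k))
      ((continuousOn_thP hq hβ).mul (hm j k)) _ _)
  refine e2.trans ?_
  rw [thP_antisymm hq hx hβ, thP_antisymm hq hx hα]
  have hA : A j k = cAvg (thP q α * m j k) := rfl
  have hB : B j k = cAvg (thP q β * m j k) := rfl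
  rw [hA, hB]
  ring

/-- The torus average with theta functions inserted. -/
noncomputable def thJ (p q : ℂ) (n : ℕ) {N l m : ℕ} (t : Fin N → ℂ) (x : Fin l → ℂ) (y : Fin m → ℂ) : ℂ :=
  thAvg p q n fun z => (∏ j, thP q (x j) z) * (∏ j, thP p (y j) z) * thW p q t z

theorem thW_swap (hp : ‖p‖ < 1) (hq : ‖q‖ < 1) {ι : Type*} [Fintype ι] (t : ι → ℂ) {z : ℂ}
    (hz : z ≠ 0) : thW p q t z = thW q p t z := by
  simp only [thW, ellGamma_symm hp hq]
  rw [inv_pow, ellTheta_inv hp (pow_ne_zero 2 hz), ellTheta_inv hq (pow_ne_zero 2 hz)]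
  ring

theorem thJ_swap (hp : ‖p‖ < 1) (hq : ‖q‖ < 1) (n : ℕ) {N l m : ℕ} (t : Fin N → ℂ)
    (x : Fin l → ℂ) (y : Fin m → ℂ) : thJ p q n t x y = thJ q p n t y x := by
  rw [thJ, thAvg_swap, thJ]
  refine thAvg_congr fun z hz => ?_
  rw [thW_swap hp hq t (ne_zero_of_norm_one hz)]
  ring

theorem thJ_cons (n : ℕ) {N l m : ℕ} (t : Fin N → ℂ) (a : ℂ)
    (x : Fin l → ℂ) (y : Fin m → ℂ) :
    thJ p q n t (Fin.cons a x : Fin (l + 1) → ℂ) y = thAvg p q n fun z =>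
      thP q a z * ((∏ j, thP q (x j) z) * (∏ j, thP p (y j) z) * thW p q t z) := by
  simp only [thJ, Fin.prod_univ_succ, Fin.cons_zero, Fin.cons_succ, mul_assoc]

theorem thJ_cons_self (hp : ‖p‖ < 1) (hp0 : p ≠ 0) (hq : ‖q‖ < 1) (n : ℕ) {N l m : ℕ}
    {t : Fin N → ℂ} {b : Fin N} (ht0 : t b ≠ 0) (ht1 : ‖t b‖ < 1) (x : Fin l → ℂ) (y : Fin m → ℂ) :
    thJ p q n t (Fin.cons (t b) x : Fin (l + 1) → ℂ) y =
      ((t b)⁻¹) ^ n * thJ p q n (Function.update t b (p * t b)) x y := by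
  rw [thJ_cons, thJ, ← thAvg_const_mul]
  refine thAvg_congr fun z hz => ?_
  rw [mul_left_comm, thP_mul_thW hp hp0 hq ht0 ht1 hz]
  ring

theorem continuousOn_thP_param (hp : ‖p‖ < 1) {u : ℂ → ℂ} {U : Set ℂ} (hu : ContinuousOn u U)
    (h0 : ∀ w ∈ U, u w ≠ 0) :
    ContinuousOn (fun x : ℂ × ℂ => thP p (u x.1) x.2) (U ×ˢ sphere 0 1) := by
  have hz0 : ∀ x ∈ U ×ˢ sphere (0 : ℂ) 1, x.2 ≠ 0 := fun x hx =>
    ne_zero_of_norm_one (mem_sphere_zero_iff_norm.1 hx.2)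
  have hu' : ContinuousOn (fun x : ℂ × ℂ => u x.1) (U ×ˢ sphere 0 1) :=
    hu.comp continuousOn_fst fun x hx => hx.1
  have hT : ∀ x : ℂ, x ≠ 0 → ContinuousAt (fun x => ellTheta x p) x := fun x h =>
    (differentiableAt_ellTheta hp h).continuousAt
  refine ContinuousOn.mul (hu'.inv₀ fun x hx => h0 _ hx.1) (ContinuousOn.mul ?_ ?_)
  · exact fun x hx => ContinuousAt.comp_continuousWithinAt (f := fun x : ℂ × ℂ => u x.1 * x.2)
      (hT _ (mul_ne_zero (h0 _ hx.1) (hz0 x hx))) ((hu' x hx).mul continuousWithinAt_snd)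
  · exact fun x hx => ContinuousAt.comp_continuousWithinAt (f := fun x : ℂ × ℂ => u x.1 / x.2)
      (hT _ (div_ne_zero (h0 _ hx.1) (hz0 x hx)))
      ((hu' x hx).div continuousWithinAt_snd (hz0 x hx))

theorem differentiableAt_thP_left (hp : ‖p‖ < 1) {a z : ℂ} (ha : a ≠ 0) (hz : z ≠ 0) :
    DifferentiableAt ℂ (fun a => thP p a z) a := by
  refine ((differentiableAt_thP hp hz ha).neg).congr_of_eventuallyEq ?_
  filter_upwards [isOpen_ne.mem_nhds ha] with b hb using thP_antisymm hp hb hz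

theorem differentiableOn_thJ (hp : ‖p‖ < 1) (hp0 : p ≠ 0) (hq : ‖q‖ < 1) (hq0 : q ≠ 0) (n : ℕ)
    {N l m : ℕ} {t : ℂ → Fin N → ℂ} {x : ℂ → Fin l → ℂ} {y : Fin m → ℂ} {U : Set ℂ} (hU : IsOpen U)
    (ht : ∀ r, DifferentiableOn ℂ (fun w => t w r) U)
    (ht0 : ∀ w ∈ U, ∀ r, t w r ≠ 0) (ht1 : ∀ w ∈ U, ∀ r, ‖t w r‖ < 1)
    (hx : ∀ r, DifferentiableOn ℂ (fun w => x w r) U)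
    (hx0 : ∀ w ∈ U, ∀ r, x w r ≠ 0) (hy0 : ∀ r, y r ≠ 0) :
    DifferentiableOn ℂ (fun w => thJ p q n (t w) (x w) y) U := by
  have hX : ContinuousOn (fun v : ℂ × ℂ => ∏ j, thP q (x v.1 j) v.2) (U ×ˢ sphere 0 1) :=
    continuousOn_finsetProd _ fun j _ =>
      continuousOn_thP_param (u := fun w => x w j) hq (hx j).continuousOn fun w hw => hx0 w hw j
  have hY : ContinuousOn (fun v : ℂ × ℂ => ∏ j, thP p (y j) v.2) (U ×ˢ sphere 0 1) :=
    continuousOn_finsetProd _ fun j _ =>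
      continuousOn_thP_param (u := fun _ => y j) hp continuousOn_const fun _ _ => hy0 j
  have hWc : ContinuousOn (fun v : ℂ × ℂ => thW p q (t v.1) v.2) (U ×ˢ sphere 0 1) :=
    continuousOn_thW_param hp hq (fun r => (ht r).continuousOn) ht0 ht1
  refine differentiableOn_thAvg hp hp0 hq hq0 n (W := fun w z =>
    (∏ j, thP q (x w j) z) * (∏ j, thP p (y j) z) * thW p q (t w) z) hU ((hX.mul hY).mul hWc)
    fun z hz => ?_
  · refine DifferentiableOn.mul (DifferentiableOn.mul_const (DifferentiableOn.fun_finsetProd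
      fun j _ => ?_) _) (differentiableOn_thW_param hp hq ht ht0 ht1 hz)
    exact fun w hw => DifferentiableAt.comp_differentiableWithinAt (f := fun w => x w j) w
      (differentiableAt_thP_left hq (hx0 w hw j) (ne_zero_of_norm_one hz)) (hx j w hw)

end Insertion

section SignSums

variable {p q : ℂ}

/-- The theta Vandermonde product of type `C`. -/
noncomputable def thV (q : ℂ) {l : ℕ} (x : Fin l → ℂ) : ℂ :=
  (∏ i, thSq q (x i)) * ∏ i, ∏ j ∈ Finset.Ioi i, thP q (x i) (x j)

/-- The one-variable factor of the sign sum `thF`. -/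
noncomputable def thg (q : ℂ) (K : ℕ) {N : ℕ} (t : Fin N → ℂ) (X : ℂ) : ℂ :=
  (X ^ (K + 1))⁻¹ * ∏ r, ellTheta (t r * X) q

/-- The two-variable factor of the sign sum `thF`. -/
noncomputable def thK (p q X Y : ℂ) : ℂ :=
  X⁻¹ * (ellTheta (X / Y) q * ellTheta (p * (X * Y)) q)

/-- The sign sum on the evaluation side, cleared of denominators. -/
noncomputable def thF (p q : ℂ) (K : ℕ) {N l : ℕ} (t : Fin N → ℂ) (x : Fin l → ℂ) : ℂ :=
  ∑ σ : Fin l → Bool, (∏ i, (if σ i then 1 else -1) * thg q K t (pw (x i) (σ i))) *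
    ∏ i, ∏ j ∈ Finset.Ioi i, thK p q (pw (x i) (σ i)) (pw (x j) (σ j))

theorem pw_ne_zero {z : ℂ} (hz : z ≠ 0) (b : Bool) : pw z b ≠ 0 := by
  unfold pw
  split
  exacts [hz, inv_ne_zero hz]

theorem thP_pw (p a z : ℂ) (b : Bool) : thP p a (pw z b) = thP p a z := by
  unfold pw
  split
  exacts [rfl, thP_inv_right p a z]

theorem thK_antisymm (hq : ‖q‖ < 1) {X Y : ℂ} (hX : X ≠ 0) (hY : Y ≠ 0) :
    thK p q X Y = -thK p q Y X := by
  have h := ellTheta_inv hq (div_ne_zero hX hY)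
  rw [inv_div] at h
  rw [thK, thK, h, mul_comm Y X]
  field_simp

theorem thF_cons (K : ℕ) {N l : ℕ} (t : Fin N → ℂ) (a : ℂ) (x : Fin l → ℂ) :
    thF p q K t (Fin.cons a x : Fin (l + 1) → ℂ) = ∑ σ : Fin l → Bool,
      ((∏ i, (if σ i then 1 else -1) * thg q K t (pw (x i) (σ i))) *
        ∏ i, ∏ j ∈ Finset.Ioi i, thK p q (pw (x i) (σ i)) (pw (x j) (σ j))) *
      (thg q K t a * ∏ j, thK p q a (pw (x j) (σ j)) -
        thg q K t a⁻¹ * ∏ j, thK p q a⁻¹ (pw (x j) (σ j))) := by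
  rw [thF, ← (Fin.consEquiv fun _ : Fin (l + 1) => Bool).sum_comp, Fintype.sum_prod_type,
    Finset.sum_comm]
  refine Finset.sum_congr rfl fun σ _ => ?_
  simp only [Fin.consEquiv, Equiv.coe_fn_mk, Fin.prod_univ_succ, Fin.prod_Ioi_zero,
    Fin.prod_Ioi_succ, Fin.cons_zero, Fin.cons_succ, Fintype.sum_bool, pw, if_true,
    Bool.false_eq_true, if_false]
  ring

theorem thF_comp_perm (hq : ‖q‖ < 1) (K : ℕ) {N l : ℕ} (t : Fin N → ℂ) {x : Fin l → ℂ}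
    (hx : ∀ i, x i ≠ 0) (τ : Equiv.Perm (Fin l)) :
    thF p q K t (x ∘ τ) = (Equiv.Perm.sign τ : ℤ) * thF p q K t x := by
  rw [thF, thF, Finset.mul_sum]
  refine (Fintype.sum_equiv (Equiv.arrowCongr τ.symm (Equiv.refl Bool)) _ _ fun σ => ?_).symm
  have e : Equiv.arrowCongr τ.symm (Equiv.refl Bool) σ = σ ∘ τ := rfl
  have h := Equiv.Perm.prod_Ioi_comp_eq_sign_mul_prod τ
    (f := fun i j => thK p q (pw (x i) (σ i)) (pw (x j) (σ j)))
    fun i j => thK_antisymm hq (pw_ne_zero (hx i) _) (pw_ne_zero (hx j) _)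
  simp only [e, Function.comp_apply]
  rw [h, Equiv.prod_comp τ (fun i => (if σ i then (1 : ℂ) else -1) * thg q K t (pw (x i) (σ i)))]
  ring

theorem thF_eq_zero_of_eq (hq : ‖q‖ < 1) (K : ℕ) {N l : ℕ} (t : Fin N → ℂ) {x : Fin l → ℂ}
    (hx : ∀ i, x i ≠ 0) {i j : Fin l} (hij : i ≠ j) (h : x i = x j) : thF p q K t x = 0 := by
  have h1 := thF_comp_perm (p := p) hq K t hx (Equiv.swap i j)
  have h2 : x ∘ Equiv.swap i j = x := by
    ext k
    rcases eq_or_ne k i with rfl | hi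
    · simp [h]
    rcases eq_or_ne k j with rfl | hj
    · simp [h]
    · simp [Equiv.swap_apply_of_ne_of_ne hi hj]
  rw [h2, Equiv.Perm.sign_swap hij] at h1
  push_cast at h1
  linear_combination h1 / 2

theorem thK_mul_thg {K : ℕ} {N : ℕ} {t : Fin N → ℂ} {b : Fin N} (X : ℂ) :
    thK p q (t b) X * thg q K t X = thP q (t b) X * thg q K (Function.update t b (p * t b)) X := by
  simp only [thK, thg, thP]
  rw [← Finset.mul_prod_erase _ _ (Finset.mem_univ b), ← Finset.mul_prod_erase _ _ (Finset.mem_univ b),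
    Function.update_self, Finset.prod_congr rfl fun r hr =>
      show ellTheta (Function.update t b (p * t b) r * X) q = ellTheta (t r * X) q by
        rw [Function.update_of_ne (Finset.ne_of_mem_erase hr)], mul_assoc p]
  ring

theorem thg_self {K : ℕ} {N : ℕ} {t : Fin N → ℂ} {b : Fin N} :
    thg q K t (t b) = (t b)⁻¹ ^ K * thSq q (t b) *
      ∏ s ∈ Finset.univ.erase b, ellTheta (t b * t s) q := by
  rw [thg, thSq, ← Finset.mul_prod_erase _ _ (Finset.mem_univ b), pow_succ, mul_inv, inv_pow, pow_two]
  simp only [mul_comm _ (t b)]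
  ring

theorem thg_inv_self {K : ℕ} {N : ℕ} {t : Fin N → ℂ} {b : Fin N} (hb : t b ≠ 0) :
    thg q K t (t b)⁻¹ = 0 := by
  rw [thg, Finset.prod_eq_zero (Finset.mem_univ b), mul_zero]
  rw [mul_inv_cancel₀ hb, ellTheta_one]

theorem thF_cons_self {K : ℕ} {N l : ℕ} {t : Fin N → ℂ} {b : Fin N} (hb : t b ≠ 0) (x : Fin l → ℂ) :
    thF p q K t (Fin.cons (t b) x : Fin (l + 1) → ℂ) =
      (t b)⁻¹ ^ K * thSq q (t b) * (∏ s ∈ Finset.univ.erase b, ellTheta (t b * t s) q) *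
        (∏ j, thP q (t b) (x j)) * thF p q K (Function.update t b (p * t b)) x := by
  rw [thF_cons, thF, Finset.mul_sum]
  refine Finset.sum_congr rfl fun σ _ => ?_
  rw [thg_inv_self hb, zero_mul, sub_zero, thg_self]
  have h : ∀ i, thP q (t b) (x i) * thg q K (Function.update t b (p * t b)) (pw (x i) (σ i)) =
      thK p q (t b) (pw (x i) (σ i)) * thg q K t (pw (x i) (σ i)) := fun i => by
    rw [thK_mul_thg, thP_pw]
  have h2 : (∏ i, thP q (t b) (x i)) * ∏ i, thg q K (Function.update t b (p * t b)) (pw (x i) (σ i)) =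
      (∏ i, thK p q (t b) (pw (x i) (σ i))) * ∏ i, thg q K t (pw (x i) (σ i)) := by
    rw [← Finset.prod_mul_distrib, ← Finset.prod_mul_distrib]
    exact Finset.prod_congr rfl fun i _ => h i
  rw [Finset.prod_mul_distrib, Finset.prod_mul_distrib]
  linear_combination (-(t b)⁻¹ ^ K * thSq q (t b) *
    (∏ s ∈ Finset.univ.erase b, ellTheta (t b * t s) q) * (∏ i, if σ i then (1 : ℂ) else -1) *
    ∏ i, ∏ j ∈ Finset.Ioi i, thK p q (pw (x i) (σ i)) (pw (x j) (σ j))) * h2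

theorem thg_update (hp : ‖p‖ < 1) (hp0 : p ≠ 0) {K : ℕ} {N : ℕ} {t : Fin N → ℂ} {b : Fin N}
    (hb : t b ≠ 0) {X : ℂ} (hX : X ≠ 0) :
    thg p K (Function.update t b (p * t b)) X = -(t b)⁻¹ * thg p (K + 1) t X := by
  simp only [thg]
  rw [← Finset.mul_prod_erase _ _ (Finset.mem_univ b), ← Finset.mul_prod_erase _ _ (Finset.mem_univ b),
    Function.update_self, Finset.prod_congr rfl fun r hr =>
      show ellTheta (Function.update t b (p * t b) r * X) p = ellTheta (t r * X) p by
        rw [Function.update_of_ne (Finset.ne_of_mem_erase hr)], mul_assoc p,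
    ellTheta_mul_nome hp hp0 (mul_ne_zero hb hX), pow_succ X (K + 1), mul_inv, mul_inv]
  ring

theorem thF_update (hp : ‖p‖ < 1) (hp0 : p ≠ 0) {K : ℕ} {N m : ℕ} {t : Fin N → ℂ} {b : Fin N}
    (hb : t b ≠ 0) {y : Fin m → ℂ} (hy : ∀ j, y j ≠ 0) :
    thF q p K (Function.update t b (p * t b)) y = (-(t b)⁻¹) ^ m * thF q p (K + 1) t y := by
  rw [thF, thF, Finset.mul_sum]
  refine Finset.sum_congr rfl fun σ _ => ?_
  simp only [thg_update hp hp0 hb (pw_ne_zero (hy _) _), mul_left_comm _ (-(t b)⁻¹)]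
  rw [Finset.prod_mul_distrib, Finset.prod_const, Finset.card_fin]
  ring

theorem thg_nome_mul (hq : ‖q‖ < 1) (hq0 : q ≠ 0) {K : ℕ} {N : ℕ} {t : Fin N → ℂ}
    (ht : ∀ r, t r ≠ 0) {X : ℂ} (hX : X ≠ 0) :
    thg q K t (q * X) = (q ^ (K + 1))⁻¹ * (-1) ^ N * (∏ r, t r)⁻¹ * (X ^ N)⁻¹ * thg q K t X := by
  simp only [thg]
  have h : ∀ r, ellTheta (t r * (q * X)) q = -1 * (t r)⁻¹ * X⁻¹ * ellTheta (t r * X) q := fun r => by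
    rw [mul_left_comm, ellTheta_mul_nome hq hq0 (mul_ne_zero (ht r) hX), mul_inv]
    ring
  simp only [h, Finset.prod_mul_distrib, Finset.prod_const, Finset.card_fin, Finset.prod_inv_distrib,
    mul_pow, mul_inv, inv_pow]
  ring

theorem thK_nome_mul (hq : ‖q‖ < 1) (hq0 : q ≠ 0) (hp0 : p ≠ 0) {X Y : ℂ} (hX : X ≠ 0) (hY : Y ≠ 0) :
    thK p q (q * X) Y = p⁻¹ * (q * X ^ 2)⁻¹ * thK p q X Y := by
  simp only [thK]
  rw [mul_div_assoc, ellTheta_mul_nome hq hq0 (div_ne_zero hX hY),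
    show p * (q * X * Y) = q * (p * (X * Y)) by ring,
    ellTheta_mul_nome hq hq0 (mul_ne_zero hp0 (mul_ne_zero hX hY))]
  field_simp

theorem differentiableAt_thg (hq : ‖q‖ < 1) {K : ℕ} {N : ℕ} {t : Fin N → ℂ}
    (ht : ∀ r, t r ≠ 0) {X : ℂ} (hX : X ≠ 0) : DifferentiableAt ℂ (thg q K t) X := by
  refine ((differentiableAt_id.pow _).inv (pow_ne_zero _ hX)).mul
    (DifferentiableAt.fun_finsetProd fun r _ => ?_)
  exact DifferentiableAt.comp (f := fun X => t r * X) X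
    (differentiableAt_ellTheta hq (mul_ne_zero (ht r) hX)) (differentiableAt_id.const_mul _)

theorem differentiableAt_thK (hq : ‖q‖ < 1) (hp0 : p ≠ 0) {X Y : ℂ} (hX : X ≠ 0) (hY : Y ≠ 0) :
    DifferentiableAt ℂ (fun X => thK p q X Y) X := by
  refine (differentiableAt_id.inv hX).mul (DifferentiableAt.mul ?_ ?_)
  · exact DifferentiableAt.comp (f := fun X => X / Y) X
      (differentiableAt_ellTheta hq (div_ne_zero hX hY)) (differentiableAt_id.div_const _)
  · exact DifferentiableAt.comp (f := fun X => p * (X * Y)) X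
      (differentiableAt_ellTheta hq (mul_ne_zero hp0 (mul_ne_zero hX hY)))
      ((differentiableAt_id.mul_const _).const_mul _)

theorem isOddTheta_thF (hp0 : p ≠ 0) (hq : ‖q‖ < 1) (hq0 : q ≠ 0) {n l m : ℕ}
    {t : Fin (2 * n + 4) → ℂ} (ht : ∀ r, t r ≠ 0)
    (hprod : (∏ r, t r) * (p ^ (l + 1) * q ^ m) = p * q) {x : Fin l → ℂ} (hx : ∀ j, x j ≠ 0) :
    IsOddTheta q (n + l + 2) fun a => thF p q (n + m) t (Fin.cons a x : Fin (l + 1) → ℂ) := by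
  simp only [thF_cons]
  refine isOddTheta_sum _ fun σ _ => IsOddTheta.const_mul (isOddTheta_antisymm
    (G := fun a => thg q (n + m) t a * ∏ j, thK p q a (pw (x j) (σ j))) hq0 (fun z hz => ?_)
    fun z hz => ?_) _
  · exact (differentiableAt_thg hq ht hz).mul (DifferentiableAt.fun_finsetProd fun j _ =>
      differentiableAt_thK hq hp0 hz (pw_ne_zero (hx j) _))
  · simp only [thg_nome_mul hq hq0 ht hz, thK_nome_mul hq hq0 hp0 hz (pw_ne_zero (hx _) _),
      Finset.prod_mul_distrib, Finset.prod_const, Finset.card_fin]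
    rw [Even.neg_one_pow (by simp [parity_simps])]
    have hP : ∏ r, t r ≠ 0 := Finset.prod_ne_zero_iff.2 fun r _ => ht r
    have h1 : (∏ r, t r) * (p ^ l * q ^ m) = q := by
      apply mul_left_cancel₀ hp0
      rw [← hprod]
      ring
    have h2 : (∏ r, t r) * p ^ l * q ^ (n + m + 1) * q ^ l = q ^ (n + l + 2) := by
      linear_combination q ^ (n + l + 1) * h1
    have h3 : (q ^ (n + m + 1))⁻¹ * 1 * (∏ r, t r)⁻¹ * (z ^ (2 * n + 4))⁻¹ *
        (p⁻¹ ^ l * (q * z ^ 2)⁻¹ ^ l) = ((q * z ^ 2) ^ (n + l + 2))⁻¹ := by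
      rw [mul_pow q, ← h2]
      simp only [inv_pow, mul_pow, mul_inv]
      ring
    rw [← h3]
    ring

theorem thV_cons {l : ℕ} (a : ℂ) (x : Fin l → ℂ) :
    thV q (Fin.cons a x : Fin (l + 1) → ℂ) = thSq q a * (∏ j, thP q a (x j)) * thV q x := by
  simp only [thV, Fin.prod_univ_succ, Fin.prod_Ioi_zero, Fin.prod_Ioi_succ, Fin.cons_zero, Fin.cons_succ]
  ring

end SignSums

section InsertionFormula

variable {p q : ℂ}

theorem ContinuousAt.ellTheta (hq : ‖q‖ < 1) {f : ℂ → ℂ} {a : ℂ} (hf : ContinuousAt f a)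
    (h0 : f a ≠ 0) : ContinuousAt (fun w => ellTheta (f w) q) a :=
  ContinuousAt.comp (g := fun x => _root_.ellTheta x q) (differentiableAt_ellTheta hq h0).continuousAt hf

theorem continuousAt_thV (hq : ‖q‖ < 1) {l : ℕ} {x : ℂ → Fin l → ℂ} {a : ℂ}
    (hx : ∀ i, ContinuousAt (fun w => x w i) a) (hx0 : ∀ i, x a i ≠ 0) :
    ContinuousAt (fun w => thV q (x w)) a := by
  refine ContinuousAt.mul (tendsto_finsetProd _ fun i _ => ?_)
    (tendsto_finsetProd _ fun i _ => tendsto_finsetProd _ fun j _ => ?_)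
  · exact ((hx i).inv₀ (hx0 i)).mul (((hx i).pow 2).ellTheta hq (pow_ne_zero 2 (hx0 i)))
  · exact ((hx i).inv₀ (hx0 i)).mul
      ((((hx i).mul (hx j)).ellTheta hq (mul_ne_zero (hx0 i) (hx0 j))).mul
        (((hx i).div (hx j) (hx0 j)).ellTheta hq (div_ne_zero (hx0 i) (hx0 j))))

theorem ContinuousAt.pw {f : ℂ → ℂ} {a : ℂ} (hf : ContinuousAt f a) (h0 : f a ≠ 0) (b : Bool) :
    ContinuousAt (fun w => pw (f w) b) a := by
  cases b
  · exact hf.inv₀ h0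
  · exact hf

theorem continuousAt_thF (hp0 : p ≠ 0) (hq : ‖q‖ < 1) (K : ℕ) {N l : ℕ} {t : ℂ → Fin N → ℂ}
    {x : ℂ → Fin l → ℂ} {a : ℂ}
    (ht : ∀ i, ContinuousAt (fun w => t w i) a) (ht0 : ∀ i, t a i ≠ 0)
    (hx : ∀ i, ContinuousAt (fun w => x w i) a) (hx0 : ∀ i, x a i ≠ 0) :
    ContinuousAt (fun w => thF p q K (t w) (x w)) a := by
  refine tendsto_finsetSum _ fun σ _ => ContinuousAt.mul (tendsto_finsetProd _ fun i _ => ?_)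
    (tendsto_finsetProd _ fun i _ => tendsto_finsetProd _ fun j _ => ?_)
  · have h := (hx i).pw (hx0 i) (σ i)
    have h0 := pw_ne_zero (hx0 i) (σ i)
    exact continuousAt_const.mul (((h.pow _).inv₀ (pow_ne_zero _ h0)).mul
      (tendsto_finsetProd _ fun r _ => ((ht r).mul h).ellTheta hq (mul_ne_zero (ht0 r) h0)))
  · have hi := (hx i).pw (hx0 i) (σ i)
    have hi0 := pw_ne_zero (hx0 i) (σ i)
    have hj := (hx j).pw (hx0 j) (σ j)
    have hj0 := pw_ne_zero (hx0 j) (σ j)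
    exact (hi.inv₀ hi0).mul (((hi.div hj hj0).ellTheta hq (div_ne_zero hi0 hj0)).mul
      ((continuousAt_const.mul (hi.mul hj)).ellTheta hq (mul_ne_zero hp0 (mul_ne_zero hi0 hj0))))

theorem thV_eq_zero_of_eq {l : ℕ} {x : Fin l → ℂ} {i j : Fin l} (hi : x i ≠ 0) (hij : i < j)
    (h : x i = x j) : thV q x = 0 := by
  refine mul_eq_zero_of_right _ (Finset.prod_eq_zero (Finset.mem_univ i) ?_)
  exact Finset.prod_eq_zero (Finset.mem_Ioi.2 hij) (by rw [← h, thP_self q hi])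

/-- The evaluation of the torus average with `l` and `m` theta functions inserted. -/
def InsertionFormula (p q : ℂ) (n l m : ℕ) : Prop :=
  ∀ (t : Fin (2 * n + 4) → ℂ) (x : Fin l → ℂ) (y : Fin m → ℂ), (∀ r, t r ≠ 0) → (∀ r, ‖t r‖ < 1) →
    (∏ r, t r) * (p ^ l * q ^ m) = p * q → (∀ i, x i ≠ 0) → (∀ j, y j ≠ 0) →
    thV q x * thV p y * thJ p q n t x y =
      (-1) ^ (l * m) * thC p q n * thR p q t * thF p q (n + m) t x * thF q p (n + l) t y

theorem InsertionFormula.cons_self (hp : ‖p‖ < 1) (hp0 : p ≠ 0) (hq : ‖q‖ < 1)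
    {n l m : ℕ} (ih : InsertionFormula p q n l m) {t : Fin (2 * n + 4) → ℂ}
    (ht0 : ∀ r, t r ≠ 0) (ht1 : ∀ r, ‖t r‖ < 1) (hprod : (∏ r, t r) * (p ^ (l + 1) * q ^ m) = p * q)
    {x : Fin l → ℂ} {y : Fin m → ℂ} (hx : ∀ i, x i ≠ 0) (hy : ∀ j, y j ≠ 0) (b : Fin (2 * n + 4)) :
    thV q (Fin.cons (t b) x : Fin (l + 1) → ℂ) * thV p y *
        thJ p q n t (Fin.cons (t b) x : Fin (l + 1) → ℂ) y =
      (-1) ^ ((l + 1) * m) * thC p q n * thR p q t *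
        thF p q (n + m) t (Fin.cons (t b) x : Fin (l + 1) → ℂ) * thF q p (n + (l + 1)) t y := by
  have h := ih (Function.update t b (p * t b)) x y (fun r => ?_) (fun r => ?_) ?_ hx hy
  · rw [thV_cons, thJ_cons_self hp hp0 hq n (ht0 b) (ht1 b), thF_cons_self (ht0 b)]
    rw [thR_update hp hp0 hq ht0 ht1, thF_update hp hp0 (ht0 b) hy] at h
    have e1 : (-1 : ℂ) ^ ((l + 1) * m) = (-1) ^ (l * m) * (-1) ^ m := by rw [← pow_add]; ring_nf
    have e2 : (-(t b)⁻¹) ^ m = (-1) ^ m * (t b)⁻¹ ^ m := by rw [← mul_pow]; ring_nf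
    rw [e2] at h
    rw [e1, pow_add, ← add_assoc n l 1]
    linear_combination (thSq q (t b) * (∏ j, thP q (t b) (x j)) * (t b)⁻¹ ^ n) * h
  · by_cases h : r = b
    · subst h; simpa using ⟨hp0, ht0 r⟩
    · simpa [Function.update_of_ne h] using ht0 r
  · by_cases h : r = b
    · subst h; rw [Function.update_self]; exact norm_mul_lt_one hp (ht1 r)
    · simpa [Function.update_of_ne h] using ht1 r
  · rw [Finset.prod_update_of_mem (Finset.mem_univ b), ← Finset.erase_eq, ← hprod,
      ← Finset.mul_prod_erase _ t (Finset.mem_univ b)]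
    ring

theorem InsertionFormula.cons_of_generic (hp : ‖p‖ < 1) (hp0 : p ≠ 0) (hq : ‖q‖ < 1) (hq0 : q ≠ 0)
    {n l m : ℕ} (ih : InsertionFormula p q n l m) {t : Fin (2 * n + 4) → ℂ}
    (ht0 : ∀ r, t r ≠ 0) (ht1 : ∀ r, ‖t r‖ < 1) (hprod : (∏ r, t r) * (p ^ (l + 1) * q ^ m) = p * q)
    {x : Fin l → ℂ} {y : Fin m → ℂ} (hx : ∀ i, x i ≠ 0) (hy : ∀ j, y j ≠ 0) {k : ℕ}
    (hk : k = n + l + 1) {a : Fin k → ℂ} (ha : ∀ i, (∃ b, a i = t b) ∨ ∃ j, a i = x j)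
    (ha2 : ∀ i, ellTheta (a i ^ 2) q ≠ 0)
    (haa : ∀ i j, i < j → ellTheta (a i * a j) q ≠ 0 ∧ ellTheta (a i / a j) q ≠ 0)
    {z : ℂ} (hz : z ≠ 0) :
    thV q (Fin.cons z x : Fin (l + 1) → ℂ) * thV p y *
        thJ p q n t (Fin.cons z x : Fin (l + 1) → ℂ) y =
      (-1) ^ ((l + 1) * m) * thC p q n * thR p q t *
        thF p q (n + m) t (Fin.cons z x : Fin (l + 1) → ℂ) * thF q p (n + (l + 1)) t y := by
  have ha0 : ∀ i, a i ≠ 0 := fun i => by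
    rcases ha i with ⟨b, hb⟩ | ⟨j, hj⟩
    · rw [hb]; exact ht0 b
    · rw [hj]; exact hx j
  have hW : ContinuousOn (fun z => (∏ j, thP q (x j) z) * (∏ j, thP p (y j) z) * thW p q t z)
      (sphere 0 1) :=
    ((continuousOn_finsetProd _ fun j _ => continuousOn_thP hq (hx j)).mul
      (continuousOn_finsetProd _ fun j _ => continuousOn_thP hp (hy j))).mul
      (continuousOn_thW hp hq ht0 ht1)
  have hL : IsOddTheta q (n + l + 2) fun z => thV q x * thV p y * (thSq q z *
      ((∏ j, thP q (x j) z) * thAvg p q n fun w => thP q z w *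
        ((∏ j, thP q (x j) w) * (∏ j, thP p (y j) w) * thW p q t w))) := by
    have h := ((isOddTheta_thSq hq hq0).mul_even ((isEvenTheta_prod Finset.univ fun j _ =>
      isEvenTheta_thP hq hq0 (hx j)).mul (isEvenTheta_thAvg hp hp0 hq hq0 n hW))).const_mul
        (thV q x * thV p y)
    rw [Finset.card_fin] at h
    convert h using 1
    ring
  have hR := (isOddTheta_thF hp0 hq hq0 ht0 hprod hx).const_mul
    ((-1) ^ ((l + 1) * m) * thC p q n * thR p q t * thF q p (n + (l + 1)) t y * (-1) ^ l)
  have key : ∀ z, z ≠ 0 → thV q (Fin.cons z x : Fin (l + 1) → ℂ) * thV p y *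
        thJ p q n t (Fin.cons z x : Fin (l + 1) → ℂ) y = (-1) ^ l * (thV q x * thV p y * (thSq q z *
      ((∏ j, thP q (x j) z) * thAvg p q n fun w => thP q z w *
        ((∏ j, thP q (x j) w) * (∏ j, thP p (y j) w) * thW p q t w)))) := fun z hz => by
    have e : ∏ j, thP q z (x j) = (-1) ^ l * ∏ j, thP q (x j) z := by
      rw [Finset.prod_congr rfl fun j _ => (thP_antisymm hq hz (hx j)).trans (neg_one_mul _).symm,
        Finset.prod_mul_distrib, Finset.prod_const, Finset.card_fin]
    rw [thV_cons, thJ_cons, e]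
    ring
  have hs : ((-1 : ℂ) ^ l) * (-1) ^ l = 1 := by rw [← mul_pow]; simp
  subst hk
  have h0 := (hL.sub hR).eq_zero_of_zeros hq hq0 ha0 (fun i => mul_ne_zero (inv_ne_zero (ha0 i)) (ha2 i))
    (fun i j hij => thP_ne_zero (ha0 i) (haa i j hij).1 (haa i j hij).2) (fun i => ?_) hz
  · rw [key z hz]
    linear_combination ((-1) ^ l) * h0 + (((-1) ^ ((l + 1) * m) * thC p q n * thR p q t *
      thF p q (n + m) t (Fin.cons z x : Fin (l + 1) → ℂ) * thF q p (n + (l + 1)) t y)) * hs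
  · have h : thV q (Fin.cons (a i) x : Fin (l + 1) → ℂ) * thV p y *
        thJ p q n t (Fin.cons (a i) x : Fin (l + 1) → ℂ) y =
      (-1) ^ ((l + 1) * m) * thC p q n * thR p q t *
        thF p q (n + m) t (Fin.cons (a i) x : Fin (l + 1) → ℂ) * thF q p (n + (l + 1)) t y := by
      rcases ha i with ⟨b, hb⟩ | ⟨j, hj⟩
      · rw [hb]
        exact ih.cons_self hp hp0 hq ht0 ht1 hprod hx hy b
      · have hc : ∀ r, (Fin.cons (a i) x : Fin (l + 1) → ℂ) r ≠ 0 :=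
          Fin.cases (ha0 i) fun r => by simpa using hx r
        have e : (Fin.cons (a i) x : Fin (l + 1) → ℂ) 0 = (Fin.cons (a i) x : Fin (l + 1) → ℂ) j.succ := by
          simpa using hj
        rw [thV_eq_zero_of_eq (hc 0) (Fin.succ_pos j) e,
          thF_eq_zero_of_eq hq _ t hc (Fin.succ_ne_zero j).symm e]
        ring
    rw [key _ (ha0 i)] at h
    linear_combination ((-1) ^ l) * h - (thV q x * thV p y * (thSq q (a i) *
      ((∏ j, thP q (x j) (a i)) * thAvg p q n fun w => thP q (a i) w *
        ((∏ j, thP q (x j) w) * (∏ j, thP p (y j) w) * thW p q t w)))) * hs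

theorem InsertionFormula.succ_left (hp : ‖p‖ < 1) (hp0 : p ≠ 0) (hq : ‖q‖ < 1) (hq0 : q ≠ 0)
    {n l m : ℕ} (ih : InsertionFormula p q n l m) : InsertionFormula p q n (l + 1) m := by
  intro t x' y ht0 ht1 hprod hx' hy
  obtain ⟨z, x, rfl⟩ : ∃ (z : ℂ) (x : Fin l → ℂ), x' = Fin.cons z x :=
    ⟨x' 0, Fin.tail x', (Fin.cons_self_tail x').symm⟩
  have hz : z ≠ 0 := by simpa using hx' 0
  have hx : ∀ i, x i ≠ 0 := fun i => by simpa using hx' i.succ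
  set c : Fin (2 * n + 4) → ℂ := Fin.snoc (α := fun _ => ℂ) (fun r : Fin (2 * n + 3) => (r : ℂ) + 1)
    (-∑ r : Fin (2 * n + 3), ((r : ℂ) + 1)) with hc
  have hcs : ∀ r : Fin (2 * n + 3), c r.castSucc = (r : ℂ) + 1 := fun r => by simp [hc]
  have hc0 : ∑ r, c r = 0 := by
    rw [Fin.sum_univ_castSucc]
    simp [hc]
  set T : ℂ → Fin (2 * n + 4) → ℂ := fun w r => t r * Complex.exp (c r * w) with hT
  set X : ℂ → Fin l → ℂ := fun w j => x j * Complex.exp (((n + 1 + j : ℕ) + 1 : ℂ) * w) with hX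
  have hTd : ∀ r, Differentiable ℂ fun w => T w r := fun r =>
    ((differentiable_id.const_mul _).cexp).const_mul _
  have hXd : ∀ r, Differentiable ℂ fun w => X w r := fun r =>
    ((differentiable_id.const_mul _).cexp).const_mul _
  have hT0 : ∀ w r, T w r ≠ 0 := fun w r => mul_ne_zero (ht0 r) (Complex.exp_ne_zero _)
  have hX0 : ∀ w r, X w r ≠ 0 := fun w r => mul_ne_zero (hx r) (Complex.exp_ne_zero _)
  have hTz : T 0 = t := by funext r; simp [hT]
  have hXz : X 0 = x := by funext r; simp [hX]
  have hTp : ∀ w, ∏ r, T w r = ∏ r, t r := fun w => by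
    simp only [hT]
    rw [Finset.prod_mul_distrib, ← Complex.exp_sum, ← Finset.sum_mul, hc0]
    simp
  set U : Set ℂ := {w | ∀ r, ‖T w r‖ < 1} with hU
  have hUo : IsOpen U := by
    have : U = ⋂ r, {w | ‖T w r‖ < 1} := by ext; simp [hU]
    rw [this]
    exact isOpen_iInter_of_finite fun r => isOpen_lt (hTd r).continuous.norm continuous_const
  have h0U : (0 : ℂ) ∈ U := fun r => by rw [hTz]; exact ht1 r
  have hZ0 : ∀ w r, (Fin.cons z (X w) : Fin (l + 1) → ℂ) r ≠ 0 := fun w =>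
    Fin.cases hz fun r => by simpa using hX0 w r
  have hZd : ∀ r, Differentiable ℂ fun w => (Fin.cons z (X w) : Fin (l + 1) → ℂ) r :=
    Fin.cases (by simp) fun r => by simpa using hXd r
  have hJ : ContinuousAt (fun w => thJ p q n (T w) (Fin.cons z (X w) : Fin (l + 1) → ℂ) y) 0 :=
    (differentiableOn_thJ hp hp0 hq hq0 n hUo (fun r => (hTd r).differentiableOn)
      (fun w _ => hT0 w) (fun w hw => hw) (fun r => (hZd r).differentiableOn) (fun w _ => hZ0 w)
      hy).continuousOn.continuousAt (hUo.mem_nhds h0U)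
  have hR : ContinuousAt (fun w => thR p q (T w)) 0 :=
    (differentiableOn_thR hp hq (fun r => (hTd r).differentiableOn)
      (fun w _ => hT0 w) (fun w hw => hw)).continuousOn.continuousAt (hUo.mem_nhds h0U)
  have hV : ContinuousAt (fun w => thV q (Fin.cons z (X w) : Fin (l + 1) → ℂ)) 0 :=
    continuousAt_thV hq (fun r => (hZd r).continuous.continuousAt) (hZ0 0)
  have hF : ContinuousAt (fun w => thF p q (n + m) (T w) (Fin.cons z (X w) : Fin (l + 1) → ℂ)) 0 :=
    continuousAt_thF hp0 hq _ (fun r => (hTd r).continuous.continuousAt) (hT0 0)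
      (fun r => (hZd r).continuous.continuousAt) (hZ0 0)
  have hG : ContinuousAt (fun w => thF q p (n + (l + 1)) (T w) y) 0 :=
    continuousAt_thF hq0 hp _ (fun r => (hTd r).continuous.continuousAt) (hT0 0)
      (fun _ => continuousAt_const) hy
  have e1 := ((hV.mul (continuousAt_const (y := thV p y))).mul hJ).tendsto.mono_left
    (nhdsWithin_le_nhds (s := {0}ᶜ))
  have e2 := ((((continuousAt_const (y := (-1 : ℂ) ^ ((l + 1) * m) * thC p q n)).mul hR).mul hF).mul
    hG).tendsto.mono_left (nhdsWithin_le_nhds (s := {0}ᶜ))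
  simp only [Pi.mul_apply, hTz, hXz] at e1 e2
  refine tendsto_nhds_unique_of_eventuallyEq e1 e2 ?_
  set A : Fin (n + 1 + l) → ℂ :=
    Fin.append (fun i : Fin (n + 1) => t (Fin.castSucc (Fin.castLE (by omega) i))) x with hA
  have hA0 : ∀ i, A i ≠ 0 := Fin.addCases (fun i => by simpa [hA] using ht0 _)
    fun i => by simpa [hA] using hx i
  set a : ℂ → Fin (n + 1 + l) → ℂ := fun w i => A i * Complex.exp (((i : ℕ) + 1 : ℂ) * w) with ha
  have ha' : ∀ w i, (∃ b, a w i = T w b) ∨ ∃ j, a w i = X w j := fun w => by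
    refine Fin.addCases (fun i => Or.inl ⟨Fin.castSucc (Fin.castLE (by omega) i), ?_⟩)
      fun i => Or.inr ⟨i, ?_⟩
    · simp only [ha, hA, hT, Fin.append_left, hcs, Fin.val_castAdd, Fin.val_castLE]
    · simp [ha, hA, hX]
  have g1 : ∀ i, ∀ᶠ w in 𝓝[≠] (0 : ℂ), ellTheta (a w i ^ 2) q ≠ 0 := fun i => by
    have hne : (2 * ((i : ℕ) + 1) : ℂ) ≠ 0 := by norm_cast
    filter_upwards [eventually_ellTheta_ne_zero hq (pow_ne_zero 2 (hA0 i)) hne] with w hw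
    convert hw using 2
    simp only [ha]
    rw [mul_pow, ← Complex.exp_nat_mul]
    push_cast
    ring_nf
  have g2 : ∀ i j, i < j → ∀ᶠ w in 𝓝[≠] (0 : ℂ), ellTheta (a w i * a w j) q ≠ 0 ∧
      ellTheta (a w i / a w j) q ≠ 0 := fun i j hij => by
    have hne1 : (((i : ℕ) + 1) + ((j : ℕ) + 1) : ℂ) ≠ 0 := by norm_cast
    have hne2 : (((i : ℕ) + 1) - ((j : ℕ) + 1) : ℂ) ≠ 0 := by
      rw [add_sub_add_right_eq_sub, sub_ne_zero]
      exact_mod_cast (Fin.lt_def.1 hij).ne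
    filter_upwards [eventually_ellTheta_ne_zero hq (mul_ne_zero (hA0 i) (hA0 j)) hne1,
      eventually_ellTheta_ne_zero hq (div_ne_zero (hA0 i) (hA0 j)) hne2] with w hw1 hw2
    constructor
    · convert hw1 using 2
      simp only [ha]
      rw [add_mul ((i : ℂ) + 1), Complex.exp_add]
      ring
    · convert hw2 using 2
      simp only [ha]
      rw [sub_mul, Complex.exp_sub, mul_div_mul_comm]
  filter_upwards [eventually_all.2 g1, eventually_all.2 fun i => eventually_all.2 fun j =>
    eventually_imp_distrib_left.2 (g2 i j), nhdsWithin_le_nhds (hUo.mem_nhds h0U)] with w w1 w2 hw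
  exact ih.cons_of_generic hp hp0 hq hq0 (hT0 w) hw (by rw [hTp, hprod]) (hX0 w) hy (by ring)
    (ha' w) w1 w2 hz

theorem InsertionFormula.swap (hp : ‖p‖ < 1) (hq : ‖q‖ < 1) {n l m : ℕ}
    (h : InsertionFormula p q n l m) : InsertionFormula q p n m l := by
  intro t x y ht0 ht1 hprod hx hy
  have h1 := h t y x ht0 ht1 (by rw [mul_comm (p ^ l), hprod, mul_comm]) hy hx
  have hR : thR q p t = thR p q t := by simp only [thR, ellGamma_symm hp hq]
  have hC : thC q p n = thC p q n := by rw [thC, thC, mul_comm (qPoch p)]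
  rw [← thJ_swap hp hq, hR, hC, mul_comm m l]
  linear_combination h1

theorem insertionFormula_zero (hp : ‖p‖ < 1) (hp0 : p ≠ 0) (hq : ‖q‖ < 1) (hq0 : q ≠ 0) (n : ℕ) :
    InsertionFormula p q n 0 0 := by
  intro t x y ht0 ht1 hprod _ _
  have h := thI_eq hp hp0 hq hq0 n rfl ht0 ht1 (by simpa using hprod)
  simpa [thV, thJ, thF, thI] using h

theorem insertionFormula (hp : ‖p‖ < 1) (hp0 : p ≠ 0) (hq : ‖q‖ < 1) (hq0 : q ≠ 0) (n l m : ℕ) :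
    InsertionFormula p q n l m := by
  induction l with
  | zero =>
    induction m with
    | zero => exact insertionFormula_zero hp hp0 hq hq0 n
    | succ m ih => exact ((ih.swap hp hq).succ_left hq hq0 hp hp0).swap hq hp
  | succ l ih => exact ih.succ_left hp hp0 hq hq0

end InsertionFormula

section Reduction

variable {p q : ℂ}

theorem ellTheta_pow_mul (hq : ‖q‖ < 1) (hq0 : q ≠ 0) (m : ℕ) {X : ℂ} (hX : X ≠ 0) :
    ellTheta (q ^ m * X) q =
      (-1) ^ m * (∏ k ∈ Finset.range m, q ^ k)⁻¹ * (X ^ m)⁻¹ * ellTheta X q := by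
  induction m with
  | zero => simp
  | succ m ih =>
    rw [pow_succ', mul_assoc, ellTheta_mul_nome hq hq0 (mul_ne_zero (pow_ne_zero _ hq0) hX), ih,
      Finset.prod_range_succ]
    simp only [mul_inv, pow_succ]
    ring

theorem norm_pow_mul_lt_one (hp : ‖p‖ < 1) (l : ℕ) {X : ℂ} (hX1 : ‖X‖ < 1) : ‖p ^ l * X‖ < 1 := by
  rw [norm_mul, norm_pow]
  exact mul_lt_one_of_nonneg_of_lt_one_right (pow_le_one₀ (norm_nonneg _) hp.le) (norm_nonneg _) hX1

theorem ellGamma_pow_mul_left (hp : ‖p‖ < 1) (hp0 : p ≠ 0) (hq : ‖q‖ < 1) (l : ℕ) {X : ℂ}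
    (hX : X ≠ 0) (hX1 : ‖X‖ < 1) :
    ellGamma (p ^ l * X) p q = (∏ k ∈ Finset.range l, ellTheta (p ^ k * X) q) * ellGamma X p q := by
  induction l with
  | zero => simp
  | succ l ih =>
    rw [pow_succ', mul_assoc, ellGamma_nome_mul hp hp0 hq (mul_ne_zero (pow_ne_zero _ hp0) hX)
      (qp1_ne_zero_of_norm_lt hq (norm_pow_mul_lt_one hp l hX1)), ih, Finset.prod_range_succ]
    ring

/-- The constant relating shifted elliptic Gamma functions and elliptic symbols. -/
noncomputable def shiftConst (p q : ℂ) (l m : ℕ) : ℂ :=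
  (-1) ^ (l * m) * (∏ k ∈ Finset.range m, q ^ k) ^ l * (∏ k ∈ Finset.range l, p ^ k) ^ m

theorem ellGamma_pow_mul_pow_mul (hp : ‖p‖ < 1) (hp0 : p ≠ 0) (hq : ‖q‖ < 1) (hq0 : q ≠ 0) (l m : ℕ)
    {X : ℂ} (hX : X ≠ 0) (hX1 : ‖X‖ < 1) :
    ellGamma (p ^ l * q ^ m * X) p q = shiftConst p q l m * X ^ (l * m) *
      ellThetaPQ (p * q / (p ^ l * q ^ m * X)) p q l m * ellGamma X p q := by
  have hp' : ∀ k, p ^ k ≠ 0 := fun k => pow_ne_zero _ hp0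
  have hq' : ∀ k, q ^ k ≠ 0 := fun k => pow_ne_zero _ hq0
  have hQ : ∏ k ∈ Finset.range m, q ^ k ≠ 0 := Finset.prod_ne_zero_iff.2 fun k _ => hq' k
  have e1 : ellGamma (p ^ l * q ^ m * X) p q = (∏ k ∈ Finset.range m, ellTheta (q ^ k * (p ^ l * X)) p) *
      ((∏ k ∈ Finset.range l, ellTheta (p ^ k * X) q) * ellGamma X p q) := by
    rw [show p ^ l * q ^ m * X = q ^ m * (p ^ l * X) by ring, ellGamma_symm hp hq,
      ellGamma_pow_mul_left hq hq0 hp m (mul_ne_zero (hp' l) hX) (norm_pow_mul_lt_one hp l hX1),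
      ellGamma_symm hq hp, ellGamma_pow_mul_left hp hp0 hq l hX hX1]
  have e2 : ∏ k ∈ Finset.range l, ellTheta (p ^ k * (p * q / (p ^ l * q ^ m * X))) q =
      ∏ k ∈ Finset.range l, ellTheta (q ^ m * (p ^ k * X)) q := by
    rw [← Finset.prod_range_reflect]
    refine Finset.prod_congr rfl fun k hk => ?_
    have hk := Finset.mem_range.1 hk
    rw [← ellTheta_nome_div hq hq0 (q ^ m * (p ^ k * X))]
    congr 1
    have h : p ^ l = p ^ (l - 1 - k) * p * p ^ k := by
      rw [← pow_succ, ← pow_add]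
      congr 1
      omega
    rw [h]
    have := hp' (l - 1 - k)
    have := hp' k
    field_simp
  have e3 : ∏ k ∈ Finset.range m, ellTheta (q ^ k * (p * q / (p ^ l * q ^ m * X))) p =
      ∏ k ∈ Finset.range m, ellTheta (q ^ k * (p ^ l * X)) p := by
    rw [← Finset.prod_range_reflect]
    refine Finset.prod_congr rfl fun k hk => ?_
    have hk := Finset.mem_range.1 hk
    rw [← ellTheta_nome_div hp hp0 (q ^ k * (p ^ l * X))]
    congr 1
    have h : q ^ m = q ^ (m - 1 - k) * q * q ^ k := by
      rw [← pow_succ, ← pow_add]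
      congr 1
      omega
    rw [h]
    have := hq' (m - 1 - k)
    have := hq' k
    field_simp
  have e4 : ∏ k ∈ Finset.range l, ellTheta (q ^ m * (p ^ k * X)) q =
      (-1) ^ (l * m) * ((∏ k ∈ Finset.range m, q ^ k) ^ l)⁻¹ *
        ((∏ k ∈ Finset.range l, p ^ k) ^ m)⁻¹ * (X ^ (l * m))⁻¹ *
        ∏ k ∈ Finset.range l, ellTheta (p ^ k * X) q := by
    rw [Finset.prod_congr rfl fun k _ => ellTheta_pow_mul hq hq0 m (mul_ne_zero (hp' k) hX)]
    simp only [Finset.prod_mul_distrib, Finset.prod_const, Finset.card_range, mul_pow,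
      Finset.prod_inv_distrib, mul_inv, Finset.prod_pow, inv_pow]
    rw [mul_comm l m, pow_mul, pow_mul]
    ring
  have hs : ((-1 : ℂ) ^ (l * m)) * (-1) ^ (l * m) = 1 := by rw [← mul_pow]; simp
  have hP : ∏ k ∈ Finset.range l, p ^ k ≠ 0 := Finset.prod_ne_zero_iff.2 fun k _ => hp' k
  have hX' : X ^ (l * m) ≠ 0 := pow_ne_zero _ hX
  rw [ellThetaPQ, e1, e2, e3, e4, shiftConst]
  generalize ∏ k ∈ Finset.range m, ellTheta (q ^ k * (p ^ l * X)) p = A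
  generalize ∏ k ∈ Finset.range l, ellTheta (p ^ k * X) q = B
  generalize ∏ k ∈ Finset.range m, q ^ k = Q at hQ ⊢
  generalize ∏ k ∈ Finset.range l, p ^ k = P at hP ⊢
  generalize X ^ (l * m) = Y at hX' ⊢
  generalize (-1 : ℂ) ^ (l * m) = s at hs ⊢
  field_simp
  linear_combination -(A * B * ellGamma X p q) * hs

theorem prod_range_pow_sq (q : ℂ) (m : ℕ) :
    (∏ k ∈ Finset.range m, q ^ k) ^ 2 * q ^ m = (q ^ m) ^ m := by
  rw [Finset.prod_pow_eq_pow_sum, ← pow_mul, Finset.sum_range_id_mul_two, ← pow_add, ← pow_mul]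
  congr 1
  cases m with
  | zero => rfl
  | succ m => simp; ring

theorem shiftConst_sq_mul (hp0 : p ≠ 0) (hq0 : q ≠ 0) (l m : ℕ) {P : ℂ} (hP : P * (p ^ l * q ^ m) = p * q) :
    shiftConst p q l m ^ 2 * P ^ (l * m) = 1 := by
  have h1 : shiftConst p q l m ^ 2 * (p * q) ^ (l * m) = (p ^ l * q ^ m) ^ (l * m) := by
    have hs : ((-1 : ℂ) ^ (l * m)) ^ 2 = 1 := by rw [← pow_mul, mul_comm, pow_mul]; simp
    have e1 := congrArg (· ^ l) (prod_range_pow_sq q m)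
    have e2 := congrArg (· ^ m) (prod_range_pow_sq p l)
    simp only [mul_pow] at e1 e2
    have e3 : (p ^ l * q ^ m) ^ (l * m) = ((p ^ l) ^ l) ^ m * ((q ^ m) ^ m) ^ l := by
      simp only [mul_pow, ← pow_mul]
      ring_nf
    rw [e3, ← e1, ← e2, shiftConst, mul_pow, mul_pow, hs]
    simp only [mul_pow, ← pow_mul]
    ring_nf
  have h2 : (p ^ l * q ^ m) ^ (l * m) ≠ 0 :=
    pow_ne_zero _ (mul_ne_zero (pow_ne_zero _ hp0) (pow_ne_zero _ hq0))
  apply mul_right_cancel₀ h2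
  rw [one_mul, mul_assoc, ← mul_pow, hP]
  exact h1

theorem countable_ellThetaPQ_eq_zero (hp : ‖p‖ < 1) (hp0 : p ≠ 0) (hq : ‖q‖ < 1) (hq0 : q ≠ 0) (l m : ℕ) :
    {z : ℂ | z ≠ 0 ∧ ellThetaPQ z p q l m = 0}.Countable := by
  refine ((countable_range fun k : ℕ × ℤ => q ^ k.2 / p ^ k.1).union
    (countable_range fun k : ℕ × ℤ => p ^ k.2 / q ^ k.1)).mono ?_
  rintro z ⟨hz, h⟩
  rcases mul_eq_zero.1 h with h | h
  · obtain ⟨k, -, hk⟩ := Finset.prod_eq_zero_iff.1 h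
    obtain ⟨j, hj⟩ := exists_zpow_of_ellTheta_eq_zero hq hq0 (mul_ne_zero (pow_ne_zero k hp0) hz) hk
    exact Or.inl ⟨(k, j), by simp only [← hj]; field_simp⟩
  · obtain ⟨k, -, hk⟩ := Finset.prod_eq_zero_iff.1 h
    obtain ⟨j, hj⟩ := exists_zpow_of_ellTheta_eq_zero hp hp0 (mul_ne_zero (pow_ne_zero k hq0) hz) hk
    exact Or.inr ⟨(k, j), by simp only [← hj]; field_simp⟩

theorem countable_preimage_exp_I_mul {S : Set ℂ} (hS : S.Countable) :
    {t : ℝ | Complex.exp (Complex.I * t) ∈ S}.Countable := by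
  have : {t : ℝ | Complex.exp (Complex.I * t) ∈ S} = ⋃ s ∈ S, {t : ℝ | Complex.exp (Complex.I * t) = s} := by
    ext t; simp
  rw [this]
  refine hS.biUnion fun s _ => ?_
  rcases Set.eq_empty_or_nonempty {t : ℝ | Complex.exp (Complex.I * t) = s} with h | ⟨t₀, ht₀⟩
  · rw [h]; exact countable_empty
  refine (countable_range fun k : ℤ => t₀ + k * (2 * Real.pi)).mono fun t ht => ?_
  have ht : Complex.exp (Complex.I * t) = s := ht
  have ht₀ : Complex.exp (Complex.I * t₀) = s := ht₀
  obtain ⟨k, hk⟩ := Complex.exp_eq_exp_iff_exists_int.1 (ht.trans ht₀.symm)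
  refine ⟨k, ?_⟩
  have : (t : ℂ) = t₀ + k * (2 * Real.pi) := by
    apply mul_left_cancel₀ Complex.I_ne_zero
    rw [hk]; ring
  exact_mod_cast this.symm

theorem torusInt_congr_of_countable {n : ℕ} {f g : (Fin n → ℂ) → ℂ} {S : Set ℂ} (hS : S.Countable)
    (h : ∀ z : Fin n → ℂ, (∀ i, ‖z i‖ = 1) → (∀ i, z i ∉ S) → f z = g z) :
    torusInt n f = torusInt n g := by
  rw [torusInt, torusInt]
  congr 1
  refine integral_congr_ae (ae_restrict_of_ae ?_)
  have hn : ∀ i : Fin n, ∀ᵐ t : Fin n → ℝ, Complex.exp (Complex.I * t i) ∉ S := fun i => by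
    have h1 : ∀ᵐ t : ℝ, Complex.exp (Complex.I * t) ∉ S :=
      (countable_preimage_exp_I_mul hS).ae_notMem volume
    exact (Measure.tendsto_eval_ae_ae (μ := fun _ : Fin n => (volume : Measure ℝ)) (i := i)).eventually h1
  filter_upwards [eventually_all.2 hn] with t ht
  exact h _ (fun i => norm_exp_I_mul _) ht

end Reduction

section Normalization

variable {p q : ℂ}

theorem Fin.prod_erase_zero {N : ℕ} (f : Fin (N + 1) → ℂ) :
    ∏ r ∈ Finset.univ.erase 0, f r = ∏ j : Fin N, f j.succ := by
  rw [Fin.univ_succ, Finset.erase_cons, Finset.prod_map]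
  rfl

theorem Fin.prod_ite_lt_eq_prod_Ioi {N : ℕ} (i : Fin N) (f : Fin N → ℂ) :
    (∏ j, if i < j then f j else 1) = ∏ j ∈ Finset.Ioi i, f j := by
  rw [← Finset.prod_filter, Finset.filter_lt_eq_Ioi]

theorem thSq_pw (hq : ‖q‖ < 1) {x : ℂ} (hx : x ≠ 0) (s : Bool) :
    thSq q (pw x s) = (if s then 1 else -1) * thSq q x := by
  cases s
  · simp only [pw, thSq, Bool.false_eq_true, if_false, inv_pow, inv_inv]
    rw [ellTheta_inv hq (pow_ne_zero 2 hx)]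
    field_simp
  · simp [pw]

theorem thP_pw_pw (hq : ‖q‖ < 1) {x y : ℂ} (hx : x ≠ 0) (hy : y ≠ 0) (s s' : Bool) :
    thP q (pw x s) (pw y s') = thP q x y := by
  rw [thP_pw]
  cases s
  · exact thP_inv_left hq hx hy
  · rfl

theorem thSq_ne_zero {x : ℂ} (hx : x ≠ 0) (h : ellTheta (x ^ 2) q ≠ 0) : thSq q x ≠ 0 :=
  mul_ne_zero (inv_ne_zero hx) h

theorem sign_mul_thg (hq : ‖q‖ < 1) (hq0 : q ≠ 0) (n m : ℕ) {N : ℕ} {b : ℂ} (hb : b ≠ 0)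
    (v : Fin N → ℂ) {x : ℂ} (hx : x ≠ 0) (hx2 : ellTheta (x ^ 2) q ≠ 0) (s : Bool) :
    (if s then 1 else -1) * thg q (n + m) (Fin.cons b v : Fin (N + 1) → ℂ) (pw x s) =
      thSq q x * ((-1) ^ m * (∏ k ∈ Finset.range m, q ^ k) * b ^ m) *
        ((ellTheta (q ^ m * b * pw x s) q * ∏ r, ellTheta (v r * pw x s) q) /
          (pw x s ^ n * ellTheta (pw x s ^ 2) q)) := by
  have h1 : (if s then (1 : ℂ) else -1) * thSq q (pw x s) = thSq q x := by
    rw [thSq_pw hq hx]; cases s <;> simp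
  have hX : pw x s ≠ 0 := pw_ne_zero hx s
  have hX2 : ellTheta (pw x s ^ 2) q ≠ 0 := by
    intro h
    apply thSq_ne_zero hx hx2
    rw [← h1, thSq, h, mul_zero, mul_zero]
  have hQ : ∏ k ∈ Finset.range m, q ^ k ≠ 0 :=
    Finset.prod_ne_zero_iff.2 fun k _ => pow_ne_zero _ hq0
  have hs : ((-1 : ℂ) ^ m) * (-1) ^ m = 1 := by rw [← mul_pow]; simp
  rw [← h1, mul_assoc (q ^ m), ellTheta_pow_mul hq hq0 m (mul_ne_zero hb hX), thg, thSq,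
    Fin.prod_univ_succ]
  simp only [Fin.cons_zero, Fin.cons_succ]
  generalize ∏ k ∈ Finset.range m, q ^ k = Q at hQ ⊢
  generalize pw x s = X at hX hX2 ⊢
  generalize ∏ r, ellTheta (v r * X) q = V
  generalize (if s then (1 : ℂ) else -1) = e
  generalize (-1 : ℂ) ^ m = w at hs ⊢
  field_simp
  linear_combination -(e * X * X ^ m * X ^ n * ellTheta (b * X) q * V * b ^ m) * hs

theorem thK_pw (hq : ‖q‖ < 1) {x y : ℂ} (hx : x ≠ 0) (hy : y ≠ 0) (h : thP q x y ≠ 0) (s s' : Bool) :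
    thK p q (pw x s) (pw y s') = thP q x y *
      (ellTheta (p * pw x s * pw y s') q / ellTheta (pw x s * pw y s') q) := by
  rw [← thP_pw_pw hq hx hy s s', thP] at h ⊢
  have h1 := (mul_ne_zero_iff.1 (mul_ne_zero_iff.1 h).2).1
  have h2 := pw_ne_zero hx s
  rw [thK, mul_assoc p]
  field_simp

theorem thF_eq_thV_mul_sum (hq : ‖q‖ < 1) (hq0 : q ≠ 0) (n m : ℕ) {N l : ℕ} {b : ℂ} (hb : b ≠ 0)
    (v : Fin N → ℂ) {x : Fin l → ℂ} (hx : ∀ i, x i ≠ 0) (hx2 : ∀ i, ellTheta (x i ^ 2) q ≠ 0)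
    (hxij : ∀ i j, i < j → thP q (x i) (x j) ≠ 0) :
    thF p q (n + m) (Fin.cons b v : Fin (N + 1) → ℂ) x =
      thV q x * ((-1) ^ m * (∏ k ∈ Finset.range m, q ^ k) * b ^ m) ^ l *
        ∑ σ : Fin l → Bool, ∏ i,
          ((ellTheta (q ^ m * b * pw (x i) (σ i)) q * ∏ r, ellTheta (v r * pw (x i) (σ i)) q) /
            (pw (x i) (σ i) ^ n * ellTheta (pw (x i) (σ i) ^ 2) q)) *
          ∏ j, if i < j then ellTheta (p * pw (x i) (σ i) * pw (x j) (σ j)) q /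
              ellTheta (pw (x i) (σ i) * pw (x j) (σ j)) q
            else 1 := by
  rw [thF, Finset.mul_sum]
  refine Finset.sum_congr rfl fun σ _ => ?_
  have h1 : ∏ i, ∏ j ∈ Finset.Ioi i, thK p q (pw (x i) (σ i)) (pw (x j) (σ j)) =
      (∏ i, ∏ j ∈ Finset.Ioi i, thP q (x i) (x j)) *
      ∏ i, ∏ j ∈ Finset.Ioi i, (ellTheta (p * pw (x i) (σ i) * pw (x j) (σ j)) q /
        ellTheta (pw (x i) (σ i) * pw (x j) (σ j)) q) := by
    simp only [← Finset.prod_mul_distrib]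
    exact Finset.prod_congr rfl fun i _ => Finset.prod_congr rfl fun j hj =>
      thK_pw hq (hx i) (hx j) (hxij i j (Finset.mem_Ioi.1 hj)) _ _
  rw [h1, Finset.prod_congr rfl fun i _ => sign_mul_thg hq hq0 n m hb v (hx i) (hx2 i) (σ i)]
  simp only [Fin.prod_ite_lt_eq_prod_Ioi, Finset.prod_mul_distrib, Finset.prod_const,
    Finset.card_univ, Fintype.card_fin, thV]
  ring

theorem inv_ellGamma_pair (hp : ‖p‖ < 1) (hq : ‖q‖ < 1) {a b : ℂ} (ha : ‖a‖ = 1) (hb : ‖b‖ = 1) :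
    (ellGamma (a * b) p q * ellGamma (a / b) p q * ellGamma (b / a) p q *
      ellGamma (1 / (a * b)) p q)⁻¹ = thP p a b * thP q a b := by
  have ha0 := ne_zero_of_norm_one ha
  have hb0 := ne_zero_of_norm_one hb
  have h1 := inv_ellGamma_mul_ellGamma_inv hp hq (x := a * b) (by rw [norm_mul, ha, hb, one_mul])
  have h2 := inv_ellGamma_mul_ellGamma_inv hp hq (x := a / b) (by rw [norm_div, ha, hb, div_one])
  have h3 := ellTheta_inv hp (mul_ne_zero ha0 hb0)
  have h4 := ellTheta_inv hp (div_ne_zero ha0 hb0)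
  rw [h3] at h1
  rw [h4, inv_div] at h2
  rw [one_div, show ellGamma (a * b) p q * ellGamma (a / b) p q * ellGamma (b / a) p q *
      ellGamma (a * b)⁻¹ p q = (ellGamma (a * b) p q * ellGamma (a * b)⁻¹ p q) *
      (ellGamma (a / b) p q * ellGamma (b / a) p q) by ring, mul_inv, h1, h2, thP, thP]
  field_simp

theorem inv_ellGamma_sq (hp : ‖p‖ < 1) (hq : ‖q‖ < 1) {z : ℂ} (hz : ‖z‖ = 1) :
    (ellGamma (z ^ 2) p q * ellGamma (1 / z ^ 2) p q)⁻¹ = ellTheta (z ^ 2) p * ellTheta (z⁻¹ ^ 2) q := by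
  rw [ellGamma_symm hp hq (z ^ 2), ellGamma_symm hp hq (1 / z ^ 2), one_div,
    inv_ellGamma_mul_ellGamma_inv hq hp (by rw [norm_pow, hz, one_pow]), inv_pow]

theorem ellGamma_pair_div_ellThetaPQ (hp : ‖p‖ < 1) (hp0 : p ≠ 0) (hq : ‖q‖ < 1) (hq0 : q ≠ 0)
    (l m : ℕ) {a b z : ℂ} (hb0 : b ≠ 0) (hb : ‖b‖ < 1) (ha : a = p ^ l * q ^ m * b) (hz : ‖z‖ = 1)
    (h1 : ellThetaPQ (p * q * z / a) p q l m ≠ 0) (h2 : ellThetaPQ (p * q / (z * a)) p q l m ≠ 0) :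
    ellGamma (a * z) p q * ellGamma (a / z) p q /
      (ellThetaPQ (p * q * z / a) p q l m * ellThetaPQ (p * q / (z * a)) p q l m) =
      (shiftConst p q l m ^ 2 * b ^ (2 * (l * m))) * (ellGamma (b * z) p q * ellGamma (b / z) p q) := by
  have hz0 := ne_zero_of_norm_one hz
  have hp' : p ^ l ≠ 0 := pow_ne_zero _ hp0
  have hq' : q ^ m ≠ 0 := pow_ne_zero _ hq0
  have e1 := ellGamma_pow_mul_pow_mul hp hp0 hq hq0 l m (X := b * z) (mul_ne_zero hb0 hz0)
    (by rwa [norm_mul, hz, mul_one])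
  have e2 := ellGamma_pow_mul_pow_mul hp hp0 hq hq0 l m (X := b / z) (div_ne_zero hb0 hz0)
    (by rwa [norm_div, hz, div_one])
  rw [show p ^ l * q ^ m * (b * z) = a * z by rw [ha]; ring, mul_comm a z] at e1
  rw [show p ^ l * q ^ m * (b / z) = a / z by rw [ha]; ring,
    show p * q / (a / z) = p * q * z / a by rw [ha]; field_simp] at e2
  rw [mul_comm a z, e1, e2, mul_pow, div_pow, show b ^ (2 * (l * m)) = (b ^ (l * m)) ^ 2 by rw [← pow_mul, mul_comm]]
  have hzp : z ^ (l * m) ≠ 0 := pow_ne_zero _ hz0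
  generalize z ^ (l * m) = w at hzp ⊢
  generalize b ^ (l * m) = w'
  field_simp

theorem torusInt_eq_thJ (hp : ‖p‖ < 1) (hp0 : p ≠ 0) (hq : ‖q‖ < 1) (hq0 : q ≠ 0) (n : ℕ) {N l m : ℕ}
    {u : Fin (N + 1) → ℂ} {b : ℂ} (hb0 : b ≠ 0) (hb : ‖b‖ < 1) (hu : u 0 = p ^ l * q ^ m * b)
    (x : Fin l → ℂ) (y : Fin m → ℂ) :
    torusInt n (fun z =>
        (∏ i, ((∏ j, (x j)⁻¹ * (ellTheta (x j * z i) q * ellTheta (x j / z i) q)) *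
            ∏ j, (y j)⁻¹ * (ellTheta (y j * z i) p * ellTheta (y j / z i) p)) /
          (ellThetaPQ (p * q * z i / u 0) p q l m * ellThetaPQ (p * q / (z i * u 0)) p q l m)) *
        ((∏ i, ∏ r, ellGamma (u r * z i) p q * ellGamma (u r / z i) p q) /
          ((∏ i, ∏ j, if i < j then
              ellGamma (z i * z j) p q * ellGamma (z i / z j) p q *
                ellGamma (z j / z i) p q * ellGamma (1 / (z i * z j)) p q
            else 1) *
            ∏ i, ellGamma (z i ^ 2) p q * ellGamma (1 / z i ^ 2) p q))) =
      (shiftConst p q l m ^ 2 * b ^ (2 * (l * m))) ^ n *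
        thJ p q n (Fin.cons b fun r => u r.succ : Fin (N + 1) → ℂ) x y := by
  have hu0 : u 0 ≠ 0 := by
    rw [hu]
    exact mul_ne_zero (mul_ne_zero (pow_ne_zero _ hp0) (pow_ne_zero _ hq0)) hb0
  have hpq := mul_ne_zero hp0 hq0
  have hC := countable_ellThetaPQ_eq_zero hp hp0 hq hq0 l m
  have hS : ((fun w => w * u 0 / (p * q)) '' {z | z ≠ 0 ∧ ellThetaPQ z p q l m = 0} ∪
      (fun w => p * q / (w * u 0)) '' {z | z ≠ 0 ∧ ellThetaPQ z p q l m = 0}).Countable :=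
    (hC.image _).union (hC.image _)
  rw [thJ, thAvg, ← torusInt_const_mul]
  refine torusInt_congr_of_countable hS fun z hz hzS => ?_
  have hz0 : ∀ i, z i ≠ 0 := fun i => ne_zero_of_norm_one (hz i)
  have hT : ∀ i, ellThetaPQ (p * q * z i / u 0) p q l m ≠ 0 ∧
      ellThetaPQ (p * q / (z i * u 0)) p q l m ≠ 0 := by
    refine fun i => ⟨fun h => hzS i (Or.inl ⟨_, ⟨?_, h⟩, ?_⟩), fun h => hzS i (Or.inr ⟨_, ⟨?_, h⟩, ?_⟩)⟩
    · exact div_ne_zero (mul_ne_zero hpq (hz0 i)) hu0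
    · field_simp
    · exact div_ne_zero hpq (mul_ne_zero (hz0 i) hu0)
    · have := hz0 i
      field_simp
  have e1 : (∏ i, ∏ j, if i < j then ellGamma (z i * z j) p q * ellGamma (z i / z j) p q *
      ellGamma (z j / z i) p q * ellGamma (1 / (z i * z j)) p q else 1)⁻¹ =
      ∏ i, ∏ j ∈ Finset.Ioi i, thP p (z i) (z j) * thP q (z i) (z j) := by
    simp only [Fin.prod_ite_lt_eq_prod_Ioi, ← Finset.prod_inv_distrib]
    exact Finset.prod_congr rfl fun i _ => Finset.prod_congr rfl fun j _ =>
      inv_ellGamma_pair hp hq (hz i) (hz j)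
  have e2 : (∏ i, ellGamma (z i ^ 2) p q * ellGamma (1 / z i ^ 2) p q)⁻¹ =
      ∏ i, ellTheta (z i ^ 2) p * ellTheta ((z i)⁻¹ ^ 2) q := by
    rw [← Finset.prod_inv_distrib]
    exact Finset.prod_congr rfl fun i _ => inv_ellGamma_sq hp hq (hz i)
  rw [div_eq_mul_inv _ (_ * _), mul_inv, e1, e2]
  have e3 : (∏ i, ((∏ j, (x j)⁻¹ * (ellTheta (x j * z i) q * ellTheta (x j / z i) q)) *
            ∏ j, (y j)⁻¹ * (ellTheta (y j * z i) p * ellTheta (y j / z i) p)) /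
          (ellThetaPQ (p * q * z i / u 0) p q l m * ellThetaPQ (p * q / (z i * u 0)) p q l m)) *
        ((∏ i, ∏ r, ellGamma (u r * z i) p q * ellGamma (u r / z i) p q) *
          ∏ i, ellTheta (z i ^ 2) p * ellTheta ((z i)⁻¹ ^ 2) q) =
      (shiftConst p q l m ^ 2 * b ^ (2 * (l * m))) ^ n * ∏ i, (∏ j, thP q (x j) (z i)) *
        (∏ j, thP p (y j) (z i)) * thW p q (Fin.cons b fun r => u r.succ : Fin (N + 1) → ℂ) (z i) := by
    rw [← Fin.prod_const, ← Finset.prod_mul_distrib, ← Finset.prod_mul_distrib,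
      ← Finset.prod_mul_distrib]
    refine Finset.prod_congr rfl fun i _ => ?_
    have h := ellGamma_pair_div_ellThetaPQ hp hp0 hq hq0 l m hb0 hb hu (hz i) (hT i).1 (hT i).2
    simp only [thP, thW, Fin.prod_univ_succ (n := N), Fin.cons_zero, Fin.cons_succ]
    rw [div_eq_mul_inv] at h ⊢
    generalize (_ * ellThetaPQ (p * q / (z i * u 0)) p q l m)⁻¹ = D at h ⊢
    linear_combination (∏ j, (x j)⁻¹ * (ellTheta (x j * z i) q * ellTheta (x j / z i) q)) *
      (∏ j, (y j)⁻¹ * (ellTheta (y j * z i) p * ellTheta (y j / z i) p)) *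
      (∏ r : Fin N, ellGamma (u r.succ * z i) p q * ellGamma (u r.succ / z i) p q) *
      (ellTheta (z i ^ 2) p * ellTheta ((z i)⁻¹ ^ 2) q) * h
  linear_combination (∏ i, ∏ j ∈ Finset.Ioi i, thP p (z i) (z j) * thP q (z i) (z j)) * e3

theorem prod_ellGamma_mul_inv_ellThetaPQ (hp : ‖p‖ < 1) (hp0 : p ≠ 0) (hq : ‖q‖ < 1) (hq0 : q ≠ 0)
    {N l m : ℕ} {u : Fin (N + 1) → ℂ} {b : ℂ} (hb0 : b ≠ 0) (hb : ‖b‖ < 1)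
    (hu : u 0 = p ^ l * q ^ m * b) (hu0 : ∀ r, u r ≠ 0) (hu1 : ∀ r, ‖u r‖ < 1)
    (hne : ∀ r, r ≠ 0 → ellThetaPQ (p * q / (u 0 * u r)) p q l m ≠ 0) :
    (∏ r, ∏ s, if r < s then ellGamma (u r * u s) p q else 1) *
        (∏ r ∈ Finset.univ.erase 0, (ellThetaPQ (p * q / (u 0 * u r)) p q l m)⁻¹) =
      shiftConst p q l m ^ N * (b ^ N * ∏ r : Fin N, u r.succ) ^ (l * m) *
        thR p q (Fin.cons b fun r => u r.succ : Fin (N + 1) → ℂ) := by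
  have e1 : (∏ r, ∏ s, if r < s then ellGamma (u r * u s) p q else 1) =
      (∏ r : Fin N, ellGamma (u 0 * u r.succ) p q) * thR p q fun r : Fin N => u r.succ := by
    simp only [Fin.prod_ite_lt_eq_prod_Ioi]
    rw [Fin.prod_univ_succ, Fin.prod_Ioi_zero]
    simp [Fin.prod_Ioi_succ, thR]
  rw [e1, Fin.prod_erase_zero, thR_cons, mul_right_comm, ← mul_assoc]
  congr 1
  have e2 : (b ^ N * ∏ r : Fin N, u r.succ) ^ (l * m) = ∏ r : Fin N, (b * u r.succ) ^ (l * m) := by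
    rw [Finset.prod_pow, Finset.prod_mul_distrib, Fin.prod_const]
  rw [e2, ← Fin.prod_const, ← Finset.prod_mul_distrib, ← Finset.prod_mul_distrib,
    ← Finset.prod_mul_distrib]
  refine Finset.prod_congr rfl fun r _ => ?_
  have h := ellGamma_pow_mul_pow_mul hp hp0 hq hq0 l m (mul_ne_zero hb0 (hu0 r.succ))
    (norm_mul_lt_one hb (hu1 r.succ))
  rw [← mul_assoc, ← hu] at h
  have h0 := hne r.succ (Fin.succ_ne_zero r)
  rw [h]
  generalize ellThetaPQ (p * q / (u 0 * u r.succ)) p q l m = T at h0 ⊢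
  field_simp

end Normalization

theorem thV_ne_zero {q : ℂ} {l : ℕ} {x : Fin l → ℂ} (hx : ∀ i, x i ≠ 0)
    (hx2 : ∀ i, ellTheta (x i ^ 2) q ≠ 0) (hxij : ∀ i j, i < j → thP q (x i) (x j) ≠ 0) :
    thV q x ≠ 0 :=
  mul_ne_zero (Finset.prod_ne_zero_iff.2 fun i _ => thSq_ne_zero (hx i) (hx2 i))
    (Finset.prod_ne_zero_iff.2 fun i _ => Finset.prod_ne_zero_iff.2 fun j hj =>
      hxij i j (Finset.mem_Ioi.1 hj))

end EllipticHelpers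

/-- Theorem: the image of a spanning set under the Type I integral operator. -/
theorem int_op_main (n l m : ℕ) (p q : ℂ)
    (hp0 : 0 < ‖p‖) (hp1 : ‖p‖ < 1)
    (hq0 : 0 < ‖q‖) (hq1 : ‖q‖ < 1)
    (u : Fin (2 * n + 4) → ℂ) (hu0 : ∀ r, u r ≠ 0)
    (hbal : ∏ r, u r = p * q)
    (hu1 : ∀ r, ‖u r‖ < 1)
    (hu0small : ‖u 0‖ < ‖p‖ ^ l * ‖q‖ ^ m)
    (x : Fin l → ℂ) (y : Fin m → ℂ)
    (hx0 : ∀ i, x i ≠ 0) (hy0 : ∀ i, y i ≠ 0)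
    (hx2 : ∀ i, ellTheta (x i ^ 2) q ≠ 0)
    (hxij : ∀ i j, i < j → ellTheta (x i * x j) q ≠ 0 ∧ ellTheta (x i / x j) q ≠ 0)
    (hy2 : ∀ i, ellTheta (y i ^ 2) p ≠ 0)
    (hyij : ∀ i j, i < j → ellTheta (y i * y j) p ≠ 0 ∧ ellTheta (y i / y j) p ≠ 0)
    (hne : ∀ r : Fin (2 * n + 4), r ≠ 0 → ellThetaPQ (p * q / (u 0 * u r)) p q l m ≠ 0) :
    (qPoch p * qPoch q) ^ n / ((2 ^ n * n.factorial : ℕ) : ℂ) *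
      torusInt n (fun z =>
        (∏ i, ((∏ j, (x j)⁻¹ * (ellTheta (x j * z i) q * ellTheta (x j / z i) q)) *
            ∏ j, (y j)⁻¹ * (ellTheta (y j * z i) p * ellTheta (y j / z i) p)) /
          (ellThetaPQ (p * q * z i / u 0) p q l m * ellThetaPQ (p * q / (z i * u 0)) p q l m)) *
        ((∏ i, ∏ r, ellGamma (u r * z i) p q * ellGamma (u r / z i) p q) /
          ((∏ i, ∏ j, if i < j then
              ellGamma (z i * z j) p q * ellGamma (z i / z j) p q *
                ellGamma (z j / z i) p q * ellGamma (1 / (z i * z j)) p q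
            else 1) *
            ∏ i, ellGamma (z i ^ 2) p q * ellGamma (1 / z i ^ 2) p q))) =
      (∏ r, ∏ s, if r < s then ellGamma (u r * u s) p q else 1) *
        (∏ r ∈ Finset.univ.erase (0 : Fin (2 * n + 4)),
          (ellThetaPQ (p * q / (u 0 * u r)) p q l m)⁻¹) *
        (∑ σ : Fin l → Bool, ∏ i,
          ((ellTheta (p ^ (-(l : ℤ)) * u 0 * pw (x i) (σ i)) q *
              ∏ r ∈ Finset.univ.erase (0 : Fin (2 * n + 4)),
                ellTheta (u r * pw (x i) (σ i)) q) /
            (pw (x i) (σ i) ^ n * ellTheta (pw (x i) (σ i) ^ 2) q)) *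
          ∏ j, if i < j then
            ellTheta (p * pw (x i) (σ i) * pw (x j) (σ j)) q /
              ellTheta (pw (x i) (σ i) * pw (x j) (σ j)) q
          else 1) *
        (∑ σ : Fin m → Bool, ∏ i,
          ((ellTheta (q ^ (-(m : ℤ)) * u 0 * pw (y i) (σ i)) p *
              ∏ r ∈ Finset.univ.erase (0 : Fin (2 * n + 4)),
                ellTheta (u r * pw (y i) (σ i)) p) /
            (pw (y i) (σ i) ^ n * ellTheta (pw (y i) (σ i) ^ 2) p)) *
          ∏ j, if i < j then
            ellTheta (q * pw (y i) (σ i) * pw (y j) (σ j)) p /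
              ellTheta (pw (y i) (σ i) * pw (y j) (σ j)) p
          else 1) := by
  have hp := norm_pos_iff.1 hp0
  have hq := norm_pos_iff.1 hq0
  have hpl : p ^ l ≠ 0 := pow_ne_zero _ hp
  have hqm : q ^ m ≠ 0 := pow_ne_zero _ hq
  obtain ⟨b, hb⟩ : ∃ b, u 0 = p ^ l * q ^ m * b := ⟨(p ^ l * q ^ m)⁻¹ * u 0, by field_simp⟩
  have hb0 : b ≠ 0 := by
    rintro rfl
    exact hu0 0 (by rw [hb, mul_zero])
  have hb1 : ‖b‖ < 1 := by
    rw [hb, norm_mul, norm_mul, norm_pow, norm_pow] at hu0small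
    exact lt_of_mul_lt_mul_left (by rwa [mul_one]) (mul_pos (pow_pos hp0 l) (pow_pos hq0 m)).le
  have hprod : (b * ∏ r : Fin (2 * n + 3), u r.succ) * (p ^ l * q ^ m) = p * q := by
    rw [← hbal, Fin.prod_univ_succ (n := 2 * n + 3) u, hb]
    ring
  have hxP : ∀ i j, i < j → thP q (x i) (x j) ≠ 0 := fun i j hij =>
    thP_ne_zero (hx0 i) (hxij i j hij).1 (hxij i j hij).2
  have hyP : ∀ i j, i < j → thP p (y i) (y j) ≠ 0 := fun i j hij =>
    thP_ne_zero (hy0 i) (hyij i j hij).1 (hyij i j hij).2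
  have hF := insertionFormula hp1 hp hq1 hq n l m
    (Fin.cons b fun r : Fin (2 * n + 3) => u r.succ : Fin (2 * n + 4) → ℂ) x y
    (Fin.cases hb0 fun r => hu0 r.succ) (Fin.cases hb1 fun r => hu1 r.succ)
    (by simpa [Fin.prod_univ_succ (n := 2 * n + 3)] using hprod) hx0 hy0
  rw [thF_eq_thV_mul_sum hq1 hq n m hb0 _ hx0 hx2 hxP,
    thF_eq_thV_mul_sum hp1 hp n l hb0 _ hy0 hy2 hyP] at hF
  have hκ := shiftConst_sq_mul hp hq l m hprod
  rw [torusInt_eq_thJ hp1 hp hq1 hq n hb0 hb1 hb x y,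
    prod_ellGamma_mul_inv_ellThetaPQ hp1 hp hq1 hq hb0 hb1 hb hu0 hu1 hne,
    show p ^ (-(l : ℤ)) * u 0 = q ^ m * b by rw [hb, zpow_neg, zpow_natCast]; field_simp,
    show q ^ (-(m : ℤ)) * u 0 = p ^ l * b by rw [hb, zpow_neg, zpow_natCast]; field_simp]
  simp only [Fin.prod_erase_zero (N := 2 * n + 3)]
  have hVx := thV_ne_zero hx0 hx2 hxP
  have hVy := thV_ne_zero hy0 hy2 hyP
  have hs : ((-1 : ℂ) ^ (l * m)) ^ 2 = 1 := by rw [← pow_mul, mul_comm, pow_mul]; simp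
  have hC : (qPoch p * qPoch q) ^ n / ((2 ^ n * n.factorial : ℕ) : ℂ) * thC p q n = 1 := by
    have h1 := qPoch_ne_zero hp1
    have h2 := qPoch_ne_zero hq1
    have h3 : (n.factorial : ℂ) ≠ 0 := Nat.cast_ne_zero.2 n.factorial_ne_zero
    rw [thC]
    push_cast
    field_simp
  have hc : (-1) ^ (l * m) * (((-1) ^ m * (∏ k ∈ Finset.range m, q ^ k) * b ^ m) ^ l *
      ((-1) ^ l * (∏ k ∈ Finset.range l, p ^ k) * b ^ l) ^ m) =
      shiftConst p q l m * b ^ (2 * (l * m)) := by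
    rw [shiftConst]
    simp only [mul_pow, ← pow_mul, mul_comm m l]
    linear_combination (-1) ^ (l * m) * (∏ k ∈ Finset.range m, q ^ k) ^ l *
      (∏ k ∈ Finset.range l, p ^ k) ^ m * b ^ (2 * (l * m)) * hs
  generalize ((-1) ^ m * (∏ k ∈ Finset.range m, q ^ k) * b ^ m) ^ l = cx at hF hc
  generalize ((-1) ^ l * (∏ k ∈ Finset.range l, p ^ k) * b ^ l) ^ m = cy at hF hc
  generalize (∑ σ : Fin l → Bool, _ : ℂ) = Sx at hF ⊢
  generalize (∑ σ : Fin m → Bool, _ : ℂ) = Sy at hF ⊢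
  generalize thJ p q n _ x y = J at hF ⊢
  generalize thR p q _ = R at hF ⊢
  have hJ : J = shiftConst p q l m * b ^ (2 * (l * m)) * thC p q n * R * Sx * Sy := by
    apply mul_left_cancel₀ (mul_ne_zero hVx hVy)
    rw [hF, ← hc]
    ring
  generalize (qPoch p * qPoch q) ^ n / ((2 ^ n * n.factorial : ℕ) : ℂ) = C' at hC ⊢
  have hb' : (b ^ (2 * n + 3) * ∏ r : Fin (2 * n + 3), u r.succ) ^ (l * m) =
      (b ^ (2 * (l * m))) ^ (n + 1) * (b * ∏ r : Fin (2 * n + 3), u r.succ) ^ (l * m) := by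
    simp only [mul_pow, ← pow_mul]
    ring
  rw [hJ, hb']
  generalize b ^ (2 * (l * m)) = B
  generalize (b * ∏ r : Fin (2 * n + 3), u r.succ) ^ (l * m) = P at hκ ⊢
  linear_combination (shiftConst p q l m ^ 2 * B) ^ n * shiftConst p q l m * B * R * Sx * Sy * hC -
    shiftConst p q l m ^ (2 * n + 1) * B ^ (n + 1) * R * Sx * Sy * hκ
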